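/- There exists a constant C₀ > 0 (depending only on λ and the aspect-ratio constants) such that for every admissible realization of the exploration at stage k, every choice of prescribed values x_{N,v} with |x_{N,v}| ≤ λ + 1/N for v ∈ B₀, λ < x_{N,v} ≤ λ + 1/N for v ∈ B^{=λ}_k, and −λ − 1/N ≤ x_{N,v} < −λ for v ∈ B^{=−λ}_k, and every v ∈ J₃, one has E( η̃'_{N,v} | H_=, H₊, H₋ ) ≤ λ + 1/N + C₀. -/

import Mathlib

open MeasureTheory ProbabilityTheory Set

attribute [local instance] Classical.propDecidable

noncomputable section

def box (N : ℕ) : Finset (ℤ × ℤ) :=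
  Finset.Icc (-(((N : ℤ) - 1) / 2)) ((N : ℤ) / 2) ×ˢ
    Finset.Icc (-(((N : ℤ) - 1) / 2)) ((N : ℤ) / 2)

def boxR (x : ℝ) : Finset (ℤ × ℤ) := box ⌊x⌋₊

def adj (u v : ℤ × ℤ) : Prop := |u.1 - v.1| + |u.2 - v.2| = 1

def nbrs (u : ℤ × ℤ) : Finset (ℤ × ℤ) :=
  {(u.1 + 1, u.2), (u.1 - 1, u.2), (u.1, u.2 + 1), (u.1, u.2 - 1)}

def bdry (N : ℕ) : Finset (ℤ × ℤ) :=
  (box N).filter fun v => ∃ u ∈ nbrs v, u ∉ box N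

def bdryR (x : ℝ) : Finset (ℤ × ℤ) := bdry ⌊x⌋₊

def killedStep (K : Set (ℤ × ℤ)) : ℕ → (ℤ × ℤ) → (ℤ × ℤ) → ℝ
  | 0, u, v => if u = v ∧ u ∉ K then 1 else 0
  | n + 1, u, v => if u ∈ K then 0 else (1 / 4) * ∑ w ∈ nbrs u, killedStep K n w v

def greenK (K : Set (ℤ × ℤ)) (u v : ℤ × ℤ) : ℝ := ∑' n, killedStep K n u v

def green (N : ℕ) (u v : ℤ × ℤ) : ℝ := greenK (↑(bdry N)) u v

def hitStep (A : Set (ℤ × ℤ)) : ℕ → (ℤ × ℤ) → (ℤ × ℤ) → ℝ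
  | 0, v, u => if v = u ∧ v ∈ A then 1 else 0
  | n + 1, v, u => if v ∈ A then 0 else (1 / 4) * ∑ w ∈ nbrs v, hitStep A n w u

def hm (v u : ℤ × ℤ) (A : Set (ℤ × ℤ)) : ℝ := ∑' n, hitStep A n v u

def hmSet (v : ℤ × ℤ) (B A : Set (ℤ × ℤ)) : ℝ := ∑' u : B, hm v (↑u) A

def IsGaussFam {Ω ι : Type*} [MeasurableSpace Ω] (P : Measure Ω)
    (f : ι → Ω → ℝ) (K : ι → ι → ℝ) (S : Set ι) : Prop :=
  (∀ i, Measurable (f i)) ∧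
  ∀ l : ι →₀ ℝ, ↑l.support ⊆ S →
    P.map (fun ω => ∑ i ∈ l.support, l i * f i ω) =
      gaussianReal 0 (∑ i ∈ l.support, ∑ j ∈ l.support, l i * l j * K i j).toNNReal

def gffCov (N : ℕ) (u v : ℤ × ℤ) : ℝ :=
  if u ∈ box N ∧ v ∈ box N then (1 / 4) * green N u v else 0

def IsGFF {Ω : Type*} [MeasurableSpace Ω] (N : ℕ) (P : Measure Ω)
    (η : ℤ × ℤ → Ω → ℝ) : Prop :=
  IsGaussFam P η (gffCov N) Set.univ

def IsPath (H : Set (ℤ × ℤ)) (u v : ℤ × ℤ) (n : ℕ) (p : ℕ → ℤ × ℤ) : Prop :=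
  p 0 = u ∧ p n = v ∧ (∀ i ≤ n, p i ∈ H) ∧ ∀ i < n, adj (p i) (p (i + 1))

def ConnLe (H : Set (ℤ × ℤ)) (A B : Set (ℤ × ℤ)) (t : ℝ) : Prop :=
  ∃ n : ℕ, (n : ℝ) ≤ t ∧ ∃ u ∈ A, ∃ v ∈ B, ∃ p, IsPath H u v n p

def DistGe (H : Set (ℤ × ℤ)) (A B : Set (ℤ × ℤ)) (t : ℝ) : Prop :=
  ∀ n : ℕ, ∀ u ∈ A, ∀ v ∈ B, ∀ p, IsPath H u v n p → t ≤ (n : ℝ)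

def bridgeCov (T s t : ℝ) : ℝ := 2 * (min s t - s * t / T)

def edgeLen (b : Bool) : ℝ := if b then 4 else 4 / 7

abbrev M2Idx : Type := (ℤ × ℤ) ⊕ ((ℤ × ℤ) × (ℤ × ℤ) × Bool × ℝ)

def m2Cov (N : ℕ) : M2Idx → M2Idx → ℝ
  | .inl u, .inl v => gffCov N u v
  | .inr ⟨u, v, b, s⟩, .inr ⟨u', v', b', t⟩ =>
      if b = b' then
        (if u = u' ∧ v = v' then bridgeCov (edgeLen b) s t
         else if u = v' ∧ v = u' then bridgeCov (edgeLen b) s (edgeLen b - t)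
         else 0)
      else 0
  | _, _ => 0

def m2Valid (N : ℕ) : Set M2Idx :=
  {i | match i with
       | .inl u => u ∈ box N
       | .inr ⟨u, v, b, t⟩ =>
           u ∈ box N ∧ v ∈ box N ∧ adj u v ∧ t ∈ Set.Icc (0 : ℝ) (edgeLen b)}

def m2fam {Ω : Type*} (η : ℤ × ℤ → Ω → ℝ)
    (brg : (ℤ × ℤ) → (ℤ × ℤ) → Bool → ℝ → Ω → ℝ) : M2Idx → Ω → ℝ
  | .inl u => η u
  | .inr ⟨u, v, b, t⟩ => brg u v b t

def mval2 {Ω : Type*} (η : ℤ × ℤ → Ω → ℝ) (brg : (ℤ × ℤ) → (ℤ × ℤ) → Bool → ℝ → Ω → ℝ)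
    (u v : ℤ × ℤ) (b : Bool) (t : ℝ) (ω : Ω) : ℝ :=
  (1 - t / edgeLen b) * η u ω + (t / edgeLen b) * η v ω + brg u v b t ω

def IsMetricGFF2 {Ω : Type*} [MeasurableSpace Ω] (N : ℕ) (P : Measure Ω)
    (η : ℤ × ℤ → Ω → ℝ) (brg : (ℤ × ℤ) → (ℤ × ℤ) → Bool → ℝ → Ω → ℝ) : Prop :=
  IsGaussFam P (m2fam η brg) (m2Cov N) (m2Valid N) ∧
  (∀ u v b ω, brg u v b 0 ω = 0) ∧
  (∀ u v b ω, brg u v b (edgeLen b) ω = 0) ∧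
  (∀ u v b t ω, brg u v b t ω = brg v u b (edgeLen b - t) ω) ∧
  (∀ u v b ω, ContinuousOn (fun t => brg u v b t ω) (Set.Icc 0 (edgeLen b)))

abbrev PPt : Type := (ℤ × ℤ) × (ℤ × ℤ) × ℕ

def pValid (N : ℕ) (q : PPt) : Prop :=
  q.1 ∈ box N ∧ q.2.1 ∈ box N ∧ adj q.1 q.2.1 ∧ q.2.2 ≤ N ^ 3

def pval {Ω : Type*} (N : ℕ) (η : ℤ × ℤ → Ω → ℝ)
    (brg : (ℤ × ℤ) → (ℤ × ℤ) → Bool → ℝ → Ω → ℝ) (q : PPt) (ω : Ω) : ℝ :=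
  mval2 η brg q.1 q.2.1 true (4 * (q.2.2 : ℝ) / (N : ℝ) ^ 3) ω

def outsideAlpha (α : ℝ) (N : ℕ) (q : PPt) : Prop :=
  ¬(q.1 ∈ boxR (α * N) ∧ q.2.1 ∈ boxR (α * N))

def eventH {Ω : Type*} (N : ℕ) (η : ℤ × ℤ → Ω → ℝ)
    (brg : (ℤ × ℤ) → (ℤ × ℤ) → Bool → ℝ → Ω → ℝ) (lam : ℝ) (Ip Im : Finset PPt) :
    Set Ω :=
  {ω | (∀ q ∈ Ip, lam + 1 / N < pval N η brg q ω) ∧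
       ∀ q ∈ Im, pval N η brg q ω < -(lam + 1 / N)}

def eventRng {Ω : Type*} (N : ℕ) (η : ℤ × ℤ → Ω → ℝ)
    (brg : (ℤ × ℤ) → (ℤ × ℤ) → Bool → ℝ → Ω → ℝ) (lam : ℝ) (B0 : Finset (ℤ × ℤ))
    (Bp Bm : Finset PPt) : Set Ω :=
  {ω | (∀ x ∈ B0, |η x ω| ≤ lam + 1 / N) ∧
       (∀ q ∈ Bp, lam < pval N η brg q ω ∧ pval N η brg q ω ≤ lam + 1 / N) ∧
       ∀ q ∈ Bm, -(lam + 1 / N) ≤ pval N η brg q ω ∧ pval N η brg q ω < -lam}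

def condSigma {Ω : Type*} [MeasurableSpace Ω] (N : ℕ) (η : ℤ × ℤ → Ω → ℝ)
    (brg : (ℤ × ℤ) → (ℤ × ℤ) → Bool → ℝ → Ω → ℝ) (B0 : Finset (ℤ × ℤ))
    (Bp Bm : Finset PPt) : MeasurableSpace Ω :=
  MeasurableSpace.comap
    (fun ω => ((fun x : {x // x ∈ B0} => η x.1 ω),
               (fun q : {q // q ∈ Bp ∪ Bm} => pval N η brg q.1 ω)))
    inferInstance

theorem ff_aux (x y p q : ENNReal) (hx : x ≤ p) (hy : y ≤ p) (h : x * y ≤ p * q) :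
    x + y ≤ p + q := by
  rcases eq_or_ne p ⊤ with rfl | hp
  · simp
  rcases eq_or_ne q ⊤ with rfl | hq
  · simp
  lift p to NNReal using hp
  lift q to NNReal using hq
  lift x to NNReal using (ne_top_of_le_ne_top ENNReal.coe_ne_top hx)
  lift y to NNReal using (ne_top_of_le_ne_top ENNReal.coe_ne_top hy)
  norm_cast at *
  rw [← NNReal.coe_le_coe] at *
  push_cast at *
  have := x.2; have := y.2; have := q.2
  rcases eq_or_lt_of_le p.2 with h0 | h0
  · have h0' : (p:ℝ) = 0 := h0.symm
    have : 0 ≤ (q:ℝ) := q.2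
    linarith
  · have h0' : 0 < (p:ℝ) := h0
    by_contra hc
    push Not at hc
    nlinarith

theorem ff_one (a b c d : ℝ → ENNReal) (ha : Measurable a) (hb : Measurable b)
    (hc : Measurable c) (hd : Measurable d)
    (h : ∀ x y, a x * b y ≤ c (x ⊔ y) * d (x ⊓ y)) :
    (∫⁻ x, a x) * (∫⁻ x, b x) ≤ (∫⁻ x, c x) * (∫⁻ x, d x) := by
  have key : ∀ x y, a x * b y + a y * b x ≤ c x * d y + c y * d x := by
    have main : ∀ x y, y ≤ x → a x * b y + a y * b x ≤ c x * d y + c y * d x := by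
      intro x y hxy
      apply ff_aux
      · simpa [hxy] using h x y
      · simpa [hxy] using h y x
      · calc a x * b y * (a y * b x) = (a x * b x) * (a y * b y) := by ring
          _ ≤ (c x * d x) * (c y * d y) :=
            mul_le_mul' (by simpa using h x x) (by simpa using h y y)
          _ = _ := by ring
    intro x y
    rcases le_total y x with hxy | hxy
    · exact main x y hxy
    · rw [add_comm (a x * b y), add_comm (c x * d y)]; exact main y x hxy
  have e : ∀ f g : ℝ → ENNReal, Measurable f → Measurable g →
      ∫⁻ x, ∫⁻ y, (f x * g y + f y * g x) = 2 * ((∫⁻ x, f x) * ∫⁻ x, g x) := by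
    intro f g hf hg
    have : ∀ x, ∫⁻ y, (f x * g y + f y * g x) = f x * (∫⁻ y, g y) + (∫⁻ y, f y) * g x := by
      intro x
      rw [lintegral_add_left (by fun_prop), lintegral_const_mul _ hg, lintegral_mul_const _ hf]
    simp_rw [this]
    rw [lintegral_add_left (by fun_prop), lintegral_const_mul _ hg, lintegral_mul_const _ hf]
    ring
  have h2 : 2 * ((∫⁻ x, a x) * ∫⁻ x, b x) ≤ 2 * ((∫⁻ x, c x) * ∫⁻ x, d x) := by
    rw [← e a b ha hb, ← e c d hc hd]
    exact lintegral_mono fun x => lintegral_mono fun y => key x y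
  exact (ENNReal.mul_le_mul_iff_right (by norm_num) (by norm_num)).1 h2

theorem ff_marg {X : Type} [Fintype X] [DecidableEq X] (a b c d : (X → ℝ) → ENNReal)
    (ha : Measurable a) (hb : Measurable b)
    (hc : Measurable c) (hd : Measurable d)
    (h : ∀ x y, a x * b y ≤ c (x ⊔ y) * d (x ⊓ y)) (s : Finset X) :
    ∀ x y, (∫⋯∫⁻_s, a ∂(fun _ => volume)) x * (∫⋯∫⁻_s, b ∂(fun _ => volume)) y ≤
      (∫⋯∫⁻_s, c ∂(fun _ => volume)) (x ⊔ y) * (∫⋯∫⁻_s, d ∂(fun _ => volume)) (x ⊓ y) := by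
  induction s using Finset.induction_on with
  | empty => simpa using h
  | insert i s hi ih =>
    intro x y
    rw [lmarginal_insert _ ha hi, lmarginal_insert _ hb hi, lmarginal_insert _ hc hi,
      lmarginal_insert _ hd hi]
    apply ff_one
    · exact (ha.lmarginal _).comp (measurable_update x)
    · exact (hb.lmarginal _).comp (measurable_update y)
    · exact (hc.lmarginal _).comp (measurable_update _)
    · exact (hd.lmarginal _).comp (measurable_update _)
    intro s t
    have e1 : Function.update (x ⊔ y) i (s ⊔ t) =
        Function.update x i s ⊔ Function.update y i t := by
      ext j; by_cases hj : j = i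
      · subst hj; simp
      · simp [hj]
    have e2 : Function.update (x ⊓ y) i (s ⊓ t) =
        Function.update x i s ⊓ Function.update y i t := by
      ext j; by_cases hj : j = i
      · subst hj; simp
      · simp [hj]
    rw [e1, e2]
    exact ih _ _

def IsG {ι : Type} [Fintype ι] (ν : Measure (ι → ℝ)) (q : (ι → ℝ) → ℝ) : Prop :=
  ∀ c : ι → ℝ, ν.map (fun x => ∑ i, c i * x i) = gaussianReal 0 (q c).toNNReal

theorem IsG.prob {ι : Type} [Fintype ι] {ν : Measure (ι → ℝ)} {q : (ι → ℝ) → ℝ}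
    (h : IsG ν q) : IsProbabilityMeasure ν := by
  have := h 0
  have h2 : IsProbabilityMeasure (ν.map (fun x : ι → ℝ => ∑ i, (0 : ι → ℝ) i * x i)) := by
    rw [this]; infer_instance
  exact Measure.isProbabilityMeasure_of_map (fun x : ι → ℝ => ∑ i, (0 : ι → ℝ) i * x i)

theorem IsG.uniq {ι : Type} [Fintype ι] {ν ν' : Measure (ι → ℝ)} {q : (ι → ℝ) → ℝ}
    (h : IsG ν q) (h' : IsG ν' q) : ν = ν' := by
  have := h.prob
  have := h'.prob
  apply Measure.ext_of_charFunDual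
  ext L
  rw [charFunDual_eq_charFun_map_one, charFunDual_eq_charFun_map_one]
  have e : (L : (ι → ℝ) → ℝ) = fun x => ∑ i, (L (Pi.single i 1)) * x i := by
    ext x
    conv_lhs => rw [pi_eq_sum_univ' x]
    simp [map_sum, mul_comm]
  rw [e, h, h']

theorem gauss_sum_pi {ι : Type} [Fintype ι] (v : ι → NNReal) :
    (Measure.pi (fun i => gaussianReal 0 (v i))).map (fun x : ι → ℝ => ∑ i, x i) =
      gaussianReal 0 (∑ i, v i) := by
  have : IsProbabilityMeasure ((Measure.pi (fun i => gaussianReal 0 (v i))).map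
      (fun x : ι → ℝ => ∑ i, x i)) :=
    Measure.isProbabilityMeasure_map (by fun_prop)
  apply Measure.ext_of_charFun
  ext t
  rw [charFun_gaussianReal, charFun_apply_real, integral_map (by fun_prop) (by fun_prop)]
  have e : ∀ x : ι → ℝ, Complex.exp (t * ((∑ i, x i : ℝ) : ℂ) * Complex.I) =
      ∏ i, Complex.exp (t * (x i : ℂ) * Complex.I) := by
    intro x
    rw [← Complex.exp_sum]; push_cast
    rw [Finset.mul_sum, Finset.sum_mul]
  simp_rw [e]
  rw [integral_fintype_prod_eq_prod (fun i (y : ℝ) => Complex.exp (t * (y : ℂ) * Complex.I))]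
  simp_rw [← charFun_apply_real, charFun_gaussianReal]
  rw [← Complex.exp_sum]
  simp [Finset.sum_mul, Finset.sum_neg_distrib, Finset.sum_div]

theorem gauss_sum_pi' {ι : Type} [Fintype ι] {Ω : ι → Type} [∀ i, MeasurableSpace (Ω i)]
    (μ : ∀ i, Measure (Ω i)) [∀ i, IsProbabilityMeasure (μ i)] (f : ∀ i, Ω i → ℝ)
    (hf : ∀ i, Measurable (f i)) (v : ι → NNReal)
    (h : ∀ i, (μ i).map (f i) = gaussianReal 0 (v i)) :
    (Measure.pi μ).map (fun ω => ∑ i, f i (ω i)) = gaussianReal 0 (∑ i, v i) := by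
  have : ∀ i, IsProbabilityMeasure ((μ i).map (f i)) := fun i =>
    Measure.isProbabilityMeasure_map (hf i).aemeasurable
  have h1 := Measure.pi_map_pi (μ := μ) (f := f) (fun i => (hf i).aemeasurable)
  rw [← gauss_sum_pi, show (fun i => gaussianReal 0 (v i)) = fun i => (μ i).map (f i) by
    ext1 i; rw [h], ← h1, Measure.map_map (by fun_prop) (by fun_prop)]
  rfl

theorem gauss_sum_prod {Ω Ω' : Type} [MeasurableSpace Ω] [MeasurableSpace Ω']
    (μ : Measure Ω) [IsProbabilityMeasure μ] (μ' : Measure Ω') [IsProbabilityMeasure μ']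
    (f : Ω → ℝ) (hf : Measurable f) (g : Ω' → ℝ) (hg : Measurable g) (a b : NNReal)
    (h : μ.map f = gaussianReal 0 a) (h' : μ'.map g = gaussianReal 0 b) :
    (μ.prod μ').map (fun ω => f ω.1 + g ω.2) = gaussianReal 0 (a + b) := by
  have e := gaussianReal_conv_gaussianReal (m₁ := 0) (m₂ := 0) (v₁ := a) (v₂ := b)
  rw [add_zero] at e
  rw [← e, ← h, ← h', Measure.conv, Measure.map_prod_map _ _ hf hg, Measure.map_map (by fun_prop)
    (by fun_prop)]
  rfl

def stdP (ι : Type) [Fintype ι] : Measure (ι → ℝ) := Measure.pi fun _ => gaussianReal 0 1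

instance (ι : Type) [Fintype ι] : IsProbabilityMeasure (stdP ι) := by
  unfold stdP; infer_instance

theorem isG_std {ι : Type} [Fintype ι] : IsG (stdP ι) (fun c => ∑ i, c i ^ 2) := by
  intro c
  have := gauss_sum_pi' (fun _ : ι => gaussianReal 0 1) (fun i x => c i * x) (by fun_prop)
    (fun i => (c i ^ 2).toNNReal) (fun i => by
      rw [gaussianReal_map_const_mul]; congr 1; · simp
      · ext; simp [sq_nonneg])
  unfold stdP
  rw [this, Real.toNNReal_sum_of_nonneg (fun i _ => sq_nonneg _)]

theorem IsG.map {ι κ : Type} [Fintype ι] [Fintype κ] {ν : Measure (ι → ℝ)} {q : (ι → ℝ) → ℝ}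
    (h : IsG ν q) (M : Matrix κ ι ℝ) :
    IsG (ν.map (fun x => M.mulVec x)) (fun c => q (Matrix.vecMul c M)) := by
  intro c
  rw [Measure.map_map (by fun_prop) (by fun_prop), ← h]
  congr 1
  ext x
  exact Matrix.dotProduct_mulVec c M x

theorem IsG.mapFun {ι κ : Type} [Fintype ι] [Fintype κ] {ν : Measure (ι → ℝ)} {q : (ι → ℝ) → ℝ}
    (h : IsG ν q) (f : κ → ι) :
    IsG (ν.map (fun x k => x (f k))) (fun c => q (fun i => ∑ k, if f k = i then c k else 0)) := by
  intro c
  rw [Measure.map_map (by fun_prop) (by fun_prop), ← h]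
  congr 1
  ext x
  simp only [Function.comp, Finset.sum_mul]
  rw [Finset.sum_comm]
  simp

theorem IsG.add {ι : Type} [Fintype ι] {ν ν' : Measure (ι → ℝ)} {q q' : (ι → ℝ) → ℝ}
    (h : IsG ν q) (h' : IsG ν' q') (hq : ∀ c, 0 ≤ q c) (hq' : ∀ c, 0 ≤ q' c) :
    IsG ((ν.prod ν').map (fun z => z.1 + z.2)) (fun c => q c + q' c) := by
  intro c
  have := h.prob
  have := h'.prob
  rw [Measure.map_map (by fun_prop) (by fun_prop), Real.toNNReal_add (hq c) (hq' c),
    ← gauss_sum_prod ν ν' _ (by fun_prop) _ (by fun_prop) _ _ (h c) (h' c)]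
  congr 1
  ext x
  simp [mul_add, Finset.sum_add_distrib]

open scoped MatrixOrder in
theorem psd_factor {ι : Type} [Fintype ι] {S : Matrix ι ι ℝ} (hS : S.PosSemidef) :
    ∃ B : Matrix ι ι ℝ, S = B.transpose * B := by
  obtain ⟨B, rfl⟩ := CStarAlgebra.nonneg_iff_eq_star_mul_self.mp hS.nonneg
  exact ⟨B, by simp [Matrix.star_eq_conjTranspose]⟩

theorem quad_factor {ι : Type} [Fintype ι] (B : Matrix ι ι ℝ) (c : ι → ℝ) :
    c ⬝ᵥ (B.transpose * B).mulVec c = ∑ i, (B.mulVec c) i ^ 2 := by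
  rw [← Matrix.mulVec_mulVec, Matrix.dotProduct_mulVec, Matrix.vecMul_transpose]
  simp [dotProduct, sq]

theorem exists_isG {ι : Type} [Fintype ι] {S : Matrix ι ι ℝ} (hS : S.PosSemidef) :
    ∃ ν, IsG ν (fun c => c ⬝ᵥ S.mulVec c) := by
  obtain ⟨B, rfl⟩ := psd_factor hS
  refine ⟨(stdP ι).map (fun x => B.transpose.mulVec x), ?_⟩
  have := (isG_std (ι := ι)).map B.transpose
  simp_rw [Matrix.vecMul_transpose] at this
  simp_rw [quad_factor]
  exact this

def mx {ι : Type} [Fintype ι] [Nonempty ι] (f : ι → ℝ) : ℝ :=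
  Finset.univ.sup' Finset.univ_nonempty f

theorem le_mx {ι : Type} [Fintype ι] [Nonempty ι] (f : ι → ℝ) (i : ι) : f i ≤ mx f :=
  Finset.le_sup' f (Finset.mem_univ i)

theorem mx_le {ι : Type} [Fintype ι] [Nonempty ι] {f : ι → ℝ} {a : ℝ} (h : ∀ i, f i ≤ a) :
    mx f ≤ a := Finset.sup'_le _ _ fun i _ => h i

theorem exists_mx {ι : Type} [Fintype ι] [Nonempty ι] (f : ι → ℝ) : ∃ i, mx f = f i := by
  obtain ⟨i, _, h⟩ := Finset.exists_mem_eq_sup' Finset.univ_nonempty f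
  exact ⟨i, h⟩

theorem integrable_mx {ι Ω : Type} [Fintype ι] [Nonempty ι] [MeasurableSpace Ω] {μ : Measure Ω}
    {F : ι → Ω → ℝ} (h : ∀ i, Integrable (F i) μ) : Integrable (fun ω => mx (fun i => F i ω)) μ := by
  have : (fun ω => mx (fun i => F i ω)) = Finset.univ.sup' Finset.univ_nonempty F := by
    ext ω; rw [Finset.sup'_apply]; rfl
  rw [this]
  exact Finset.sup'_induction (p := fun g : Ω → ℝ => Integrable g μ) _ _
    (fun _ h1 _ h2 => h1.sup h2) (fun i _ => h i)

theorem integrable_of_gauss {Ω : Type} [MeasurableSpace Ω] {μ : Measure Ω} {f : Ω → ℝ}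
    (hf : Measurable f) {v : NNReal} (h : μ.map f = gaussianReal 0 v) : Integrable f μ := by
  have : Integrable id (μ.map f) := by
    rw [h]; exact (memLp_id_gaussianReal 1).integrable (by simp)
  exact this.comp_measurable hf

theorem integral_of_gauss {Ω : Type} [MeasurableSpace Ω] {μ : Measure Ω} {f : Ω → ℝ}
    (hf : Measurable f) {v : NNReal} (h : μ.map f = gaussianReal 0 v) : ∫ x, f x ∂μ = 0 := by
  rw [← integral_map (f := fun x : ℝ => x) hf.aemeasurable (by fun_prop), h,
    integral_id_gaussianReal]

theorem IsG.coord {ι : Type} [Fintype ι] {ν : Measure (ι → ℝ)} {q : (ι → ℝ) → ℝ}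
    (h : IsG ν q) (i : ι) : ν.map (fun x => x i) = gaussianReal 0 (q (Pi.single i 1)).toNNReal := by
  rw [← h]; simp [Pi.single_apply]

theorem IsG.int {ι : Type} [Fintype ι] {ν : Measure (ι → ℝ)} {q : (ι → ℝ) → ℝ}
    (h : IsG ν q) (i : ι) : Integrable (fun x : ι → ℝ => x i) ν :=
  integrable_of_gauss (by fun_prop) (h.coord i)

theorem IsG.mean {ι : Type} [Fintype ι] {ν : Measure (ι → ℝ)} {q : (ι → ℝ) → ℝ}
    (h : IsG ν q) (i : ι) : ∫ x, x i ∂ν = 0 :=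
  integral_of_gauss (by fun_prop) (h.coord i)

theorem psd_max {ι : Type} [Fintype ι] [Nonempty ι] {K K' : Matrix ι ι ℝ}
    {ν ν' : Measure (ι → ℝ)} (h : IsG ν (fun c => c ⬝ᵥ K.mulVec c))
    (h' : IsG ν' (fun c => c ⬝ᵥ K'.mulVec c)) (hK : K.PosSemidef) (hK' : (K' - K).PosSemidef) :
    ∫ x, mx x ∂ν ≤ ∫ x, mx x ∂ν' := by
  obtain ⟨ρ, hρ⟩ := exists_isG hK'
  have e : ν' = (ν.prod ρ).map (fun z => z.1 + z.2) := by
    apply h'.uniq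
    have := h.add hρ (fun c => by simpa using hK.dotProduct_mulVec_nonneg c)
      (fun c => by simpa using hK'.dotProduct_mulVec_nonneg c)
    convert this using 2 with c
    rw [Matrix.sub_mulVec, dotProduct_sub]; ring
  have := h.prob
  have := hρ.prob
  have i1 : ∀ i, Integrable (fun z : (ι → ℝ) × (ι → ℝ) => z.1 i) (ν.prod ρ) := fun i =>
    (h.int i).comp_fst ρ
  have i2 : ∀ i, Integrable (fun z : (ι → ℝ) × (ι → ℝ) => z.2 i) (ν.prod ρ) := fun i =>
    (hρ.int i).comp_snd ν
  have im : Integrable (fun z : (ι → ℝ) × (ι → ℝ) => mx (fun i => z.1 i + z.2 i)) (ν.prod ρ) :=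
    integrable_mx fun i => (i1 i).add (i2 i)
  have mm : Measurable (mx : (ι → ℝ) → ℝ) := by
    have : (mx : (ι → ℝ) → ℝ) = Finset.univ.sup' Finset.univ_nonempty (fun i x => x i) := by
      ext x; rw [Finset.sup'_apply]; rfl
    rw [this]
    exact Finset.measurable_sup' _ fun i _ => measurable_pi_apply i
  rw [e, integral_map (by fun_prop) mm.aestronglyMeasurable]
  change _ ≤ ∫ z : (ι → ℝ) × (ι → ℝ), mx (fun i => z.1 i + z.2 i) ∂_
  rw [integral_prod _ im]
  apply integral_mono_ae (integrable_mx fun i => h.int i) im.integral_prod_left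
  filter_upwards [] with x
  obtain ⟨i, hi⟩ := exists_mx x
  have hx : Integrable (fun y : ι → ℝ => mx (fun i => x i + y i)) ρ :=
    integrable_mx fun i => (integrable_const _).add (hρ.int i)
  calc mx x = ∫ y, (x i + y i) ∂ρ := by
        rw [integral_add (integrable_const _) (hρ.int i), hρ.mean]; simp [hi]
    _ ≤ ∫ y, mx (fun i => x i + y i) ∂ρ :=
      integral_mono ((integrable_const _).add (hρ.int i)) hx fun y => le_mx (fun i => x i + y i) i

theorem mx_one {I : Type} [Fintype I] [Nonempty I] {ν ν' : Measure ℝ}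
    [IsProbabilityMeasure ν] [IsProbabilityMeasure ν']
    (h1 : Integrable (fun x : ℝ => x) ν) (h2 : Integrable (fun x : ℝ => x) ν')
    (hH : ∀ t, ∫ x, max t x ∂ν ≤ ∫ x, max t x ∂ν') (hM : ∫ x, x ∂ν ≤ ∫ x, x ∂ν')
    (a : I → ℝ) (S : I → Prop) :
    ∫ t, mx (fun i => a i + if S i then t else 0) ∂ν ≤
      ∫ t, mx (fun i => a i + if S i then t else 0) ∂ν' := by
  by_cases hS : ∃ i, S i
  · obtain ⟨i0, hi0⟩ := hS
    have : Nonempty {i // S i} := ⟨⟨i0, hi0⟩⟩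
    set A := mx (fun i : {i // S i} => a i) with hA
    by_cases hN : ∃ i, ¬ S i
    · obtain ⟨i1, hi1⟩ := hN
      have : Nonempty {i // ¬ S i} := ⟨⟨i1, hi1⟩⟩
      set c := mx (fun i : {i // ¬ S i} => a i) with hc
      have e : ∀ t, mx (fun i => a i + if S i then t else 0) = A + max (c - A) t := by
        intro t
        apply le_antisymm
        · apply mx_le
          intro i
          by_cases h : S i
          · have := le_mx (fun i : {i // S i} => a i) ⟨i, h⟩
            have := le_max_right (c - A) t
            simp only [h, if_true] at *; linarith
          · have := le_mx (fun i : {i // ¬ S i} => a i) ⟨i, h⟩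
            have := le_max_left (c - A) t
            simp only [h, if_false] at *; linarith
        · rcases max_choice (c - A) t with h | h <;> rw [h]
          · obtain ⟨i, hi⟩ := exists_mx (fun i : {i // ¬ S i} => a i)
            have := le_mx (fun i => a i + if S i then t else 0) i.1
            simp only [i.2, if_false] at this; linarith
          · obtain ⟨i, hi⟩ := exists_mx (fun i : {i // S i} => a i)
            have := le_mx (fun i => a i + if S i then t else 0) i.1
            simp only [i.2, if_true] at this; linarith
      simp_rw [e]
      have m1 : Integrable (fun t : ℝ => max (c - A) t) ν := (integrable_const _).sup h1
      have m2 : Integrable (fun t : ℝ => max (c - A) t) ν' := (integrable_const _).sup h2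
      rw [integral_add (integrable_const _) m1, integral_add (integrable_const _) m2]
      have := hH (c - A)
      simpa using this
    · push Not at hN
      have e : ∀ t, mx (fun i => a i + if S i then t else 0) = mx a + t := by
        intro t
        have : (fun i => a i + if S i then t else 0) = fun i => a i + t := by
          ext i; simp [hN i]
        rw [this]
        apply le_antisymm
        · exact mx_le fun i => by have := le_mx a i; linarith
        · obtain ⟨i, hi⟩ := exists_mx a
          have := le_mx (fun i => a i + t) i
          linarith
      simp_rw [e]
      rw [integral_add (integrable_const _) h1, integral_add (integrable_const _) h2]
      simpa using hM
  · push Not at hS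
    simp [hS]

theorem int_pi_coord {E : Type} [Fintype E] {ν : Measure ℝ} [IsProbabilityMeasure ν]
    (h1 : Integrable (fun x : ℝ => x) ν) (e : E) :
    Integrable (fun x : E → ℝ => x e) (Measure.pi fun _ => ν) :=
  (measurePreserving_eval (fun _ : E => ν) e).integrable_comp_of_integrable h1

theorem pi_cons {ρ : Measure ℝ} [IsProbabilityMeasure ρ] (n : ℕ) :
    MeasurePreserving (fun z : ℝ × (Fin n → ℝ) => (Fin.cons z.1 z.2 : Fin (n+1) → ℝ))
      (ρ.prod (Measure.pi fun _ => ρ)) (Measure.pi fun _ => ρ) := by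
  have mp := (measurePreserving_piFinSuccAbove (fun _ : Fin (n+1) => ρ) 0).symm
  convert mp using 1
  ext z i
  simp [MeasurableEquiv.piFinSuccAbove]

theorem icx_fin {ν ν' : Measure ℝ}
    [IsProbabilityMeasure ν] [IsProbabilityMeasure ν']
    (h1 : Integrable (fun x : ℝ => x) ν) (h2 : Integrable (fun x : ℝ => x) ν')
    (hH : ∀ t, ∫ x, max t x ∂ν ≤ ∫ x, max t x ∂ν') (hM : ∫ x, x ∂ν ≤ ∫ x, x ∂ν')
    {I : Type} [Fintype I] [Nonempty I] (n : ℕ) :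
    ∀ (a : I → ℝ) (π : I → Option (Fin n)),
    ∫ x : Fin n → ℝ, mx (fun i => a i + (π i).elim 0 x) ∂(Measure.pi fun _ => ν) ≤
      ∫ x : Fin n → ℝ, mx (fun i => a i + (π i).elim 0 x) ∂(Measure.pi fun _ => ν') := by
  induction n with
  | zero =>
    intro a π
    have : ∀ i, π i = none := fun i => by
      rcases h : π i with _ | k
      · rfl
      · exact k.elim0
    simp [this]
  | succ n ih =>
    intro a π
    have key : ∀ (ρ : Measure ℝ) [IsProbabilityMeasure ρ], Integrable (fun x : ℝ => x) ρ →
        Integrable (fun z : ℝ × (Fin n → ℝ) => mx (fun i => a i + (π i).elim 0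
          (Fin.cons z.1 z.2 : Fin (n+1) → ℝ))) (ρ.prod (Measure.pi fun _ => ρ)) ∧
        ∫ x : Fin (n+1) → ℝ, mx (fun i => a i + (π i).elim 0 x) ∂(Measure.pi fun _ => ρ) =
        ∫ z : ℝ × (Fin n → ℝ), mx (fun i => a i + (π i).elim 0
          (Fin.cons z.1 z.2 : Fin (n+1) → ℝ)) ∂(ρ.prod (Measure.pi fun _ => ρ)) := by
      intro ρ _ hρ
      have mp := pi_cons (ρ := ρ) n
      have : Integrable (fun x : Fin (n+1) → ℝ => mx (fun i => a i + (π i).elim 0 x))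
          (Measure.pi fun _ => ρ) := by
        apply integrable_mx
        intro i
        apply (integrable_const _).add
        rcases π i with _ | k
        · exact integrable_const _
        · exact int_pi_coord hρ k
      refine ⟨mp.integrable_comp_of_integrable this, ?_⟩
      conv_lhs => rw [← mp.map_eq]
      rw [integral_map mp.measurable.aemeasurable]
      rw [mp.map_eq]; exact this.aestronglyMeasurable
    obtain ⟨k1, k2⟩ := key ν h1
    obtain ⟨k3, k4⟩ := key ν' h2
    rw [k2, k4, integral_prod _ k1, integral_prod_symm _ k3]
    have hint : ∀ (ρ : Measure ℝ) [IsProbabilityMeasure ρ] (ρ' : Measure ℝ) [IsProbabilityMeasure ρ'],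
        Integrable (fun x : ℝ => x) ρ → Integrable (fun x : ℝ => x) ρ' →
        Integrable (fun z : ℝ × (Fin n → ℝ) => mx (fun i => a i + (π i).elim 0
          (Fin.cons z.1 z.2 : Fin (n+1) → ℝ))) (ρ.prod (Measure.pi fun _ => ρ')) := by
      intro ρ _ ρ' _ hρ hρ'
      apply integrable_mx
      intro i
      apply (integrable_const _).add
      rcases π i with _ | k
      · exact integrable_const _
      · refine Fin.cases ?_ (fun k => ?_) k
        · exact hρ.comp_fst _
        · exact (int_pi_coord hρ' k).comp_snd _
    have k5 := hint ν ν' h1 h2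
    calc _ ≤ ∫ x, ∫ y, mx (fun i => a i + (π i).elim 0 (Fin.cons x y : Fin (n+1) → ℝ))
            ∂(Measure.pi fun _ => ν') ∂ν := by
          apply integral_mono k1.integral_prod_left k5.integral_prod_left
          intro x
          have := ih (fun i => a i + if π i = some 0 then x else 0)
            (fun i => (π i).elim none (Fin.cases none fun k => some k))
          have e : ∀ (y : Fin n → ℝ), (fun i => (a i + if π i = some 0 then x else 0) +
             ((π i).elim none (Fin.cases none fun k => some k) : Option (Fin n)).elim 0 y) =
             fun i => a i + (π i).elim 0 (Fin.cons x y : Fin (n+1) → ℝ) := by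
            intro y; ext i
            rcases π i with _ | k
            · simp
            · refine Fin.cases ?_ (fun k => ?_) k <;> simp
          simp_rw [e] at this
          exact this
      _ = ∫ y, ∫ x, mx (fun i => a i + (π i).elim 0 (Fin.cons x y : Fin (n+1) → ℝ)) ∂ν
            ∂(Measure.pi fun _ => ν') := by
          rw [← integral_prod _ k5, integral_prod_symm _ k5]
      _ ≤ _ := by
          apply integral_mono k5.integral_prod_right k3.integral_prod_right
          intro y
          have := mx_one h1 h2 hH hM (fun i => a i + (π i).elim 0
            (Fin.cons 0 y : Fin (n+1) → ℝ)) (fun i => π i = some 0)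
          have e : ∀ x : ℝ, (fun i => (a i + (π i).elim 0 (Fin.cons 0 y : Fin (n+1) → ℝ)) +
            @ite _ (π i = some 0) (Classical.propDecidable _) x 0) =
             fun i => a i + (π i).elim 0 (Fin.cons x y : Fin (n+1) → ℝ) := by
            intro x; ext i
            rcases π i with _ | k
            · simp
            · refine Fin.cases ?_ (fun k => ?_) k <;> simp
          simp_rw [e] at this
          exact this

theorem icx_max {ν ν' : Measure ℝ}
    [IsProbabilityMeasure ν] [IsProbabilityMeasure ν']
    (h1 : Integrable (fun x : ℝ => x) ν) (h2 : Integrable (fun x : ℝ => x) ν')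
    (hH : ∀ t, ∫ x, max t x ∂ν ≤ ∫ x, max t x ∂ν') (hM : ∫ x, x ∂ν ≤ ∫ x, x ∂ν')
    {I E : Type} [Fintype I] [Nonempty I] [Fintype E] (a : I → ℝ) (π : I → E) :
    ∫ x : E → ℝ, mx (fun i => a i + x (π i)) ∂(Measure.pi fun _ => ν) ≤
      ∫ x : E → ℝ, mx (fun i => a i + x (π i)) ∂(Measure.pi fun _ => ν') := by
  have e := (Fintype.equivFin E).symm
  have key : ∀ (ρ : Measure ℝ) [IsProbabilityMeasure ρ],
      ∫ x : E → ℝ, mx (fun i => a i + x (π i)) ∂(Measure.pi fun _ => ρ) =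
      ∫ x : Fin (Fintype.card E) → ℝ, mx (fun i => a i + (some (e.symm (π i))).elim 0 x)
        ∂(Measure.pi fun _ => ρ) := by
    intro ρ _
    have mp := measurePreserving_piCongrLeft (fun _ : E => ρ) e
    rw [← mp.integral_comp']
    congr 1; ext x; congr 1; ext i
    obtain ⟨k, hk⟩ := e.surjective (π i)
    simp only [← hk, Option.elim, Equiv.symm_apply_apply]
    rw [MeasurableEquiv.coe_piCongrLeft, Equiv.piCongrLeft_apply_apply]
  rw [key, key]
  exact icx_fin h1 h2 hH hM _ a _

theorem gauss_lower {V t : ℝ} (hV : 0 < V) (ht : 0 ≤ t) :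
    t + (Real.sqrt (2 * Real.pi * V))⁻¹ * Real.exp (-(t + 2) ^ 2 / (2 * V)) ≤
      ∫ x, max t x ∂(gaussianReal 0 V.toNNReal) := by
  set γ := gaussianReal 0 V.toNNReal with hγ
  have hV' : V.toNNReal ≠ 0 := by simpa using hV
  have hi : Integrable (fun x : ℝ => max t x) γ :=
    (integrable_const _).sup ((memLp_id_gaussianReal 1).integrable (by simp))
  set S := Set.Icc (t + 1) (t + 2)
  have hS : (Real.sqrt (2 * Real.pi * V))⁻¹ * Real.exp (-(t + 2) ^ 2 / (2 * V)) ≤ γ.real S := by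
    rw [Measure.real, hγ, gaussianReal_apply_eq_integral _ hV', ENNReal.toReal_ofReal
      (by apply integral_nonneg; intro x; exact gaussianPDFReal_nonneg _ _ _)]
    have : ∫ x in S, (Real.sqrt (2 * Real.pi * V))⁻¹ * Real.exp (-(t + 2) ^ 2 / (2 * V)) =
        (Real.sqrt (2 * Real.pi * V))⁻¹ * Real.exp (-(t + 2) ^ 2 / (2 * V)) := by
      rw [setIntegral_const]; simp [S, Measure.real]; norm_num
    rw [← this]
    apply setIntegral_mono_on
    · exact (integrableOn_const (by simp [S]))
    · exact (integrable_gaussianPDFReal _ _).integrableOn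
    · exact measurableSet_Icc
    · intro x hx
      rw [gaussianPDFReal]
      simp only [Real.coe_toNNReal _ hV.le, sub_zero]
      apply mul_le_mul_of_nonneg_left _ (by positivity)
      apply Real.exp_le_exp.2
      apply div_le_div_of_nonneg_right _ (by positivity)
      have h1 : t + 1 ≤ x := hx.1
      have h2 : x ≤ t + 2 := hx.2
      nlinarith
  calc _ ≤ t + γ.real S := by linarith
    _ = ∫ x, (t + S.indicator (fun _ => (1:ℝ)) x) ∂γ := by
      rw [integral_add (integrable_const _) ((integrable_const _).indicator measurableSet_Icc),
        integral_indicator measurableSet_Icc]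
      simp [S]
    _ ≤ _ := by
      apply integral_mono ((integrable_const _).add
        ((integrable_const _).indicator measurableSet_Icc)) hi
      intro x
      by_cases hx : x ∈ S
      · have h1 : t + 1 ≤ x := hx.1
        have e : S.indicator (fun _ => (1:ℝ)) x = 1 := indicator_of_mem hx _
        change t + S.indicator (fun _ => (1:ℝ)) x ≤ _
        rw [e]; exact h1.trans (le_max_right _ _)
      · have e : S.indicator (fun _ => (1:ℝ)) x = 0 := indicator_of_notMem hx _
        change t + S.indicator (fun _ => (1:ℝ)) x ≤ _
        rw [e, add_zero]; exact (le_max_left _ _)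

theorem icx_gauss (A V : ℝ) (hV : 0 < V) (hA : 0 ≤ A) : ∃ C : ℝ, 0 ≤ C ∧
    ∀ ν : Measure ℝ, IsProbabilityMeasure ν → Integrable (fun x : ℝ => x) ν →
      (∀ θ : ℝ, 0 ≤ θ → Integrable (fun x => Real.exp (θ * x)) ν ∧
        ∫ x, Real.exp (θ * x) ∂ν ≤ A * Real.exp (θ ^ 2 * V / 2)) →
      (∀ t, ∫ x, max t x ∂ν ≤ ∫ x, max t x ∂((gaussianReal 0 (8 * V).toNNReal).map (C + ·))) ∧
      ∫ x, x ∂ν ≤ ∫ x, x ∂((gaussianReal 0 (8 * V).toNNReal).map (C + ·)) := by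
  set u0 := max 2 (A * V * Real.sqrt (2 * Real.pi * (8 * V)))
  have hu0 : 2 ≤ u0 := le_max_left _ _
  set C := u0 + A * Real.exp (V / 2) with hC
  have hC0 : 0 ≤ C := by positivity
  refine ⟨C, hC0, ?_⟩
  intro ν _ hi hm
  set γ := gaussianReal 0 (8 * V).toNNReal
  have hγi : Integrable (fun x : ℝ => x) γ := (memLp_id_gaussianReal 1).integrable (by simp)
  have hγm : ∫ x, x ∂γ = 0 := integral_id_gaussianReal
  have hmap : ∀ f : ℝ → ℝ, Continuous f → ∫ x, f x ∂(γ.map (C + ·)) = ∫ x, f (C + x) ∂γ := by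
    intro f hf
    rw [integral_map (by fun_prop) hf.aestronglyMeasurable]
  have hm1 : ∀ t, Integrable (fun x : ℝ => max t (C + x)) γ := fun t =>
    (integrable_const _).sup ((integrable_const _).add hγi)
  have hmean : ∫ x, (C + x) ∂γ = C := by
    rw [integral_add (integrable_const _) hγi, hγm]; simp
  have hup : ∀ t ≤ u0, ∫ x, max t x ∂ν ≤ C := by
    intro t ht
    have h1 := hm 1 zero_le_one
    calc ∫ x, max t x ∂ν ≤ ∫ x, (u0 + Real.exp (1 * x)) ∂ν := by
          apply integral_mono ((integrable_const _).sup hi) ((integrable_const _).add h1.1)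
          intro x
          simp only [one_mul]
          change max t x ≤ u0 + Real.exp x
          have := Real.add_one_le_exp x
          have := Real.exp_pos x
          apply max_le <;> linarith
      _ = u0 + ∫ x, Real.exp (1 * x) ∂ν := by
          rw [integral_add (integrable_const _) h1.1]; simp
      _ ≤ C := by have := h1.2; simp only [one_pow, one_mul] at *; linarith
  rw [hmap _ continuous_id', hmean]
  refine ⟨?_, ?_⟩
  · intro t
    rw [hmap _ (by fun_prop)]
    rcases le_total t u0 with ht | ht
    · refine (hup t ht).trans ?_
      refine hmean.symm.le.trans ?_
      exact integral_mono ((integrable_const _).add hγi) (hm1 t) fun x => le_max_right _ _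
    · have ht0 : 0 < t := by linarith
      have hθ : 0 < t / V := by positivity
      have h1 := hm (t / V) hθ.le
      calc ∫ x, max t x ∂ν ≤ ∫ x, (t + (V / t * Real.exp (-t^2/V)) * Real.exp (t / V * x)) ∂ν := by
            apply integral_mono ((integrable_const _).sup hi)
              ((integrable_const _).add (h1.1.const_mul _))
            intro x
            change max t x ≤ t + (V / t * Real.exp (-t^2/V)) * Real.exp (t / V * x)
            apply max_le
            · have : 0 ≤ (V / t * Real.exp (-t^2/V)) * Real.exp (t / V * x) := by positivity
              linarith
            · have e : (V / t * Real.exp (-t^2/V)) * Real.exp (t / V * x) =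
                  V / t * Real.exp (t / V * (x - t)) := by
                rw [mul_assoc, ← Real.exp_add]; congr 2; field_simp; ring
              rw [e]
              have := Real.add_one_le_exp (t / V * (x - t))
              have h3 : V / t * (t / V * (x - t)) ≤ V / t * Real.exp (t / V * (x - t)) :=
                mul_le_mul_of_nonneg_left (by linarith) (by positivity)
              have h4 : V / t * (t / V * (x - t)) = x - t := by field_simp
              linarith
        _ = t + (V / t * Real.exp (-t^2/V)) * ∫ x, Real.exp (t / V * x) ∂ν := by
            rw [integral_add (integrable_const _) (h1.1.const_mul _), integral_const_mul]; simp
        _ ≤ t + (V / t * Real.exp (-t^2/V)) * (A * Real.exp ((t/V) ^ 2 * V / 2)) := by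
            gcongr; exact h1.2
        _ = t + A * V / t * Real.exp (-t^2/(2*V)) := by
            rw [show (V / t * Real.exp (-t^2/V)) * (A * Real.exp ((t/V) ^ 2 * V / 2)) =
              A * V / t * (Real.exp (-t^2/V) * Real.exp ((t/V) ^ 2 * V / 2)) by ring,
              ← Real.exp_add]
            congr 3; field_simp; ring
        _ ≤ t + (Real.sqrt (2 * Real.pi * (8 * V)))⁻¹ * Real.exp (-(t + 2) ^ 2 / (2 * (8 * V))) := by
            have hs : 0 < Real.sqrt (2 * Real.pi * (8 * V)) := by positivity
            have h5 : A * V / t ≤ (Real.sqrt (2 * Real.pi * (8 * V)))⁻¹ := by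
              rw [div_le_iff₀ ht0, inv_mul_eq_div, le_div_iff₀ hs]
              exact (le_max_right _ _).trans ht
            have h6 : Real.exp (-t^2/(2*V)) ≤ Real.exp (-(t + 2) ^ 2 / (2 * (8 * V))) := by
              apply Real.exp_le_exp.2
              rw [div_le_div_iff₀ (by positivity) (by positivity)]
              have : 2 ≤ t := by linarith
              nlinarith [mul_nonneg hV.le (sq_nonneg t), mul_nonneg hV.le (sq_nonneg (t-2)), mul_pos hV ht0, mul_nonneg hV.le (sub_nonneg.2 this), mul_nonneg (mul_nonneg hV.le (sub_nonneg.2 this)) ht0.le]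
            gcongr
        _ ≤ ∫ x, max t x ∂γ := gauss_lower (by positivity) ht0.le
        _ ≤ _ := by
          apply integral_mono ((integrable_const _).sup hγi) (hm1 t)
          intro x
          apply max_le_max le_rfl; linarith
  · refine le_trans ?_ (hup 0 (by linarith))
    exact integral_mono hi ((integrable_const _).sup hi) fun x => le_max_right _ _

theorem noise_cmp (A V : ℝ) (hV : 0 < V) (hA : 0 ≤ A) : ∃ C : ℝ, 0 ≤ C ∧
    ∀ (Ω : Type) [MeasurableSpace Ω] (μ : Measure Ω) [IsProbabilityMeasure μ]
      (f : Ω → ℝ), Measurable f → Integrable f μ →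
      (∀ θ : ℝ, 0 ≤ θ → Integrable (fun x => Real.exp (θ * f x)) μ ∧
        ∫ x, Real.exp (θ * f x) ∂μ ≤ A * Real.exp (θ ^ 2 * V / 2)) →
      ∀ (I E : Type) [Fintype I] [Nonempty I] [Fintype E] (a : I → ℝ) (π : I → E),
      ∫ x : E → Ω, mx (fun i => a i + f (x (π i))) ∂(Measure.pi fun _ => μ) ≤
      C + ∫ x : E → ℝ, mx (fun i => a i + Real.sqrt (8 * V) * x (π i)) ∂(stdP E) := by
  obtain ⟨C, hC, h⟩ := icx_gauss A V hV hA
  refine ⟨C, hC, ?_⟩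
  intro Ω _ μ _ f hf hi hm I E _ _ _ a π
  have p1 : IsProbabilityMeasure (μ.map f) := Measure.isProbabilityMeasure_map hf.aemeasurable
  have hi' : Integrable (fun x : ℝ => x) (μ.map f) := by
    rw [integrable_map_measure (by fun_prop) (by fun_prop)]; exact hi
  obtain ⟨h1, h2⟩ := h (μ.map f) p1 hi' (fun θ hθ => by
    rw [integrable_map_measure (by fun_prop) (by fun_prop), integral_map (by fun_prop) (by fun_prop)]
    exact hm θ hθ)
  have e0 : (gaussianReal 0 (8 * V).toNNReal).map (C + ·) =
      (gaussianReal 0 1).map (fun x => C + Real.sqrt (8 * V) * x) := by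
    have : gaussianReal 0 (8 * V).toNNReal = (gaussianReal 0 1).map (Real.sqrt (8 * V) * ·) := by
      rw [gaussianReal_map_const_mul]; congr 1
      · simp
      · ext
        simp only [mul_one]
        rw [Real.coe_toNNReal _ (by positivity), NNReal.coe_mk, Real.sq_sqrt (by positivity)]
    rw [this, Measure.map_map (by fun_prop) (by fun_prop)]; rfl
  rw [e0] at h1 h2
  set ν' := (gaussianReal 0 1).map (fun x => C + Real.sqrt (8 * V) * x) with hν'
  have p2 : IsProbabilityMeasure ν' := Measure.isProbabilityMeasure_map (by fun_prop)
  have i2 : Integrable (fun x : ℝ => x) ν' := by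
    rw [hν', integrable_map_measure (by fun_prop) (by fun_prop)]
    exact (integrable_const _).add
      (((memLp_id_gaussianReal 1).integrable (by simp)).const_mul _)
  have main := icx_max hi' i2 h1 h2 a π
  have mm : Measurable (fun x : E → ℝ => mx (fun i => a i + x (π i))) := by
    have : (fun x : E → ℝ => mx (fun i => a i + x (π i))) =
        Finset.univ.sup' Finset.univ_nonempty (fun i x => a i + x (π i)) := by
      ext x; rw [Finset.sup'_apply]; rfl
    rw [this]
    exact Finset.measurable_sup' _ fun i _ => by fun_prop
  rw [← Measure.pi_map_pi (μ := fun _ : E => μ) (f := fun _ => f) (fun i => hf.aemeasurable),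
    integral_map (Measurable.aemeasurable (by fun_prop)) mm.aestronglyMeasurable, hν',
    ← Measure.pi_map_pi (μ := fun _ : E => gaussianReal 0 1)
      (f := fun _ => fun x => C + Real.sqrt (8 * V) * x) (fun i => by fun_prop),
    integral_map (Measurable.aemeasurable (by fun_prop)) mm.aestronglyMeasurable] at main
  refine main.trans ?_
  have ii : Integrable (fun x : E → ℝ => mx (fun i => a i + Real.sqrt (8 * V) * x (π i))) (stdP E) :=
    integrable_mx fun i => (integrable_const _).add ((isG_std.int _).const_mul _)
  have : C + ∫ x : E → ℝ, mx (fun i => a i + Real.sqrt (8 * V) * x (π i)) ∂(stdP E) =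
     ∫ x : E → ℝ, (C + mx (fun i => a i + Real.sqrt (8 * V) * x (π i))) ∂(stdP E) := by
    rw [integral_add (integrable_const _) ii]; simp
  rw [this]
  apply integral_mono
  · exact integrable_mx fun i => (integrable_const _).add ((integrable_const _).add
      (((isG_std (ι := E)).int (π i)).const_mul _))
  · exact (integrable_const _).add ii
  · intro x
    apply mx_le
    intro i
    have := le_mx (fun i => a i + Real.sqrt (8 * V) * x (π i)) i
    simp only at *; linarith

def runM (σ : ℝ) : (m : ℕ) → (Fin m → ℝ) → ℝ → ℝ → ℝ
  | 0, _, x, y => max y x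
  | m + 1, g, x, y => runM σ m (Fin.tail g) (x + σ * g 0) (max y x)

theorem runM_meas (σ : ℝ) (m : ℕ) :
    Measurable (fun z : (Fin m → ℝ) × ℝ × ℝ => runM σ m z.1 z.2.1 z.2.2) := by
  induction m with
  | zero => simp only [runM]; fun_prop
  | succ m ih =>
    simp only [runM]
    have : Measurable (fun z : (Fin (m+1) → ℝ) × ℝ × ℝ =>
        (Fin.tail z.1, z.2.1 + σ * z.1 0, max z.2.2 z.2.1)) := by
      unfold Fin.tail
      fun_prop
    exact ih.comp this

theorem runM_ge (σ : ℝ) (m : ℕ) : ∀ (g : Fin m → ℝ) (x y : ℝ), y ≤ runM σ m g x y ∧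
    ∀ j : ℕ, x + σ * ∑ i : Fin m, (if (i : ℕ) < j then g i else 0) ≤ runM σ m g x y := by
  induction m with
  | zero => intro g x y; simp [runM]
  | succ m ih =>
    intro g x y
    simp only [runM]
    obtain ⟨h1, h2⟩ := ih (Fin.tail g) (x + σ * g 0) (max y x)
    refine ⟨(le_max_left _ _).trans h1, ?_⟩
    intro j
    rcases j with _ | j
    · simpa using (le_max_right _ _).trans h1
    · have := h2 j
      rw [Fin.sum_univ_succ]
      simp only [Fin.val_succ, Fin.val_zero, Nat.add_lt_add_iff_right, Nat.succ_pos, if_true]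
      have e : ∀ i, Fin.tail g i = g i.succ := fun i => rfl
      simp only [e] at this
      linarith

theorem runM_mgf (σ θ : ℝ) (m : ℕ) : ∀ x y : ℝ,
    ∫⁻ g, ENNReal.ofReal (Real.exp (θ * runM σ m g x y)) ∂(stdP (Fin m)) ≤
      ENNReal.ofReal (Real.exp (2 * θ ^ 2 * σ ^ 2 * m) *
        (Real.exp (θ * y) + Real.exp (2 * θ * x - θ * y))) := by
  have amgm : ∀ x y : ℝ, Real.exp (θ * max y x) + Real.exp (2 * θ * x - θ * max y x) ≤
      Real.exp (θ * y) + Real.exp (2 * θ * x - θ * y) := by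
    intro x y
    rcases max_choice y x with h | h <;> rw [h]
    have e1 : Real.exp (2 * θ * x - θ * x) = Real.exp (θ * x) := by congr 1; ring
    have e2 : Real.exp (θ * y) * Real.exp (2 * θ * x - θ * y) = Real.exp (θ * x) ^ 2 := by
      rw [← Real.exp_add, ← Real.exp_nat_mul]; congr 1; push_cast; ring
    rw [e1]
    have := Real.exp_pos (θ * y)
    have := Real.exp_pos (2 * θ * x - θ * y)
    have := Real.exp_pos (θ * x)
    apply le_of_sq_le_sq _ (by positivity)
    nlinarith [sq_nonneg (Real.exp (θ * y) - Real.exp (2 * θ * x - θ * y))]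
  induction m with
  | zero =>
    intro x y
    simp only [runM, lintegral_const, measure_univ, mul_one]
    apply ENNReal.ofReal_le_ofReal
    have := amgm x y
    have := Real.exp_pos (2 * θ * x - θ * max y x)
    simp; linarith
  | succ m ih =>
    intro x y
    have mp := pi_cons (ρ := gaussianReal 0 1) m
    have hm : Measurable (fun g : Fin (m+1) → ℝ =>
        ENNReal.ofReal (Real.exp (θ * runM σ (m+1) g x y))) := by
      have := (runM_meas σ (m+1)).comp (f := fun g : Fin (m+1) → ℝ => (g, x, y)) (by fun_prop)
      have : Measurable (fun g : Fin (m+1) → ℝ => runM σ (m+1) g x y) := this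
      fun_prop
    unfold stdP
    rw [← mp.lintegral_comp hm, lintegral_prod _ (by
      exact (hm.comp mp.measurable).aemeasurable)]
    simp only [runM, Fin.tail_cons, Fin.cons_zero]
    calc _ ≤ ∫⁻ g0, ENNReal.ofReal (Real.exp (2 * θ ^ 2 * σ ^ 2 * m) *
        (Real.exp (θ * max y x) + Real.exp (2 * θ * (x + σ * g0) - θ * max y x)))
          ∂(gaussianReal 0 1) := lintegral_mono fun g0 => ih _ _
      _ ≤ _ := ?_
    have hexp : ∫ g0, Real.exp (2 * θ * (x + σ * g0) - θ * max y x) ∂(gaussianReal 0 1) =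
        Real.exp (2 * θ * x - θ * max y x) * Real.exp (2 * θ ^ 2 * σ ^ 2) := by
      have := mgf_gaussianReal (p := gaussianReal 0 1) (X := fun x => x) (μ := 0) (v := 1)
        (by simp) (2 * θ * σ)
      unfold mgf at this
      rw [show (fun g0 => Real.exp (2 * θ * (x + σ * g0) - θ * max y x)) = fun g0 =>
        Real.exp (2 * θ * x - θ * max y x) * Real.exp (2 * θ * σ * g0) by
          ext g; rw [← Real.exp_add]; congr 1; ring, integral_const_mul, this]
      congr 2; simp; ring
    have hint : Integrable (fun g0 => Real.exp (2 * θ * (x + σ * g0) - θ * max y x))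
        (gaussianReal 0 1) := by
      rw [show (fun g0 => Real.exp (2 * θ * (x + σ * g0) - θ * max y x)) = fun g0 =>
        Real.exp (2 * θ * x - θ * max y x) * Real.exp (2 * θ * σ * g0) by
          ext g; rw [← Real.exp_add]; congr 1; ring]
      exact (integrable_exp_mul_gaussianReal _).const_mul _
    have hint2 : Integrable (fun g0 => Real.exp (2 * θ ^ 2 * σ ^ 2 * m) * (Real.exp (θ * max y x) +
        Real.exp (2 * θ * (x + σ * g0) - θ * max y x))) (gaussianReal 0 1) :=
      ((integrable_const _).add hint).const_mul _
    rw [← ofReal_integral_eq_lintegral_ofReal hint2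
      (by filter_upwards [] with g; simp only [Pi.zero_apply]; positivity)]
    apply ENNReal.ofReal_le_ofReal
    rw [integral_const_mul, integral_add (integrable_const _) hint, hexp]
    have := amgm x y
    have h1 : (1:ℝ) ≤ Real.exp (2 * θ ^ 2 * σ ^ 2) := Real.one_le_exp (by positivity)
    have h2 := Real.exp_pos (θ * max y x)
    have h3 : Real.exp (2 * θ ^ 2 * σ ^ 2 * (m + 1 : ℕ)) = Real.exp (2 * θ ^ 2 * σ ^ 2 * m) *
        Real.exp (2 * θ ^ 2 * σ ^ 2) := by
      rw [← Real.exp_add]; congr 1; push_cast; ring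
    rw [h3, mul_assoc (Real.exp _)]
    apply mul_le_mul_of_nonneg_left _ (Real.exp_pos _).le
    simp only [integral_const, probReal_univ, smul_eq_mul, one_mul]
    nlinarith [Real.exp_pos (2 * θ * x - θ * max y x), Real.exp_pos (2 * θ ^ 2 * σ ^ 2)]

def wk (m : ℕ) (g : Fin m → ℝ) (j : ℕ) : ℝ :=
  Real.sqrt (8 / m) * ∑ i : Fin m, if (i : ℕ) < j then g i else 0

def br (m : ℕ) (g : Fin m → ℝ) (j : ℕ) : ℝ := wk m g j - j / m * wk m g m

def Bx (m : ℕ) (g : Fin m → ℝ) : ℝ := mx (fun j : Fin (m + 1) => |br m g j|)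

theorem wk_meas (m j : ℕ) : Measurable (fun g => wk m g j) := by
  unfold wk
  apply Measurable.const_mul
  apply Finset.measurable_sum
  intro i _
  split_ifs <;> fun_prop

theorem br_meas (m j : ℕ) : Measurable (fun g => br m g j) := by
  unfold br
  have := wk_meas m j
  have := wk_meas m m
  fun_prop

theorem measurable_mx {I Ω : Type} [Fintype I] [Nonempty I] [MeasurableSpace Ω] {F : I → Ω → ℝ}
    (h : ∀ i, Measurable (F i)) : Measurable (fun ω => mx (fun i => F i ω)) := by
  have : (fun ω => mx (fun i => F i ω)) = Finset.univ.sup' Finset.univ_nonempty F := by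
    ext x; rw [Finset.sup'_apply]; rfl
  rw [this]
  exact Finset.measurable_sup' _ fun i _ => h i

theorem Bx_meas (m : ℕ) : Measurable (Bx m) := by
  unfold Bx
  exact measurable_mx fun i => by have := br_meas m i; fun_prop

theorem Bx_nonneg (m : ℕ) (g) : 0 ≤ Bx m g :=
  (abs_nonneg _).trans (le_mx (fun j : Fin (m + 1) => |br m g j|) 0)

theorem le_Bx {m j : ℕ} (hj : j ≤ m) (g) : |br m g j| ≤ Bx m g :=
  le_mx (fun j : Fin (m + 1) => |br m g j|) ⟨j, by omega⟩

theorem Bx_int (m : ℕ) : Integrable (Bx m) (stdP (Fin m)) := by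
  unfold Bx
  apply integrable_mx
  intro j
  apply Integrable.abs
  have : ∀ k : ℕ, Integrable (fun g => wk m g k) (stdP (Fin m)) := by
    intro k
    apply Integrable.const_mul
    apply integrable_finset_sum
    intro i _
    split_ifs
    · exact isG_std.int i
    · exact integrable_const _
  exact (this j).sub ((this m).const_mul _)

theorem bridge_mgf (m : ℕ) (hm : 1 ≤ m) (θ : ℝ) (hθ : 0 ≤ θ) :
    Integrable (fun g => Real.exp (θ * (9 * Bx m g))) (stdP (Fin m)) ∧
    ∫ g, Real.exp (θ * (9 * Bx m g)) ∂(stdP (Fin m)) ≤ 4 * Real.exp (θ ^ 2 * 10368 / 2) := by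
  set σ := Real.sqrt (8 / m) with hσ
  have hm0 : (0:ℝ) < m := by exact_mod_cast hm
  have hs : σ ^ 2 * m = 8 := by rw [hσ, Real.sq_sqrt (by positivity)]; field_simp
  have hb : ∀ g, ENNReal.ofReal (Real.exp (θ * (9 * Bx m g))) ≤
      ENNReal.ofReal (Real.exp (18 * θ * runM σ m g 0 0)) +
      ENNReal.ofReal (Real.exp (18 * θ * runM (-σ) m g 0 0)) := by
    intro g
    rw [← ENNReal.ofReal_add (by positivity) (by positivity)]
    apply ENNReal.ofReal_le_ofReal
    set a := runM σ m g 0 0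
    set b := runM (-σ) m g 0 0
    have h1 : ∀ j, |wk m g j| ≤ max a b := by
      intro j
      apply abs_le'.2 ⟨?_, ?_⟩
      · refine le_trans ?_ (le_max_left _ _)
        have := (runM_ge σ m g 0 0).2 j
        rw [zero_add] at this; exact this
      · refine le_trans ?_ (le_max_right _ _)
        have := (runM_ge (-σ) m g 0 0).2 j
        rw [zero_add, neg_mul] at this; exact this
    have h2 : Bx m g ≤ 2 * max a b := by
      apply mx_le
      intro j
      have hj : (j : ℝ) / m ≤ 1 := by
        rw [div_le_one hm0]; exact_mod_cast (by omega : (j:ℕ) ≤ m)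
      have hj0 : 0 ≤ (j : ℝ) / m := by positivity
      have e1 := h1 j
      have e2 := h1 m
      have e3 : |(j : ℝ) / m * wk m g m| ≤ |wk m g m| := by
        rw [abs_mul, abs_of_nonneg hj0]
        exact mul_le_of_le_one_left (abs_nonneg _) hj
      have := abs_sub (wk m g j) ((j : ℝ) / m * wk m g m)
      unfold br
      linarith
    have h3 : θ * (9 * Bx m g) ≤ 18 * θ * max a b := by nlinarith
    refine (Real.exp_le_exp.2 h3).trans ?_
    have := Real.exp_pos (18 * θ * a)
    have := Real.exp_pos (18 * θ * b)
    rcases max_choice a b with h | h <;> rw [h] <;> linarith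
  have meas : ∀ s : ℝ, Measurable (fun g : Fin m → ℝ =>
        ENNReal.ofReal (Real.exp (18 * θ * runM s m g 0 0))) := by
    intro s
    have := (runM_meas s m).comp (f := fun g : Fin m → ℝ => (g, 0, 0)) (by fun_prop)
    have : Measurable (fun g : Fin m → ℝ => runM s m g 0 0) := this
    fun_prop
  have hl : ∫⁻ g, ENNReal.ofReal (Real.exp (θ * (9 * Bx m g))) ∂(stdP (Fin m)) ≤
      ENNReal.ofReal (4 * Real.exp (θ ^ 2 * 10368 / 2)) := by
    refine (lintegral_mono hb).trans ?_
    rw [lintegral_add_left (meas σ)]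
    refine (add_le_add (runM_mgf σ (18 * θ) m 0 0) (runM_mgf (-σ) (18 * θ) m 0 0)).trans ?_
    rw [← ENNReal.ofReal_add (by positivity) (by positivity)]
    apply ENNReal.ofReal_le_ofReal
    have e : 2 * (18 * θ) ^ 2 * σ ^ 2 * m = θ ^ 2 * 10368 / 2 := by
      rw [mul_assoc, hs]; ring
    rw [neg_sq, e]
    simp
    linarith
  have hmeas : Measurable (fun g => Real.exp (θ * (9 * Bx m g))) := by
    have := Bx_meas m
    fun_prop
  have hi : Integrable (fun g => Real.exp (θ * (9 * Bx m g))) (stdP (Fin m)) := by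
    refine ⟨hmeas.aestronglyMeasurable, ?_⟩
    rw [hasFiniteIntegral_iff_ofReal (by filter_upwards [] with g; positivity)]
    exact hl.trans_lt ENNReal.ofReal_lt_top
  refine ⟨hi, ?_⟩
  rw [← ENNReal.ofReal_le_ofReal_iff (by positivity),
    ofReal_integral_eq_lintegral_ofReal hi (by filter_upwards [] with g; positivity)]
  exact hl

theorem gauss_sq {Ω : Type} [MeasurableSpace Ω] {μ : Measure Ω} {f : Ω → ℝ}
    (hf : Measurable f) {v : NNReal} (h : μ.map f = gaussianReal 0 v) :
    MemLp f 2 μ ∧ ∫ x, f x ^ 2 ∂μ = v := by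
  have h1 : MemLp id 2 (μ.map f) := by rw [h]; exact memLp_id_gaussianReal 2
  refine ⟨by simpa using h1.comp_of_map hf.aemeasurable, ?_⟩
  rw [← integral_map (f := fun x : ℝ => x ^ 2) hf.aemeasurable (by fun_prop), h]
  have := variance_id_gaussianReal (μ := 0) (v := v)
  rw [variance_of_integral_eq_zero (by fun_prop) (by simp [integral_id_gaussianReal])] at this
  exact this

theorem gauss_max {Ω Ω' κ : Type} [MeasurableSpace Ω] [MeasurableSpace Ω'] [Fintype κ] [Nonempty κ]
    {μ : Measure Ω} {μ' : Measure Ω'}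
    {F : κ → Ω → ℝ} {F' : κ → Ω' → ℝ} (hF : ∀ i, Measurable (F i)) (hF' : ∀ i, Measurable (F' i))
    {q q' : (κ → ℝ) → ℝ}
    (h : ∀ c, μ.map (fun ω => ∑ i, c i * F i ω) = gaussianReal 0 (q c).toNNReal)
    (h' : ∀ c, μ'.map (fun ω => ∑ i, c i * F' i ω) = gaussianReal 0 (q' c).toNNReal)
    (hq : ∀ c, 0 ≤ q c) (hqq : ∀ c, q c ≤ q' c) :
    ∫ ω, mx (fun i => F i ω) ∂μ ≤ ∫ ω, mx (fun i => F' i ω) ∂μ' := by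
  have key : ∀ {Ω : Type} [MeasurableSpace Ω] (μ : Measure Ω) (F : κ → Ω → ℝ) (q : (κ → ℝ) → ℝ),
      (∀ i, Measurable (F i)) → (∀ c, 0 ≤ q c) →
      (∀ c, μ.map (fun ω => ∑ i, c i * F i ω) = gaussianReal 0 (q c).toNNReal) →
      ∃ K : Matrix κ κ ℝ, K.IsHermitian ∧ (∀ c, q c = c ⬝ᵥ K.mulVec c) := by
    intro Ω _ μ F q hF hq h
    have hL : ∀ i, MemLp (F i) 2 μ := fun i => by
      have := (gauss_sq (by fun_prop) (h (Pi.single i 1))).1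
      simpa [Pi.single_apply] using this
    refine ⟨Matrix.of fun i j => ∫ ω, F i ω * F j ω ∂μ, ?_, ?_⟩
    · ext i j; simp [mul_comm]
    · intro c
      have h1 := (gauss_sq (by fun_prop) (h c)).2
      rw [Real.coe_toNNReal _ (hq c)] at h1
      rw [← h1]
      have : ∀ ω, (∑ i, c i * F i ω) ^ 2 = ∑ i, ∑ j, c i * c j * (F i ω * F j ω) := by
        intro ω; rw [sq, Finset.sum_mul_sum]
        refine Finset.sum_congr rfl fun i _ => Finset.sum_congr rfl fun j _ => by ring
      have hi : ∀ i j, Integrable (fun ω => c i * c j * (F i ω * F j ω)) μ := fun i j =>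
        ((hL i).integrable_mul (hL j)).const_mul _
      simp_rw [this]
      rw [integral_finsetSum _ fun i _ => integrable_finsetSum _ fun j _ => hi i j]
      simp only [dotProduct, Matrix.mulVec, Matrix.of_apply, Finset.mul_sum]
      refine Finset.sum_congr rfl fun i _ => ?_
      rw [integral_finsetSum _ fun j _ => hi i j]
      refine Finset.sum_congr rfl fun j _ => ?_
      rw [integral_const_mul]; ring
  obtain ⟨K, hK, hKq⟩ := key μ F q hF hq h
  obtain ⟨K', hK', hKq'⟩ := key μ' F' q' hF' (fun c => (hq c).trans (hqq c)) h'
  have g1 : IsG (μ.map (fun ω i => F i ω)) (fun c => c ⬝ᵥ K.mulVec c) := by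
    intro c
    show _ = gaussianReal 0 (c ⬝ᵥ K.mulVec c).toNNReal
    rw [Measure.map_map (by fun_prop) (by fun_prop), ← hKq, ← h]; rfl
  have g2 : IsG (μ'.map (fun ω i => F' i ω)) (fun c => c ⬝ᵥ K'.mulVec c) := by
    intro c
    show _ = gaussianReal 0 (c ⬝ᵥ K'.mulVec c).toNNReal
    rw [Measure.map_map (by fun_prop) (by fun_prop), ← hKq', ← h']; rfl
  have := psd_max g1 g2
    (Matrix.PosSemidef.of_dotProduct_mulVec_nonneg hK fun x => by simpa [← hKq] using hq x)
    (Matrix.PosSemidef.of_dotProduct_mulVec_nonneg (hK'.sub hK) fun x => by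
      have := hqq x
      simp only [star_trivial, Matrix.sub_mulVec, dotProduct_sub, ← hKq, ← hKq']; linarith)
  have mm : Measurable (mx : (κ → ℝ) → ℝ) := measurable_mx (F := fun i (x : κ → ℝ) => x i) (by fun_prop)
  rw [integral_map (by fun_prop) mm.aestronglyMeasurable,
    integral_map (by fun_prop) mm.aestronglyMeasurable] at this
  exact this

abbrev Tor (L : ℕ) : Type := ZMod L × ZMod L

def ed {L : ℕ} (d : Bool) : Tor L := if d then (1, 0) else (0, 1)

section torus
variable {L : ℕ} [NeZero L]

def Eb (f g : Tor L → ℝ) : ℝ :=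
  ∑ d : Bool, ∑ x, (f x - f (x + ed d)) * (g x - g (x + ed d))

def mn (f : Tor L → ℝ) : ℝ := (∑ x, f x) / (L : ℝ) ^ 2

def Lap (f : Tor L → ℝ) (x : Tor L) : ℝ := ∑ d : Bool, (2 * f x - f (x + ed d) - f (x - ed d))

theorem sum_shift {M : Type} [AddCommMonoid M] (f : Tor L → M) (e : Tor L) :
    ∑ x, f (x + e) = ∑ x, f x :=
  Equiv.sum_comp (Equiv.addRight e) f

theorem green_id (f g : Tor L → ℝ) : ∑ x, g x * Lap f x = Eb f g := by
  unfold Lap Eb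
  simp_rw [Finset.mul_sum]
  rw [Finset.sum_comm]
  refine Finset.sum_congr rfl fun d _ => ?_
  have e1 : ∀ x, g x * (2 * f x - f (x + ed d) - f (x - ed d)) =
      g x * (f x - f (x + ed d)) + g x * (f x - f (x - ed d)) := fun x => by ring
  simp_rw [e1]
  rw [Finset.sum_add_distrib, ← sum_shift (fun x => g x * (f x - f (x - ed d))) (ed d),
    ← Finset.sum_add_distrib]
  refine Finset.sum_congr rfl fun x _ => ?_
  rw [add_sub_cancel_right]; ring

theorem Eb_comm (f g : Tor L → ℝ) : Eb f g = Eb g f := by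
  unfold Eb
  refine Finset.sum_congr rfl fun d _ => Finset.sum_congr rfl fun x _ => by ring

def QL : (Tor L → ℝ) →ₗ[ℝ] (Tor L → ℝ) where
  toFun f := fun x => Lap f x + mn f / (L : ℝ) ^ 2
  map_add' f g := by
    ext x; simp only [Lap, mn, Pi.add_apply, Finset.sum_add_distrib, Fintype.sum_bool]; ring
  map_smul' c f := by
    ext x
    simp only [Lap, mn, Pi.smul_apply, smul_eq_mul, ← Finset.mul_sum, Fintype.sum_bool,
      RingHom.id_apply]; ring

def Qm (L : ℕ) [NeZero L] : Matrix (Tor L) (Tor L) ℝ := LinearMap.toMatrix' QL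

theorem Qm_mulVec (f : Tor L → ℝ) (x : Tor L) :
    (Qm L).mulVec f x = Lap f x + mn f / (L : ℝ) ^ 2 := by
  unfold Qm; rw [LinearMap.toMatrix'_mulVec]; rfl

theorem Qm_form (f g : Tor L → ℝ) : g ⬝ᵥ (Qm L).mulVec f = Eb f g + mn f * mn g := by
  simp only [dotProduct, Qm_mulVec, mul_add, Finset.sum_add_distrib, green_id]
  rw [← Finset.sum_mul]; unfold mn; ring

theorem Qm_herm : (Qm L).IsHermitian := by
  rw [Matrix.IsHermitian, Matrix.conjTranspose_eq_transpose_of_trivial]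
  ext i j
  have h1 := Qm_form (L := L) (Pi.single i 1) (Pi.single j 1)
  have h2 := Qm_form (L := L) (Pi.single j 1) (Pi.single i 1)
  simp only [Matrix.mulVec_single_one, single_one_dotProduct, Matrix.col_apply] at h1 h2
  rw [Matrix.transpose_apply, h1, h2, Eb_comm, mul_comm]

theorem Eb_nonneg (f : Tor L → ℝ) : 0 ≤ Eb f f :=
  Finset.sum_nonneg fun d _ => Finset.sum_nonneg fun x _ => mul_self_nonneg _

theorem le_Eb (f : Tor L → ℝ) (d : Bool) (x : Tor L) : (f x - f (x + ed d)) ^ 2 ≤ Eb f f := by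
  unfold Eb
  have h1 := Finset.single_le_sum (f := fun d => ∑ x, (f x - f (x + ed d)) * (f x - f (x + ed d)))
    (fun d _ => Finset.sum_nonneg fun x _ => mul_self_nonneg _) (Finset.mem_univ d)
  have h2 := Finset.single_le_sum (f := fun x => (f x - f (x + ed d)) * (f x - f (x + ed d)))
    (fun x _ => mul_self_nonneg _) (Finset.mem_univ x)
  nlinarith

theorem const_of_Eb (f : Tor L → ℝ) (h : Eb f f = 0) (x : Tor L) : f x = f 0 := by
  have hd : ∀ d x, f (x + ed d) = f x := by
    intro d x
    have := le_Eb f d x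
    rw [h] at this
    nlinarith [sq_nonneg (f x - f (x + ed d))]
  have h1 : ∀ n : ℕ, ∀ y, f (y + (n : ZMod L) • (1, 0)) = f y := by
    intro n; induction n with
    | zero => simp
    | succ n ih =>
      intro y
      have := hd true (y + (n : ZMod L) • (1, 0))
      rw [ih] at this
      rw [← this]; congr 1; push_cast; rw [add_smul, ← add_assoc]; simp [ed]
  have h2 : ∀ n : ℕ, ∀ y, f (y + (n : ZMod L) • (0, 1)) = f y := by
    intro n; induction n with
    | zero => simp
    | succ n ih =>
      intro y
      have := hd false (y + (n : ZMod L) • (0, 1))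
      rw [ih] at this
      rw [← this]; congr 1; push_cast; rw [add_smul, ← add_assoc]; simp [ed]
  have e1 := h1 x.1.val 0
  have e2 := h2 x.2.val ((0 : Tor L) + (x.1.val : ZMod L) • (1, 0))
  rw [e1] at e2
  rw [← e2]; congr 1
  simp

theorem Qm_pd : (Qm L).PosDef := by
  apply Matrix.PosDef.of_dotProduct_mulVec_pos Qm_herm
  intro f hf
  rw [star_trivial, Qm_form]
  have h1 := Eb_nonneg f
  rcases h1.lt_or_eq with h | h
  · nlinarith [mul_self_nonneg (mn f)]
  · rw [← h, zero_add]
    have hc := const_of_Eb f h.symm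
    have : mn f = f 0 := by
      unfold mn
      simp_rw [hc]
      have : (L : ℝ) ≠ 0 := by exact_mod_cast NeZero.ne L
      simp [ZMod.card]; field_simp
    rw [this]
    apply mul_self_pos.2
    intro h0; apply hf; ext x; rw [hc x, h0]; rfl

def Km (L : ℕ) [NeZero L] : Matrix (Tor L) (Tor L) ℝ := (Qm L)⁻¹

def qK (a : Tor L → ℝ) : ℝ := a ⬝ᵥ (Km L).mulVec a

theorem QK : Qm L * Km L = 1 := Matrix.mul_nonsing_inv _ ((Matrix.isUnit_iff_isUnit_det _).1 Qm_pd.isUnit)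

theorem Km_pd : (Km L).PosDef := Qm_pd.inv

theorem qK_nonneg (a : Tor L → ℝ) : 0 ≤ qK a := by
  have := Km_pd.posSemidef.dotProduct_mulVec_nonneg a
  rwa [star_trivial] at this

theorem qK_opt (a : Tor L → ℝ) : ∃ f : Tor L → ℝ, (∀ x, Lap f x + mn f / (L:ℝ)^2 = a x) ∧
    qK a = ∑ x, a x * f x ∧ Eb f f + mn f * mn f = ∑ x, a x * f x := by
  have h : (Qm L).mulVec ((Km L).mulVec a) = a := by
    rw [Matrix.mulVec_mulVec, QK, Matrix.one_mulVec]
  refine ⟨(Km L).mulVec a, fun x => by rw [← Qm_mulVec, h], rfl, ?_⟩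
  rw [← Qm_form, h, dotProduct]
  simp_rw [mul_comm]

theorem Eb_add_left (f g h : Tor L → ℝ) : Eb (fun x => f x + g x) h = Eb f h + Eb g h := by
  unfold Eb; rw [← Finset.sum_add_distrib]
  refine Finset.sum_congr rfl fun d _ => ?_
  rw [← Finset.sum_add_distrib]
  refine Finset.sum_congr rfl fun x _ => by ring

theorem Eb_smul_left (t : ℝ) (f h : Tor L → ℝ) : Eb (fun x => t * f x) h = t * Eb f h := by
  unfold Eb; simp_rw [Finset.mul_sum]
  refine Finset.sum_congr rfl fun d _ => ?_
  refine Finset.sum_congr rfl fun x _ => by ring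

theorem mn_add (f g : Tor L → ℝ) : mn (fun x => f x + g x) = mn f + mn g := by
  unfold mn; rw [Finset.sum_add_distrib, add_div]

theorem mn_smul (t : ℝ) (g : Tor L → ℝ) : mn (fun x => t * g x) = t * mn g := by
  unfold mn; rw [← Finset.mul_sum, mul_div_assoc]

theorem qK_ge (a f : Tor L → ℝ) : 2 * ∑ x, a x * f x - (Eb f f + mn f * mn f) ≤ qK a := by
  obtain ⟨g, h1, h2, h3⟩ := qK_opt a
  have e : ∑ x, a x * f x = Eb g f + mn g * mn f := by
    rw [← Qm_form]
    simp only [dotProduct, Qm_mulVec, h1]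
    simp_rw [mul_comm]
  have h4 := Eb_nonneg (fun x => f x + (-1) * g x)
  rw [Eb_add_left, Eb_smul_left, Eb_comm f, Eb_comm g, Eb_add_left, Eb_add_left, Eb_smul_left,
    Eb_smul_left, Eb_comm f g] at h4
  nlinarith [mul_self_nonneg (mn f - mn g)]

theorem qK_le {a : Tor L → ℝ} {B : ℝ}
    (h : ∀ f, 2 * ∑ x, a x * f x - (Eb f f + mn f * mn f) ≤ B) : qK a ≤ B := by
  obtain ⟨g, h1, h2, h3⟩ := qK_opt a
  have := h g
  linarith

end torus

section dbl
variable {L : ℕ} [NeZero L]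

def dbl (L : ℕ) : ZMod L →+ ZMod (2 * L) :=
  ZMod.lift L ⟨(AddMonoidHom.mulLeft (2 : ZMod (2 * L))).comp (Int.castAddHom (ZMod (2 * L))), by
    have := ZMod.natCast_self (2 * L)
    push_cast at this
    simpa using this⟩

theorem dbl_int (i : ℤ) : dbl L (i : ZMod L) = 2 * (i : ZMod (2 * L)) := by
  simp [dbl]

theorem dbl_one : dbl L 1 = 1 + 1 := by
  have := dbl_int (L := L) 1
  push_cast at this
  rw [this]; norm_num

theorem dbl_inj : Function.Injective (dbl L) := by
  rw [dbl, ZMod.lift_injective]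
  intro m hm
  have h : ((2 * m : ℤ) : ZMod (2 * L)) = 0 := by push_cast; simpa using hm
  rw [ZMod.intCast_zmod_eq_zero_iff_dvd] at h
  rw [ZMod.intCast_zmod_eq_zero_iff_dvd]
  push_cast at h
  exact Int.dvd_of_mul_dvd_mul_left (by norm_num) h

theorem dbl_ne (x y : ZMod L) : dbl L x ≠ dbl L y + 1 := by
  intro h
  have h2 : (2 : ℕ) ∣ 2 * L := Dvd.intro _ rfl
  have key : ∀ x : ZMod L, ZMod.castHom h2 (ZMod 2) (dbl L x) = 0 := by
    intro x
    obtain ⟨i, rfl⟩ := ZMod.intCast_surjective x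
    rw [dbl_int, map_mul]
    have : ZMod.castHom h2 (ZMod 2) 2 = 0 := by rw [map_ofNat]; rfl
    rw [this, zero_mul]
  have := congrArg (ZMod.castHom h2 (ZMod 2)) h
  rw [map_add, key, key, map_one] at this
  exact absurd this (by decide)

def p0 (x : Tor L) : Tor (2 * L) := (dbl L x.1, dbl L x.2)

def bo (b : Bool) : ℤ := if b then 1 else 0

def pc (q : Tor L × Bool × Bool) : Tor (2 * L) :=
  p0 q.1 + (if q.2.1 then ed true else 0) + (if q.2.2 then ed false else 0)

theorem pc_inj : Function.Injective (pc (L := L)) := by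
  rintro ⟨⟨x, y⟩, b, c⟩ ⟨⟨x', y'⟩, b', c'⟩ h
  simp only [pc, p0, ed] at h
  have := @dbl_ne L _
  have hi := @dbl_inj L _
  cases b <;> cases b' <;> cases c <;> cases c' <;>
    simp [Prod.ext_iff, hi.eq_iff, this, (this _ _).symm] at h ⊢ <;> exact h

def pe : Tor L × Bool × Bool ≃ Tor (2 * L) :=
  Equiv.ofBijective pc (by
    rw [Fintype.bijective_iff_injective_and_card]
    refine ⟨pc_inj, ?_⟩
    simp [ZMod.card]; ring)

theorem ed_t : (ed true : Tor L) = (1, 0) := rfl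
theorem ed_f : (ed false : Tor L) = (0, 1) := rfl

theorem p0_ed (x : Tor L) (d : Bool) : p0 (x + ed d) = p0 x + ed d + ed d := by
  cases d <;> simp [p0, ed, Prod.ext_iff, dbl_one, add_assoc]

def mk (g : Bool → Bool → Tor L → ℝ) (z : Tor (2 * L)) : ℝ :=
  g (pe.symm z).2.1 (pe.symm z).2.2 (pe.symm z).1

theorem mk_pc (g : Bool → Bool → Tor L → ℝ) (q) : mk g (pc q) = g q.2.1 q.2.2 q.1 := by
  have : pe.symm (pc q) = q := pe.symm_apply_apply q
  rw [mk, this]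

theorem mk00 (g : Bool → Bool → Tor L → ℝ) (x) : mk g (p0 x) = g false false x := by
  rw [← mk_pc g (x, false, false)]; simp [pc]
theorem mk10 (g : Bool → Bool → Tor L → ℝ) (x) : mk g (p0 x + ed true) = g true false x := by
  rw [← mk_pc g (x, true, false)]; simp [pc]
theorem mk01 (g : Bool → Bool → Tor L → ℝ) (x) : mk g (p0 x + ed false) = g false true x := by
  rw [← mk_pc g (x, false, true)]; simp [pc]
theorem mk11 (g : Bool → Bool → Tor L → ℝ) (x) :
    mk g (p0 x + ed true + ed false) = g true true x := by
  rw [← mk_pc g (x, true, true)]; simp [pc]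

theorem sum2 (f : Tor (2 * L) → ℝ) : ∑ z, f z = ∑ x, (f (p0 x) + f (p0 x + ed true) +
    f (p0 x + ed false) + f (p0 x + ed true + ed false)) := by
  rw [← Equiv.sum_comp pe, Fintype.sum_prod_type]
  refine Finset.sum_congr rfl fun x _ => ?_
  rw [Fintype.sum_prod_type]
  simp only [Fintype.sum_bool, pe, Equiv.ofBijective_apply, pc]
  simp; ring

theorem Eb2 (f : Tor (2 * L) → ℝ) : Eb f f = ∑ x, (
    (f (p0 x) - f (p0 x + ed true)) ^ 2 + (f (p0 x + ed true) - f (p0 (x + ed true))) ^ 2 +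
    (f (p0 x + ed false) - f (p0 x + ed true + ed false)) ^ 2 +
    (f (p0 x + ed true + ed false) - f (p0 (x + ed true) + ed false)) ^ 2 +
    (f (p0 x) - f (p0 x + ed false)) ^ 2 + (f (p0 x + ed false) - f (p0 (x + ed false))) ^ 2 +
    (f (p0 x + ed true) - f (p0 x + ed true + ed false)) ^ 2 +
    (f (p0 x + ed true + ed false) - f (p0 (x + ed false) + ed true)) ^ 2) := by
  rw [Eb, Fintype.sum_bool, sum2, sum2, ← Finset.sum_add_distrib]
  refine Finset.sum_congr rfl fun x _ => ?_
  have e1 : p0 x + ed true + ed true = p0 (x + ed true) := (p0_ed _ _).symm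
  have e2 : p0 x + ed false + ed false = p0 (x + ed false) := (p0_ed _ _).symm
  have e3 : p0 x + ed false + ed true = p0 x + ed true + ed false := by abel
  have e4 : p0 x + ed true + ed false + ed true = p0 (x + ed true) + ed false := by
    rw [← e1]; abel
  have e5 : p0 x + ed true + ed false + ed false = p0 (x + ed false) + ed true := by
    rw [← e2]; abel
  rw [e1, e2, e3, e4, e5]; ring

def xt (f : Tor L → ℝ) : Bool → Bool → Tor L → ℝ
  | false, false => f
  | true, false => fun x => (f x + f (x + ed true)) / 2
  | false, true => fun x => (f x + f (x + ed false)) / 2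
  | true, true => fun x => (f x + f (x + ed true) + f (x + ed false) + f (x + ed true + ed false)) / 4

theorem Eb_xt (f : Tor L → ℝ) : Eb (mk (xt f)) (mk (xt f)) ≤ Eb f f := by
  rw [Eb2]
  simp only [mk00, mk10, mk01, mk11, xt]
  have h1 := sum_shift (fun x => (f x - f (x + ed true)) ^ 2) (ed false)
  have h2 := sum_shift (fun x => (f x - f (x + ed false)) ^ 2) (ed true)
  have h3 : Eb f f = ∑ x, (3 / 4 * (f x - f (x + ed true)) ^ 2 +
      1 / 4 * (f (x + ed false) - f (x + ed false + ed true)) ^ 2 +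
      3 / 4 * (f x - f (x + ed false)) ^ 2 +
      1 / 4 * (f (x + ed true) - f (x + ed true + ed false)) ^ 2) := by
    simp_rw [Finset.sum_add_distrib, ← Finset.mul_sum]
    rw [h1, h2, Eb, Fintype.sum_bool]
    simp_rw [← sq]; ring
  rw [h3]
  refine Finset.sum_le_sum fun x _ => ?_
  have e : x + ed false + ed true = x + ed true + ed false := by abel
  rw [e]
  nlinarith [sq_nonneg ((f x - f (x + ed true)) - (f (x + ed false) - f (x + ed true + ed false))),
    sq_nonneg ((f x - f (x + ed false)) - (f (x + ed true) - f (x + ed true + ed false)))]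

theorem p0_sub (x : Tor L) (d : Bool) : p0 x - ed d = p0 (x - ed d) + ed d := by
  have := p0_ed (x - ed d) d
  rw [sub_add_cancel] at this
  rw [this]; abel

theorem Lap_xt (f : Tor L → ℝ) (x : Tor L) : Lap (mk (xt f)) (p0 x) = Lap f x / 2 := by
  simp only [Lap, Fintype.sum_bool, p0_sub, mk00, mk10, mk01, xt, sub_add_cancel]
  ring

def z0 (a : Tor L → ℝ) : Bool → Bool → Tor L → ℝ
  | false, false => a
  | _, _ => fun _ => 0

theorem sum_z0 (a : Tor L → ℝ) (f : Tor (2 * L) → ℝ) :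
    ∑ z, mk (z0 a) z * f z = ∑ x, a x * f (p0 x) := by
  rw [sum2]
  simp [mk00, mk10, mk01, mk11, z0]

theorem Lap_z0 (a : Tor L → ℝ) (x : Tor L) : Lap (mk (z0 a)) (p0 x) = 4 * a x := by
  simp only [Lap, Fintype.sum_bool, p0_sub, mk00, mk10, mk01, z0]
  ring

theorem mn_xt (f : Tor L → ℝ) : mn (mk (xt f)) = mn f := by
  rw [mn, mn, sum2]
  simp only [mk00, mk10, mk01, mk11, xt, Finset.sum_add_distrib, ← Finset.sum_div]
  have h : ∑ x, f (x + ed true + ed false) = ∑ x, f x := by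
    rw [← sum_shift f (ed true + ed false)]; simp_rw [add_assoc]
  rw [h, sum_shift f, sum_shift f]
  push_cast
  field_simp
  ring

theorem mn_z0 (a : Tor L → ℝ) : mn (mk (z0 a)) = (∑ x, a x) / (4 * (L:ℝ) ^ 2) := by
  have := sum_z0 a (fun _ => 1)
  simp only [mul_one] at this
  rw [mn, this]; push_cast; ring_nf

theorem sum_Lap (f : Tor L → ℝ) : ∑ x, Lap f x = 0 := by
  have := green_id f (fun _ => 1)
  simp only [one_mul] at this
  rw [this]; simp [Eb]

theorem Eb_sq (t : ℝ) (f g : Tor L → ℝ) : Eb (fun x => f x + t * g x) (fun x => f x + t * g x) =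
    Eb f f + 2 * t * Eb f g + t ^ 2 * Eb g g := by
  unfold Eb; simp_rw [Finset.mul_sum]; rw [← Finset.sum_add_distrib, ← Finset.sum_add_distrib]
  refine Finset.sum_congr rfl fun d _ => ?_
  rw [← Finset.sum_add_distrib, ← Finset.sum_add_distrib]
  refine Finset.sum_congr rfl fun x _ => by ring

theorem psd_step (a : Tor L → ℝ) : qK a + 1 / 16 * ∑ x, a x ^ 2 ≤ qK (mk (z0 a)) := by
  obtain ⟨f, h1, h2, h3⟩ := qK_opt a
  have hL : (1 : ℝ) ≤ L := by exact_mod_cast NeZero.one_le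
  have hA : mn f = ∑ x, a x := by
    have : ∑ x, (Lap f x + mn f / (L:ℝ)^2) = ∑ x, a x := by simp_rw [h1]
    rw [Finset.sum_add_distrib, sum_Lap, zero_add] at this
    rw [← this]; simp [ZMod.card]; field_simp
  have k := qK_ge (mk (z0 a)) (fun z => mk (xt f) z + 1 / 8 * mk (z0 a) z)
  rw [sum_z0, mn_add, mn_smul, mn_xt, mn_z0, Eb_sq, ← green_id (mk (xt f)) (mk (z0 a)),
    ← green_id (mk (z0 a)) (mk (z0 a)), sum_z0, sum_z0] at k
  simp only [mk00, Lap_xt, Lap_z0, z0, xt] at k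
  have e1 : ∑ x, a x * (Lap f x / 2) = (∑ x, a x ^ 2 - (∑ x, a x) ^ 2 / (L:ℝ) ^ 2) / 2 := by
    have : ∀ x, a x * (Lap f x / 2) = (a x ^ 2 - a x * (mn f / (L:ℝ)^2)) / 2 := by
      intro x; rw [← h1 x]; ring
    simp_rw [this]
    rw [← Finset.sum_div, Finset.sum_sub_distrib, ← Finset.sum_mul, hA]; ring
  have e2 : ∑ x, a x * (f x + 1 / 8 * a x) = ∑ x, a x * f x + 1 / 8 * ∑ x, a x ^ 2 := by
    rw [Finset.mul_sum, ← Finset.sum_add_distrib]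
    exact Finset.sum_congr rfl fun x _ => by ring
  have e3 : ∑ x, a x * (4 * a x) = 4 * ∑ x, a x ^ 2 := by
    rw [Finset.mul_sum]
    exact Finset.sum_congr rfl fun x _ => by ring
  rw [e1, e2, e3, hA] at k
  have hx := Eb_xt f
  rw [hA] at h3
  set A := ∑ x, a x
  have e4 : A / (4 * (L:ℝ)^2) = A / (L:ℝ)^2 / 4 := by field_simp
  have e5 : A ^ 2 / (L:ℝ)^2 = A * (A / (L:ℝ)^2) := by ring
  rw [e4, e5] at k
  have hB : (A / (L:ℝ)^2) ^ 2 ≤ A * (A / (L:ℝ)^2) := by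
    rw [← e5, div_pow]
    apply div_le_div_of_nonneg_left (sq_nonneg _) (by positivity)
    nlinarith [sq_nonneg ((L:ℝ) ^ 2), one_le_pow₀ hL (n := 2)]
  have : 0 ≤ (A / (L:ℝ)^2) ^ 2 := sq_nonneg _
  nlinarith

def psh {X Z : Type} [Fintype X] (e : X → Z) (a : X → ℝ) (z : Z) : ℝ := ∑ x, if e x = z then a x else 0

theorem psh_sum {X Z : Type} [Fintype X] [Fintype Z] (e : X → Z) (a : X → ℝ) (f : Z → ℝ) :
    ∑ z, psh e a z * f z = ∑ x, a x * f (e x) := by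
  simp only [psh, Finset.sum_mul]
  rw [Finset.sum_comm]
  refine Finset.sum_congr rfl fun x _ => ?_
  simp [ite_mul]

theorem psh_inj {X Z : Type} [Fintype X] {e : X → Z} (he : Function.Injective e) (a : X → ℝ) (x : X) :
    psh e a (e x) = a x := by
  simp [psh, he.eq_iff]

theorem psh_comp {X Y Z : Type} [Fintype X] [Fintype Y] (e : X → Y) (e' : Y → Z) (a : X → ℝ) :
    psh e' (psh e a) = psh (e' ∘ e) a := by
  ext z
  have := psh_sum e a (fun y => if e' y = z then 1 else 0)
  simpa [psh, mul_ite] using this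

theorem ext_sum {Z : Type} [Fintype Z] {a b : Z → ℝ} (h : ∀ f : Z → ℝ, ∑ z, a z * f z = ∑ z, b z * f z) :
    a = b := by
  ext z; simpa using h (fun y => if y = z then 1 else 0)

theorem p0_inj : Function.Injective (p0 (L := L)) := by
  rintro ⟨x, y⟩ ⟨x', y'⟩ h
  simpa [p0, Prod.ext_iff, dbl_inj.eq_iff] using h

theorem emb_ex (k : ℕ) : ∀ M [NeZero M], M = 2 ^ k * L → ∃ e : Tor L → Tor M,
    Function.Injective e ∧ ∀ a, qK a + k / 16 * ∑ x, a x ^ 2 ≤ qK (psh e a) := by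
  induction k with
  | zero =>
    intro M _ h
    obtain rfl : M = L := by simpa using h
    refine ⟨id, Function.injective_id, fun a => ?_⟩
    have : psh id a = a := ext_sum fun f => by rw [psh_sum]; rfl
    rw [this]; simp
  | succ k ih =>
    intro M _ h
    haveI : NeZero (2 ^ k * L) := ⟨by have := NeZero.ne L; positivity⟩
    obtain ⟨e, he, hq⟩ := ih (2 ^ k * L) rfl
    obtain rfl : M = 2 * (2 ^ k * L) := by rw [h]; ring
    refine ⟨p0 ∘ e, p0_inj.comp he, fun a => ?_⟩
    have h1 := psd_step (psh e a)
    have h2 : mk (z0 (psh e a)) = psh p0 (psh e a) := ext_sum fun f => by rw [sum_z0, psh_sum p0]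
    rw [h2, psh_comp] at h1
    have h3 : ∑ z, psh e a z ^ 2 = ∑ x, a x ^ 2 := by
      simp_rw [sq]; rw [psh_sum]; simp_rw [psh_inj he]
    rw [h3] at h1
    have := hq a
    push_cast
    linarith

end dbl

section vgrow
variable {L : ℕ} [NeZero L]

def dl {X : Type} (x : X) : X → ℝ := fun y => if y = x then 1 else 0

theorem sum_dl {X : Type} [Fintype X] (x : X) (f : X → ℝ) : ∑ y, dl x y * f y = f x := by
  simp [dl]

theorem Eb_trans (f : Tor L → ℝ) (e : Tor L) :
    Eb (fun x => f (x + e)) (fun x => f (x + e)) = Eb f f := by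
  unfold Eb
  refine Finset.sum_congr rfl fun d _ => ?_
  rw [← sum_shift (fun x => (f x - f (x + ed d)) * (f x - f (x + ed d))) e]
  simp_rw [add_right_comm]

theorem qK_dl (x y : Tor L) : qK (dl x) ≤ qK (dl y) := by
  apply qK_le
  intro f
  have h := qK_ge (dl y) (fun z => f (z + (x - y)))
  rw [sum_dl, Eb_trans] at h
  have e : mn (fun z => f (z + (x - y))) = mn f := by unfold mn; rw [sum_shift f]
  rw [e] at h
  rw [sum_dl]
  simpa using h

theorem two_sub (t : ℝ) : 2 * t ≤ 1 + t ^ 2 := by nlinarith [sq_nonneg (t - 1)]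

theorem qK_adj (x : Tor L) (d : Bool) : qK (fun z => dl x z - dl (x + ed d) z) ≤ 1 := by
  apply qK_le
  intro f
  simp_rw [sub_mul]
  rw [Finset.sum_sub_distrib, sum_dl, sum_dl]
  have := le_Eb f d x
  nlinarith [two_sub (f x - f (x + ed d)), mul_self_nonneg (mn f)]

theorem le_Eb' (f : Tor L → ℝ) (x y : Tor L) :
    (f x - f (x + ed true)) ^ 2 + (f y - f (y + ed false)) ^ 2 ≤ Eb f f := by
  unfold Eb
  rw [Fintype.sum_bool]
  have h2 := Finset.single_le_sum (f := fun x => (f x - f (x + ed true)) * (f x - f (x + ed true)))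
    (fun x _ => mul_self_nonneg _) (Finset.mem_univ x)
  have h3 := Finset.single_le_sum (f := fun x => (f x - f (x + ed false)) * (f x - f (x + ed false)))
    (fun x _ => mul_self_nonneg _) (Finset.mem_univ y)
  nlinarith

theorem qK_diag (x : Tor L) : qK (fun z => dl x z - dl (x + ed true + ed false) z) ≤ 2 := by
  apply qK_le
  intro f
  simp_rw [sub_mul]
  rw [Finset.sum_sub_distrib, sum_dl, sum_dl]
  have := le_Eb' f x (x + ed true)
  nlinarith [two_sub (f x - f (x + ed true)), two_sub (f (x + ed true) - f (x + ed true + ed false)),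
    mul_self_nonneg (mn f)]

theorem qK_diag' (x : Tor L) : qK (fun z => dl (x + ed true) z - dl (x + ed false) z) ≤ 2 := by
  apply qK_le
  intro f
  simp_rw [sub_mul]
  rw [Finset.sum_sub_distrib, sum_dl, sum_dl]
  have := le_Eb' f x x
  nlinarith [two_sub (f (x + ed true) - f x), two_sub (f x - f (x + ed false)),
    mul_self_nonneg (mn f)]

theorem qK_four (a b c d : Tor L → ℝ) : qK (fun z => 1 / 4 * (a z + b z + c z + d z)) =
    (4 * (qK a + qK b + qK c + qK d) - qK (fun z => a z - b z) - qK (fun z => a z - c z)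
      - qK (fun z => a z - d z) - qK (fun z => b z - c z) - qK (fun z => b z - d z)
      - qK (fun z => c z - d z)) / 16 := by
  change qK ((1 / 4 : ℝ) • (a + b + c + d)) = (4 * (qK a + qK b + qK c + qK d) - qK (a - b) -
    qK (a - c) - qK (a - d) - qK (b - c) - qK (b - d) - qK (c - d)) / 16
  simp only [qK, Matrix.mulVec_add, Matrix.mulVec_sub, Matrix.mulVec_smul, dotProduct_add,
    dotProduct_sub, dotProduct_smul, add_dotProduct, sub_dotProduct, smul_dotProduct, smul_eq_mul]
  ring

theorem Eb_avg (f : Tor (2 * L) → ℝ) :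
    Eb (fun x : Tor L => 1 / 4 * (f (p0 x) + f (p0 x + ed true) + f (p0 x + ed false) +
      f (p0 x + ed true + ed false))) (fun x : Tor L => 1 / 4 * (f (p0 x) + f (p0 x + ed true) +
      f (p0 x + ed false) + f (p0 x + ed true + ed false))) ≤ Eb f f := by
  rw [Eb2]
  set f0 := fun x => f (p0 x)
  set f1 := fun x => f (p0 x + ed true)
  set f2 := fun x => f (p0 x + ed false)
  set f3 := fun x => f (p0 x + ed true + ed false)
  change Eb (fun x => 1 / 4 * (f0 x + f1 x + f2 x + f3 x))
    (fun x => 1 / 4 * (f0 x + f1 x + f2 x + f3 x)) ≤ ∑ x, (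
    (f0 x - f1 x) ^ 2 + (f1 x - f0 (x + ed true)) ^ 2 + (f2 x - f3 x) ^ 2 +
    (f3 x - f2 (x + ed true)) ^ 2 + (f0 x - f2 x) ^ 2 + (f2 x - f0 (x + ed false)) ^ 2 +
    (f1 x - f3 x) ^ 2 + (f3 x - f1 (x + ed false)) ^ 2)
  have s1 := sum_shift (fun x => (f0 x - f1 x) ^ 2) (ed true)
  have s2 := sum_shift (fun x => (f2 x - f3 x) ^ 2) (ed true)
  have s3 := sum_shift (fun x => (f0 x - f2 x) ^ 2) (ed false)
  have s4 := sum_shift (fun x => (f1 x - f3 x) ^ 2) (ed false)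
  have e : ∑ x, (
    (f0 x - f1 x) ^ 2 + (f1 x - f0 (x + ed true)) ^ 2 + (f2 x - f3 x) ^ 2 +
    (f3 x - f2 (x + ed true)) ^ 2 + (f0 x - f2 x) ^ 2 + (f2 x - f0 (x + ed false)) ^ 2 +
    (f1 x - f3 x) ^ 2 + (f3 x - f1 (x + ed false)) ^ 2) = ∑ x, (
    1 / 2 * (f0 x - f1 x) ^ 2 + 1 / 2 * (f0 (x + ed true) - f1 (x + ed true)) ^ 2 +
    (f1 x - f0 (x + ed true)) ^ 2 + 1 / 2 * (f2 x - f3 x) ^ 2 +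
    1 / 2 * (f2 (x + ed true) - f3 (x + ed true)) ^ 2 +
    (f3 x - f2 (x + ed true)) ^ 2 + 1 / 2 * (f0 x - f2 x) ^ 2 +
    1 / 2 * (f0 (x + ed false) - f2 (x + ed false)) ^ 2 + (f2 x - f0 (x + ed false)) ^ 2 +
    1 / 2 * (f1 x - f3 x) ^ 2 + 1 / 2 * (f1 (x + ed false) - f3 (x + ed false)) ^ 2 +
    (f3 x - f1 (x + ed false)) ^ 2) := by
    simp_rw [Finset.sum_add_distrib, ← Finset.mul_sum]
    rw [s1, s2, s3, s4]; ring
  rw [e, Eb, Fintype.sum_bool, ← Finset.sum_add_distrib]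
  refine Finset.sum_le_sum fun x _ => ?_
  have key : ∀ A B A' C D C' : ℝ, (1 / 4 * (A + 2 * B + A' + C + 2 * D + C')) ^ 2 ≤
      1 / 2 * A ^ 2 + 1 / 2 * A' ^ 2 + B ^ 2 + (1 / 2 * C ^ 2 + 1 / 2 * C' ^ 2 + D ^ 2) := by
    intro A B A' C D C'
    nlinarith [sq_nonneg ((A + 2 * B + A') - (C + 2 * D + C')), sq_nonneg (A - B), sq_nonneg (A' - B),
      sq_nonneg (A - A'), sq_nonneg (C - D), sq_nonneg (C' - D), sq_nonneg (C - C')]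
  have k1 := key (f0 x - f1 x) (f1 x - f0 (x + ed true)) (f0 (x + ed true) - f1 (x + ed true))
    (f2 x - f3 x) (f3 x - f2 (x + ed true)) (f2 (x + ed true) - f3 (x + ed true))
  have k2 := key (f0 x - f2 x) (f2 x - f0 (x + ed false)) (f0 (x + ed false) - f2 (x + ed false))
    (f1 x - f3 x) (f3 x - f1 (x + ed false)) (f1 (x + ed false) - f3 (x + ed false))
  refine le_trans (le_of_eq ?_) (le_trans (add_le_add k1 k2) (le_of_eq ?_)) <;> ring

theorem var_step : qK (dl (0 : Tor (2 * L))) ≤ qK (dl (0 : Tor L)) + 1 / 2 := by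
  have h0 : p0 (0 : Tor L) = 0 := by simp [p0]
  have h1 : qK (fun z => 1 / 4 * (dl (p0 (0 : Tor L)) z + dl (p0 (0 : Tor L) + ed true) z +
      dl (p0 (0 : Tor L) + ed false) z + dl (p0 (0 : Tor L) + ed true + ed false) z)) ≤
      qK (dl (0 : Tor L)) := by
    apply qK_le
    intro f
    have := qK_ge (dl (0 : Tor L)) (fun x : Tor L => 1 / 4 * (f (p0 x) + f (p0 x + ed true) + f (p0 x + ed false) +
      f (p0 x + ed true + ed false)))
    have e := Eb_avg f
    have m : mn (fun x : Tor L => 1 / 4 * (f (p0 x) + f (p0 x + ed true) + f (p0 x + ed false) +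
      f (p0 x + ed true + ed false))) = mn f := by
      rw [mn, mn, sum2 f, ← Finset.mul_sum]
      push_cast; field_simp; ring
    rw [m, sum_dl] at this
    simp_rw [mul_assoc, ← Finset.mul_sum, add_mul, Finset.sum_add_distrib, sum_dl]
    linarith
  rw [qK_four] at h1
  have a1 := qK_adj (p0 (0 : Tor L)) true
  have a2 := qK_adj (p0 (0 : Tor L)) false
  have a3 := qK_diag (p0 (0 : Tor L))
  have a4 := qK_diag' (p0 (0 : Tor L))
  have a5 := qK_adj (p0 (0 : Tor L) + ed true) false
  have a6 := qK_adj (p0 (0 : Tor L) + ed false) true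
  rw [add_right_comm] at a6
  have b1 := qK_dl 0 (p0 (0 : Tor L))
  have b2 := qK_dl 0 (p0 (0 : Tor L) + ed true)
  have b3 := qK_dl 0 (p0 (0 : Tor L) + ed false)
  have b4 := qK_dl 0 (p0 (0 : Tor L) + ed true + ed false)
  linarith

theorem var_bound (n : ℕ) : ∀ M [NeZero M], M = 2 ^ n → qK (dl (0 : Tor M)) ≤ 1 + n / 2 := by
  induction n with
  | zero =>
    intro M _ h
    obtain rfl : M = 1 := by simpa using h
    apply qK_le
    intro f
    rw [sum_dl]
    have h1 : mn f = f 0 := by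
      unfold mn
      rw [Fintype.sum_subsingleton _ (0 : Tor 1)]; simp
    rw [h1]
    have := Eb_nonneg f
    push_cast
    nlinarith [two_sub (f 0)]
  | succ n ih =>
    intro M _ h
    obtain rfl : M = 2 * 2 ^ n := by rw [h]; ring
    have h1 := ih (2 ^ n) rfl
    have h2 := var_step (L := 2 ^ n)
    push_cast; linarith

def muT (L : ℕ) [NeZero L] : Measure (Tor L → ℝ) :=
  Classical.choose (exists_isG (Km_pd (L := L)).posSemidef)

theorem isG_muT : IsG (muT L) qK := Classical.choose_spec (exists_isG (Km_pd (L := L)).posSemidef)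

instance : IsProbabilityMeasure (muT L) := isG_muT.prob

def cT (L : ℕ) [NeZero L] : ℝ := ∫ x, mx x ∂muT L

theorem cT_nonneg : 0 ≤ cT L := by
  have h := (isG_muT (L := L)).mean 0
  rw [← h]
  exact integral_mono ((isG_muT (L := L)).int 0) (integrable_mx fun i => isG_muT.int i)
    fun x => le_mx x 0

theorem cT_le (n : ℕ) (M : ℕ) [NeZero M] (h : M = 2 ^ n) : cT M ≤ 3 * (n + 1) := by
  have hv := var_bound n M h
  set V : ℝ := qK (dl (0 : Tor M))
  have hV : 0 ≤ V := qK_nonneg _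
  set A : ℝ := (M:ℝ) ^ 2 * Real.exp (V / 2)
  have hM : (0 : ℝ) < M := by exact_mod_cast NeZero.pos M
  have hA : 0 < A := by positivity
  have hc : ∀ i : Tor M, (muT M).map (fun x => x i) = gaussianReal 0 V.toNNReal := by
    intro i
    rw [isG_muT.coord i]; congr 2
    refine Eq.trans (congrArg qK ?_) (le_antisymm (qK_dl i 0) (qK_dl 0 i))
    ext y; simp [dl, Pi.single_apply]
  have he : ∀ i : Tor M, Integrable (fun x : Tor M → ℝ => Real.exp (x i)) (muT M) ∧
      ∫ x, Real.exp (x i) ∂muT M = Real.exp (V / 2) := by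
    intro i
    have h1 : Integrable (fun x : ℝ => Real.exp x) ((muT M).map (fun x => x i)) := by
      rw [hc]; simpa using integrable_exp_mul_gaussianReal (μ := 0) (v := V.toNNReal) 1
    refine ⟨h1.comp_measurable (by fun_prop), ?_⟩
    rw [← integral_map (f := fun x : ℝ => Real.exp x) (φ := fun x : Tor M → ℝ => x i) (measurable_pi_apply i).aemeasurable
      (by fun_prop), hc]
    have h2 := mgf_gaussianReal (p := gaussianReal 0 V.toNNReal) (X := id) (μ := 0)
      (v := V.toNNReal) (by simp) 1
    simp only [mgf, id, one_mul] at h2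
    rw [h2]; simp [Real.coe_toNNReal _ hV]
  have hp : ∀ x : Tor M → ℝ, mx x ≤ (∑ i, Real.exp (x i)) / A - 1 + Real.log A := by
    intro x
    obtain ⟨i, hi⟩ := exists_mx x
    rw [hi]
    have h1 : Real.exp (x i) ≤ ∑ i, Real.exp (x i) :=
      Finset.single_le_sum (f := fun i => Real.exp (x i)) (fun i _ => (Real.exp_pos _).le) (Finset.mem_univ i)
    have h2 := Real.add_one_le_exp (x i - Real.log A)
    rw [Real.exp_sub, Real.exp_log hA] at h2
    have := div_le_div_of_nonneg_right h1 hA.le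
    linarith
  have hI : Integrable (fun x : Tor M → ℝ => (∑ i, Real.exp (x i)) / A - 1 + Real.log A) (muT M) :=
    (((integrable_finsetSum _ fun i _ => (he i).1).div_const _).sub (integrable_const _)).add
      (integrable_const _)
  have h1 : cT M ≤ ∫ x, ((∑ i, Real.exp (x i)) / A - 1 + Real.log A) ∂muT M :=
    integral_mono (integrable_mx fun i => isG_muT.int i) hI hp
  have h2 : ∫ x, ((∑ i, Real.exp (x i)) / A - 1 + Real.log A) ∂muT M = Real.log A := by
    have i1 : Integrable (fun x : Tor M → ℝ => (∑ i, Real.exp (x i)) / A) (muT M) :=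
      (integrable_finsetSum _ fun i _ => (he i).1).div_const _
    have i2 : Integrable (fun x : Tor M → ℝ => (∑ i, Real.exp (x i)) / A - 1) (muT M) :=
      i1.sub (integrable_const _)
    rw [integral_add i2 (integrable_const _), integral_sub i1 (integrable_const _), integral_div,
      integral_finsetSum _ fun i _ => (he i).1]
    simp_rw [fun i => (he i).2]
    have : (∑ i : Tor M, Real.exp (V / 2)) / A = 1 := by
      rw [div_eq_one_iff_eq hA.ne']
      simp [ZMod.card, A]; ring
    rw [this]; simp
  rw [h2] at h1
  have h3 : Real.log A = 2 * (n * Real.log 2) + V / 2 := by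
    rw [Real.log_mul (by positivity) (by positivity), Real.log_exp, h]; push_cast
    rw [Real.log_pow, Real.log_pow]; push_cast; ring
  have h4 := Real.log_two_lt_d9
  have h5 : (n:ℝ) * Real.log 2 ≤ n * 1 := by
    apply mul_le_mul_of_nonneg_left _ (by positivity); linarith
  have : (0:ℝ) ≤ n := by positivity
  linarith

theorem good_scale (k N : ℕ) : ∃ n ≥ N, cT (2 ^ (n + k)) ≤ cT (2 ^ n) + (3 * k + 1) := by
  by_contra! hcon
  have hk : ∀ j : ℕ, (3 * k + 1 : ℝ) * j ≤ cT (2 ^ (N + j * k)) := by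
    intro j; induction j with
    | zero => simpa using cT_nonneg
    | succ j ih =>
      have := hcon (N + j * k) (by omega)
      have e : N + j * k + k = N + (j + 1) * k := by ring
      rw [e] at this
      push_cast; linarith
  obtain ⟨j, hj⟩ := exists_nat_gt (3 * (N + 1) : ℝ)
  have h1 := hk j
  have h2 := cT_le (N + j * k) (2 ^ (N + j * k)) rfl
  push_cast at h2
  nlinarith

theorem lap_sq (B : Tor L → ℝ) : Eb B B ≤ 8 * ∑ x, B x ^ 2 := by
  have s1 := fun d => sum_shift (fun x => B x ^ 2) (ed d)
  have : 8 * ∑ x, B x ^ 2 = ∑ d : Bool, ∑ x, (2 * B x ^ 2 + 2 * B (x + ed d) ^ 2) := by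
    simp_rw [Finset.sum_add_distrib, ← Finset.mul_sum, s1, Fintype.sum_bool]; ring
  rw [this, Eb]
  refine Finset.sum_le_sum fun d _ => Finset.sum_le_sum fun x _ => ?_
  nlinarith [sq_nonneg (B x + B (x + ed d))]

theorem qK_lap (A B : Tor L → ℝ) :
    qK (fun x => A x + Lap B x) ≤ qK A + ∑ x, A x ^ 2 + 9 * ∑ x, B x ^ 2 := by
  apply qK_le
  intro f
  have h := qK_ge A (fun x => (fun x => f x + (-1) * B x) x + mn B * 1)
  rw [Eb_sq, Eb_sq, mn_add, mn_smul, mn_add, mn_smul] at h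
  have hL : (L : ℝ) ≠ 0 := by exact_mod_cast NeZero.ne L
  have m1 : mn (fun _ : Tor L => (1 : ℝ)) = 1 := by
    simp [mn, ZMod.card]; field_simp
  have z1 : Eb (fun x => f x + (-1) * B x) (fun _ : Tor L => (1 : ℝ)) = 0 := by simp [Eb]
  have z2 : Eb (fun _ : Tor L => (1 : ℝ)) (fun _ : Tor L => (1 : ℝ)) = 0 := by simp [Eb]
  rw [m1, z1, z2] at h
  have e1 : ∑ x, (A x + Lap B x) * f x = ∑ x, A x * f x + Eb f B := by
    simp_rw [add_mul]; rw [Finset.sum_add_distrib, ← Eb_comm B f, ← green_id B f]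
    simp_rw [mul_comm]
  have e2 : ∑ x, A x * (f x + -1 * B x + mn B * 1) =
      ∑ x, A x * f x - ∑ x, A x * B x + mn B * ∑ x, A x := by
    rw [Finset.mul_sum, ← Finset.sum_sub_distrib, ← Finset.sum_add_distrib]
    exact Finset.sum_congr rfl fun x _ => by ring
  rw [e2] at h
  rw [e1]
  have h1 := lap_sq B

  have h2 : 2 * (∑ x, A x * B x - mn B * ∑ x, A x) ≤ ∑ x, A x ^ 2 + ∑ x, B x ^ 2 := by
    have : ∑ x, (A x ^ 2 + (B x - mn B) ^ 2 - 2 * (A x * (B x - mn B))) =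
        ∑ x, A x ^ 2 + ∑ x, B x ^ 2 - (L : ℝ) ^ 2 * mn B ^ 2 -
          2 * (∑ x, A x * B x - mn B * ∑ x, A x) := by
      have i1 : ∀ x, A x ^ 2 + (B x - mn B) ^ 2 - 2 * (A x * (B x - mn B)) =
        A x ^ 2 + B x ^ 2 - 2 * mn B * B x + mn B ^ 2 - 2 * (A x * B x) + 2 * mn B * A x :=
          fun x => by ring
      simp_rw [i1, Finset.sum_add_distrib, Finset.sum_sub_distrib, Finset.sum_add_distrib,
        Finset.sum_sub_distrib, Finset.sum_add_distrib, ← Finset.mul_sum]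
      have i2 : ∑ x, B x = (L : ℝ) ^ 2 * mn B := by rw [mn]; field_simp
      rw [i2]
      simp [ZMod.card]; ring
    have h3 : 0 ≤ ∑ x, (A x ^ 2 + (B x - mn B) ^ 2 - 2 * (A x * (B x - mn B))) :=
      Finset.sum_nonneg fun x _ => by nlinarith [sq_nonneg (A x - (B x - mn B))]
    nlinarith [mul_nonneg (sq_nonneg (L : ℝ)) (sq_nonneg (mn B))]
  linarith

end vgrow

theorem noise_int {Z Ω I E : Type} [MeasurableSpace Z] [MeasurableSpace Ω] [Fintype I] [Nonempty I] [Fintype E]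
    {ν : Measure Z} [IsProbabilityMeasure ν] {μ : Measure Ω} [IsProbabilityMeasure μ] {f : Ω → ℝ}
    (hf : Integrable f μ) {s C : ℝ} (π : I → E)
    (h : ∀ a : I → ℝ, ∫ x : E → Ω, mx (fun i => a i + f (x (π i))) ∂(Measure.pi fun _ => μ) ≤
      C + ∫ x : E → ℝ, mx (fun i => a i + s * x (π i)) ∂stdP E)
    {a : I → Z → ℝ} (ha : ∀ i, Integrable (a i) ν) :
    ∫ ω, mx (fun i => a i ω.1 + f (ω.2 (π i))) ∂(ν.prod (Measure.pi fun _ : E => μ)) ≤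
      C + ∫ ω, mx (fun i => a i ω.1 + s * ω.2 (π i)) ∂(ν.prod (stdP E)) := by
  have i1 : Integrable (fun ω : Z × (E → Ω) => mx (fun i => a i ω.1 + f (ω.2 (π i))))
      (ν.prod (Measure.pi fun _ : E => μ)) :=
    integrable_mx fun i => ((ha i).comp_fst _).add
      (Integrable.comp_snd (f := fun x : E → Ω => f (x (π i)))
        ((measurePreserving_eval (fun _ : E => μ) (π i)).integrable_comp_of_integrable hf) ν)
  have i2 : Integrable (fun ω : Z × (E → ℝ) => mx (fun i => a i ω.1 + s * ω.2 (π i)))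
      (ν.prod (stdP E)) :=
    integrable_mx fun i => ((ha i).comp_fst _).add
      (Integrable.comp_snd (f := fun x : E → ℝ => s * x (π i)) ((isG_std.int (π i)).const_mul s) ν)
  rw [integral_prod _ i1, integral_prod _ i2]
  have : C + ∫ z, ∫ x, mx (fun i => a i z + s * x (π i)) ∂stdP E ∂ν =
      ∫ z, (C + ∫ x, mx (fun i => a i z + s * x (π i)) ∂stdP E) ∂ν := by
    rw [integral_add (integrable_const _) i2.integral_prod_left]; simp
  rw [this]
  exact integral_mono i1.integral_prod_left ((integrable_const _).add i2.integral_prod_left)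
    fun z => h fun i => a i z

theorem mixG {X E : Type} [Fintype X] [Fintype E] {ν : Measure (X → ℝ)} {ν' : Measure (E → ℝ)}
    {q q'} (h : IsG ν q) (h' : IsG ν' q') (hq : ∀ c, 0 ≤ q c) (hq' : ∀ c, 0 ≤ q' c) (a : X → ℝ)
    (b : E → ℝ) : (ν.prod ν').map (fun ω => ∑ x, a x * ω.1 x + ∑ e, b e * ω.2 e) =
      gaussianReal 0 (q a + q' b).toNNReal := by
  have := h.prob
  have := h'.prob
  rw [gauss_sum_prod ν ν' (fun x => ∑ i, a i * x i) (by fun_prop) (fun x => ∑ i, b i * x i) (by fun_prop)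
    _ _ (h a) (h' b), Real.toNNReal_add (hq a) (hq' b)]

theorem psh_sq {T R Z : Type} [Fintype T] [Fintype R] [Fintype Z] (e : T × R → Z)
    (he : ∀ r, Function.Injective fun x => e (x, r)) (c : T × R → ℝ) :
    ∑ z, psh e c z ^ 2 ≤ Fintype.card R * ∑ i, c i ^ 2 := by
  have h1 : ∀ z, psh e c z ^ 2 ≤ Fintype.card R * ∑ i, (if e i = z then c i ^ 2 else 0) := by
    intro z
    rw [psh, ← Finset.sum_filter, ← Finset.sum_filter]
    refine sq_sum_le_card_mul_sum_sq.trans ?_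
    apply mul_le_mul_of_nonneg_right _ (Finset.sum_nonneg fun i _ => sq_nonneg _)
    have : (Finset.univ.filter fun i => e i = z).card ≤ (Finset.univ : Finset R).card := by
      apply Finset.card_le_card_of_injOn Prod.snd (by simp)
      rintro ⟨x, r⟩ h ⟨y, r'⟩ h' (rfl : r = r')
      simp at h h'
      have := he r (h.trans h'.symm)
      simp [this]
    exact_mod_cast this
  refine (Finset.sum_le_sum fun z _ => h1 z).trans ?_
  rw [← Finset.mul_sum, Finset.sum_comm]
  simp

abbrev RR : Type := Bool × Bool × Fin 3

section psi
variable {L : ℕ} [NeZero L]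

def gI (i : Tor L × RR) : Tor L := if i.2.2.2 = 2 then i.1 - ed true else i.1
def ch (i : Tor L × RR) : ℝ := if i.2.2.2 = 0 then 0 else 1
def Yf (ζ : Tor L → ℝ) (i : Tor L × RR) : ℝ := ζ i.1 + ch i * Lap ζ (gI i)
def eI (i : Tor L × RR) : Tor L × Bool := (if i.2.2.1 then i.1 else i.1 - ed i.2.1, i.2.1)

def Psi (L m : ℕ) [NeZero L] : ℝ :=
  ∫ ω, mx (fun i => Yf ω.1 i + 9 * Bx m (ω.2 (eI i)))
    ∂((muT L).prod (Measure.pi fun _ : Tor L × Bool => stdP (Fin m)))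

theorem sum_Yf (c : Tor L × RR → ℝ) (ζ : Tor L → ℝ) : ∑ i, c i * Yf ζ i =
    ∑ x, (psh Prod.fst c x + Lap (psh gI fun i => c i * ch i) x) * ζ x := by
  have h1 := psh_sum Prod.fst c ζ
  have h2 := psh_sum gI (fun i => c i * ch i) (Lap ζ)
  rw [green_id, Eb_comm, ← green_id] at h2
  simp_rw [add_mul, Finset.sum_add_distrib]
  rw [h1]
  simp_rw [mul_comm (Lap _ _), h2, Yf, mul_add, Finset.sum_add_distrib, mul_assoc]

theorem Yf_int (i : Tor L × RR) : Integrable (fun ζ => Yf ζ i) (muT L) := by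
  have h := fun x => (isG_muT (L := L)).int x
  unfold Yf
  apply (h _).add
  apply Integrable.const_mul
  simp only [Lap]
  apply integrable_finsetSum
  intro d _
  exact (((h _).const_mul 2).sub (h _)).sub (h _)

theorem eI_inj (r : RR) : Function.Injective fun x : Tor L => eI (x, r) := by
  intro x y h
  simp only [eI, Prod.mk.injEq, and_true] at h
  split_ifs at h <;> simpa using h

theorem gI_inj (r : RR) : Function.Injective fun x : Tor L => gI (x, r) := by
  intro x y h
  simp only [gI] at h
  split_ifs at h <;> simpa using h

theorem psi_step2 (s : ℝ) (C' : ℝ) (hC : 120 + 12 * s ^ 2 ≤ C') :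
    ∫ ω, mx (fun i : Tor L × RR => Yf ω.1 i + s * ω.2 (eI i)) ∂((muT L).prod (stdP (Tor L × Bool))) ≤
    ∫ ω, mx (fun i : Tor L × RR => ω.1 i.1 + √C' * ω.2 i.1 i.2)
      ∂((muT L).prod (Measure.pi fun _ : Tor L => stdP RR)) := by
  have hC0 : 0 ≤ C' := by nlinarith [sq_nonneg s]
  have hsum : ∀ c : Tor L × RR → ℝ, 0 ≤ ∑ i, c i ^ 2 := fun c => Finset.sum_nonneg fun i _ => sq_nonneg _
  have hsum' : ∀ (c : Tor L × Bool → ℝ), 0 ≤ ∑ i, c i ^ 2 := fun c => Finset.sum_nonneg fun i _ => sq_nonneg _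
  have mY : ∀ i, Measurable (fun ζ : Tor L → ℝ => Yf ζ i) := by
    intro i; unfold Yf Lap; fun_prop
  refine gauss_max (q := fun c => qK (fun x => psh Prod.fst c x + Lap (psh gI fun i => c i * ch i) x) +
      ∑ e, (s * psh eI c e) ^ 2) (q' := fun c => qK (psh Prod.fst c) + C' * ∑ i, c i ^ 2)
      ?_ ?_ ?_ ?_ ?_ ?_
  · intro i
    exact ((mY i).comp measurable_fst).add (by fun_prop)
  · intro i; fun_prop
  · intro c
    rw [← mixG isG_muT isG_std qK_nonneg hsum']
    congr 1; ext ω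
    simp_rw [mul_add, Finset.sum_add_distrib, ← sum_Yf, mul_assoc, ← Finset.mul_sum, psh_sum]
    rw [Finset.mul_sum]
    congr 1
    exact Finset.sum_congr rfl fun i _ => by ring
  · intro c
    rw [Real.toNNReal_add (qK_nonneg _) (mul_nonneg hC0 (hsum c))]
    have h2 := gauss_sum_pi' (fun _ : Tor L => stdP RR)
      (fun x w => ∑ r, (√C' * c (x, r)) * w r) (by fun_prop) _ (fun x => isG_std _)
    have e : ∑ x : Tor L, (∑ r, (√C' * c (x, r)) ^ 2).toNNReal = (C' * ∑ i, c i ^ 2).toNNReal := by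
      rw [← Real.toNNReal_sum_of_nonneg (fun x _ => Finset.sum_nonneg fun i _ => sq_nonneg _)]
      congr 1
      simp_rw [mul_pow, Real.sq_sqrt hC0, Fintype.sum_prod_type, Finset.mul_sum]
    rw [e] at h2
    rw [← gauss_sum_prod _ _ _ (by fun_prop) _ (by fun_prop) _ _ (isG_muT (psh Prod.fst c)) h2]
    congr 1; ext ω
    simp_rw [psh_sum, mul_add, Finset.sum_add_distrib]
    congr 1
    rw [Fintype.sum_prod_type]
    exact Finset.sum_congr rfl fun x _ => Finset.sum_congr rfl fun r _ => by ring
  · intro c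
    exact add_nonneg (qK_nonneg _) (hsum' _)
  · intro c
    have h1 := qK_lap (psh Prod.fst c) (psh gI fun i => c i * ch i)
    have h2 := psh_sq (T := Tor L) (R := RR) Prod.fst (fun r x y h => h) c
    have h3 := psh_sq (T := Tor L) (R := RR) gI gI_inj (fun i => c i * ch i)
    have h4 := psh_sq (T := Tor L) (R := RR) eI eI_inj c
    have hcard : (Fintype.card RR : ℝ) = 12 := by norm_num [Fintype.card_prod, RR]
    rw [hcard] at h2 h3 h4
    have h5 : ∑ i, (c i * ch i) ^ 2 ≤ ∑ i, c i ^ 2 := by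
      refine Finset.sum_le_sum fun i _ => ?_
      unfold ch; split_ifs
      · simpa using sq_nonneg _
      · simp
    simp_rw [mul_pow, ← Finset.mul_sum]
    have h6 := mul_le_mul_of_nonneg_left h4 (sq_nonneg s)
    have h7 := mul_le_mul_of_nonneg_right hC (hsum c)
    nlinarith

theorem mgf_step3 (C' : ℝ) (hC : 0 ≤ C') (θ : ℝ) (hθ : 0 ≤ θ) :
    Integrable (fun x : RR → ℝ => Real.exp (θ * (√C' * mx x))) (stdP RR) ∧
    ∫ x : RR → ℝ, Real.exp (θ * (√C' * mx x)) ∂stdP RR ≤ 12 * Real.exp (θ ^ 2 * C' / 2) := by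
  have he : ∀ i : RR, Integrable (fun x : RR → ℝ => Real.exp (θ * √C' * x i)) (stdP RR) ∧
      ∫ x, Real.exp (θ * √C' * x i) ∂stdP RR = Real.exp (θ ^ 2 * C' / 2) := by
    intro i
    have hc : (stdP RR).map (fun x => x i) = gaussianReal 0 1 :=
      (measurePreserving_eval (fun _ : RR => gaussianReal 0 1) i).map_eq
    have h1 : Integrable (fun x : ℝ => Real.exp (θ * √C' * x)) ((stdP RR).map (fun x => x i)) := by
      rw [hc]; exact integrable_exp_mul_gaussianReal (μ := 0) (v := 1) _
    refine ⟨h1.comp_measurable (by fun_prop), ?_⟩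
    rw [← integral_map (f := fun x : ℝ => Real.exp (θ * √C' * x)) (φ := fun x : RR → ℝ => x i)
      (measurable_pi_apply i).aemeasurable (by fun_prop), hc]
    have h2 := mgf_gaussianReal (p := gaussianReal 0 1) (X := id) (μ := 0)
      (v := 1) (by simp) (θ * √C')
    simp only [mgf, id] at h2
    rw [h2]; simp [mul_pow, Real.sq_sqrt hC]
  have hp : ∀ x : RR → ℝ, Real.exp (θ * (√C' * mx x)) ≤ ∑ i, Real.exp (θ * √C' * x i) := by
    intro x
    obtain ⟨i, hi⟩ := exists_mx x
    rw [hi, ← mul_assoc]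
    exact Finset.single_le_sum (f := fun i => Real.exp (θ * √C' * x i))
      (fun i _ => (Real.exp_pos _).le) (Finset.mem_univ i)
  have hS : Integrable (fun x : RR → ℝ => ∑ i, Real.exp (θ * √C' * x i)) (stdP RR) :=
    integrable_finsetSum _ fun i _ => (he i).1
  have mm : Measurable (mx : (RR → ℝ) → ℝ) := measurable_mx (F := fun i (x : RR → ℝ) => x i) (by fun_prop)
  have hI : Integrable (fun x : RR → ℝ => Real.exp (θ * (√C' * mx x))) (stdP RR) := by
    refine hS.mono' (by fun_prop) (ae_of_all _ fun x => ?_)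
    rw [Real.norm_of_nonneg (Real.exp_pos _).le]; exact hp x
  refine ⟨hI, (integral_mono hI hS hp).trans ?_⟩
  rw [integral_finsetSum _ fun i _ => (he i).1]
  simp_rw [fun i => (he i).2]
  apply le_of_eq
  rw [Finset.sum_const, nsmul_eq_mul]; norm_num [Fintype.card_prod, RR]

end psi

theorem Psi_bound : ∃ C : ℝ, ∃ k : ℕ, ∀ (L m M : ℕ) [NeZero L] [NeZero M], 1 ≤ m → M = 2 ^ k * L →
    Psi L m ≤ cT M + C := by
  obtain ⟨C1, hC1, h1⟩ := noise_cmp 4 10368 (by norm_num) (by norm_num)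
  set s : ℝ := √(8 * 10368) with hs
  set C' : ℝ := 120 + 12 * s ^ 2 with hC'
  have hC'0 : 0 < C' := by positivity
  obtain ⟨C3, hC3, h3⟩ := noise_cmp 12 C' hC'0 (by norm_num)
  obtain ⟨k, hk⟩ := exists_nat_ge (16 * (8 * C'))
  refine ⟨C1 + C3, k, ?_⟩
  intro L m M _ _ hm hM
  have s1 : Psi L m ≤ C1 + ∫ ω, mx (fun i : Tor L × RR => Yf ω.1 i + s * ω.2 (eI i))
      ∂((muT L).prod (stdP (Tor L × Bool))) :=
    noise_int (f := fun g => 9 * Bx m g) ((Bx_int m).const_mul 9) eI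
      (fun a => h1 _ (stdP (Fin m)) _ ((Bx_meas m).const_mul 9) ((Bx_int m).const_mul 9)
        (fun θ hθ => bridge_mgf m hm θ hθ) _ _ a eI) Yf_int
  have s2 := psi_step2 (L := L) s C' le_rfl
  have e3 : ∀ ω : (Tor L → ℝ) × (Tor L → RR → ℝ),
      mx (fun i : Tor L × RR => ω.1 i.1 + √C' * ω.2 i.1 i.2) =
      mx (fun x => ω.1 x + √C' * mx (ω.2 x)) := by
    intro ω
    apply le_antisymm
    · apply mx_le; intro i
      refine le_trans ?_ (le_mx _ i.1)
      have := mul_le_mul_of_nonneg_left (le_mx (ω.2 i.1) i.2) (Real.sqrt_nonneg C')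
      linarith
    · apply mx_le; intro x
      obtain ⟨r, hr⟩ := exists_mx (ω.2 x)
      rw [hr]
      exact le_mx (fun i : Tor L × RR => ω.1 i.1 + √C' * ω.2 i.1 i.2) (x, r)
  simp_rw [e3] at s2
  have mm : Measurable (mx : (RR → ℝ) → ℝ) := measurable_mx (F := fun i (x : RR → ℝ) => x i) (by fun_prop)
  have imx : Integrable (fun x : RR → ℝ => √C' * mx x) (stdP RR) :=
    (integrable_mx fun i => isG_std.int i).const_mul _
  have s3 : ∫ ω, mx (fun x : Tor L => ω.1 x + √C' * mx (ω.2 x))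
      ∂((muT L).prod (Measure.pi fun _ : Tor L => stdP RR)) ≤
      C3 + ∫ ω, mx (fun x : Tor L => ω.1 x + √(8 * C') * ω.2 x) ∂((muT L).prod (stdP (Tor L))) :=
    noise_int (a := fun x (ζ : Tor L → ℝ) => ζ x) (f := fun x : RR → ℝ => √C' * mx x) imx id
      (fun a => h3 _ (stdP RR) _ (mm.const_mul _) imx (fun θ hθ => mgf_step3 C' hC'0.le θ hθ) _ _ a id)
      (fun x => isG_muT.int x)
  obtain ⟨e, he, hq⟩ := emb_ex k M hM
  have s4 : ∫ ω, mx (fun x : Tor L => ω.1 x + √(8 * C') * ω.2 x) ∂((muT L).prod (stdP (Tor L))) ≤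
      ∫ ζ, mx (fun x => ζ (e x)) ∂(muT M) := by
    refine gauss_max (q := fun c => qK c + ∑ x, (√(8 * C') * c x) ^ 2) (q' := fun c => qK (psh e c))
      ?_ ?_ ?_ ?_ ?_ ?_
    · intro i; fun_prop
    · intro i; fun_prop
    · intro c
      rw [← mixG isG_muT isG_std qK_nonneg (fun c => Finset.sum_nonneg fun i _ => sq_nonneg _)]
      congr 1; ext ω
      rw [← Finset.sum_add_distrib]
      exact Finset.sum_congr rfl fun x _ => by ring
    · intro c
      rw [← isG_muT]
      simp_rw [psh_sum]
    · intro c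
      exact add_nonneg (qK_nonneg _) (Finset.sum_nonneg fun i _ => sq_nonneg _)
    · intro c
      have := hq c
      simp_rw [mul_pow, ← Finset.mul_sum]
      rw [Real.sq_sqrt (by positivity)]
      have h0 : 0 ≤ ∑ x, c x ^ 2 := Finset.sum_nonneg fun i _ => sq_nonneg _
      nlinarith
  have s5 : ∫ ζ, mx (fun x => ζ (e x)) ∂(muT M) ≤ cT M :=
    integral_mono (integrable_mx fun i => isG_muT.int _) (integrable_mx fun i => isG_muT.int i)
      fun ζ => mx_le fun x => le_mx ζ (e x)
  linarith

section tor
variable {L : ℕ} [NeZero L] {m : ℕ}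

abbrev XX (L m : ℕ) : Type := Tor L ⊕ (Tor L × Bool × Fin (m - 1))
abbrev OT (L m : ℕ) : Type := (Tor L → ℝ) × (Tor L × Bool → Fin m → ℝ)

def PT (L m : ℕ) [NeZero L] : Measure (OT L m) :=
  (muT L).prod (Measure.pi fun _ : Tor L × Bool => stdP (Fin m))

instance : IsProbabilityMeasure (PT L m) := by unfold PT; infer_instance

def pt (m : ℕ) (e : Tor L × Bool) (j : ℕ) : XX L m :=
  if h : 0 < j ∧ j < m then .inr (e.1, e.2, ⟨j - 1, by omega⟩)
  else if j = 0 then .inl e.1 else .inl (e.1 + ed e.2)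

def lin (m : ℕ) (ζ : Tor L → ℝ) (e : Tor L × Bool) (j : ℕ) : ℝ :=
  (1 - (j : ℝ) / m) * ζ e.1 + (j : ℝ) / m * ζ (e.1 + ed e.2)

def fld (m : ℕ) (ω : OT L m) : XX L m → ℝ
  | .inl x => ω.1 x
  | .inr (x, d, k) => lin m ω.1 (x, d) (k + 1) + br m (ω.2 (x, d)) (k + 1)

theorem br_zero (g : Fin m → ℝ) : br m g 0 = 0 := by simp [br, wk]

theorem br_end (hm : 1 ≤ m) (g : Fin m → ℝ) : br m g m = 0 := by
  have : (m : ℝ) ≠ 0 := by positivity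
  simp [br, div_self this]

theorem fld_pt (hm : 1 ≤ m) (ω : OT L m) (e : Tor L × Bool) (j : ℕ) (hj : j ≤ m) :
    fld m ω (pt m e j) = lin m ω.1 e j + br m (ω.2 e) j := by
  have hm0 : (m : ℝ) ≠ 0 := by positivity
  unfold pt
  split_ifs with h h'
  · have : j - 1 + 1 = j := by omega
    simp [fld, this]
  · subst h'; simp [fld, lin, br_zero]
  · obtain rfl : j = m := by omega
    simp [fld, lin, br_end hm, div_self hm0]

theorem fld_meas (p : XX L m) : Measurable (fun ω : OT L m => fld m ω p) := by
  rcases p with x | ⟨x, d, k⟩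
  · simp only [fld]; fun_prop
  · simp only [fld, lin]
    have h : Measurable (fun ω : OT L m => ω.2 (x, d)) := by fun_prop
    exact Measurable.add (by fun_prop) ((br_meas m (k + 1)).comp h)

def Mx (m : ℕ) (ω : OT L m) : ℝ := mx (fun i => Yf ω.1 i + 9 * Bx m (ω.2 (eI i)))

theorem lin_le (hm : 1 ≤ m) (ζ : Tor L → ℝ) (e : Tor L × Bool) {j : ℕ} (hj : j ≤ m) {c : ℝ}
    (h1 : ζ e.1 ≤ c) (h2 : ζ (e.1 + ed e.2) ≤ c) : lin m ζ e j ≤ c := by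
  have hm0 : (0 : ℝ) < m := by positivity
  have a : (0:ℝ) ≤ (j : ℝ) / m := by positivity
  have b : (j : ℝ) / m ≤ 1 := by rw [div_le_one hm0]; exact_mod_cast hj
  unfold lin; nlinarith

theorem Mx1 (ω : OT L m) (e : Tor L × Bool) : ω.1 e.1 + 9 * Bx m (ω.2 e) ≤ Mx m ω := by
  have := le_mx (fun i => Yf ω.1 i + 9 * Bx m (ω.2 (eI i))) (e.1, (e.2, true, 0))
  change _ ≤ Mx m ω at this
  simpa [Yf, ch, eI] using this

theorem Mx2 (ω : OT L m) (e : Tor L × Bool) : ω.1 (e.1 + ed e.2) + 9 * Bx m (ω.2 e) ≤ Mx m ω := by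
  have := le_mx (fun i => Yf ω.1 i + 9 * Bx m (ω.2 (eI i))) (e.1 + ed e.2, (e.2, false, 0))
  change _ ≤ Mx m ω at this
  simpa [Yf, ch, eI] using this

theorem Mx3 (ω : OT L m) (y : Tor L) :
    ω.1 y + Lap ω.1 y + 9 * Bx m (ω.2 (y, true)) ≤ Mx m ω := by
  have := le_mx (fun i => Yf ω.1 i + 9 * Bx m (ω.2 (eI i))) (y, (true, true, 1))
  change _ ≤ Mx m ω at this
  simpa [Yf, ch, eI, gI] using this

theorem Mx4 (ω : OT L m) (y : Tor L) :
    ω.1 (y + ed true) + Lap ω.1 y + 9 * Bx m (ω.2 (y, true)) ≤ Mx m ω := by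
  have := le_mx (fun i => Yf ω.1 i + 9 * Bx m (ω.2 (eI i))) (y + ed true, (true, false, 2))
  change _ ≤ Mx m ω at this
  simpa [Yf, ch, eI, gI] using this

theorem fld_le (hm : 1 ≤ m) (ω : OT L m) (p : XX L m) : fld m ω p ≤ Mx m ω := by
  rcases p with x | ⟨x, d, k⟩
  · have := Mx1 ω (x, true)
    have := Bx_nonneg m (ω.2 (x, true))
    simp only [fld]; simp only at *; linarith
  · have h1 := Mx1 ω (x, d)
    have h2 := Mx2 ω (x, d)
    have hk : (k : ℕ) + 1 ≤ m := by omega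
    have h3 := (le_abs_self _).trans (le_Bx hk (ω.2 (x, d)))
    have h4 := Bx_nonneg m (ω.2 (x, d))
    have := lin_le hm ω.1 (x, d) hk (c := Mx m ω - Bx m (ω.2 (x, d))) (by linarith) (by linarith)
    simp only [fld]; linarith

def De (m j : ℕ) (ω : OT L m) (y : Tor L) : ℝ :=
  max (Lap ω.1 y) 0 + 8 * |br m (ω.2 (y, true)) j|

theorem De_nonneg (j : ℕ) (ω : OT L m) (y : Tor L) : 0 ≤ De m j ω y := by
  unfold De; positivity

theorem fldDe_le (hm : 1 ≤ m) {j : ℕ} (hj : j ≤ m) (ω : OT L m) (y : Tor L) :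
    fld m ω (pt m (y, true) j) + De m j ω y ≤ Mx m ω := by
  rw [fld_pt hm _ _ _ hj]
  have h1 := Mx1 ω (y, true)
  have h2 := Mx2 ω (y, true)
  have h3 := Mx3 ω y
  have h4 := Mx4 ω y
  have h5 := le_Bx hj (ω.2 (y, true))
  have h6 := le_abs_self (br m (ω.2 (y, true)) j)
  have := lin_le hm ω.1 (y, true) hj (c := Mx m ω - max (Lap ω.1 y) 0 - 9 * Bx m (ω.2 (y, true)))
    (by rcases max_cases (Lap ω.1 y) 0 with h | h <;> simp only at * <;> linarith)
    (by rcases max_cases (Lap ω.1 y) 0 with h | h <;> simp only at * <;> linarith)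
  unfold De; linarith

def rk (y : Tor L) : ℕ := (Fintype.equivFin (Tor L) y : ℕ)

theorem rk_inj {y z : Tor L} (h : rk y = rk z) : y = z :=
  (Fintype.equivFin (Tor L)).injective (Fin.ext h)

def Ev (m j : ℕ) (h : ℝ) (y : Tor L) : Set (XX L m → ℝ) :=
  {φ | (∀ p, φ p < φ (pt m (y, true) j) + h) ∧ ∀ y', φ (pt m (y', true) j) ≤ φ (pt m (y, true) j) ∧
    (φ (pt m (y', true) j) = φ (pt m (y, true) j) → rk y ≤ rk y')}

theorem Ev_meas (j : ℕ) (h : ℝ) (y : Tor L) : MeasurableSet (Ev m j h y) := by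
  unfold Ev
  simp only [setOf_and, setOf_forall]
  refine MeasurableSet.inter (MeasurableSet.iInter fun p => measurableSet_lt (by fun_prop) (by fun_prop))
    (MeasurableSet.iInter fun y' => (measurableSet_le (by fun_prop) (by fun_prop)).inter ?_)
  by_cases hr : rk y ≤ rk y'
  · simp [hr]
  · simp only [hr, imp_false]
    exact (measurableSet_eq_fun (by fun_prop) (by fun_prop)).compl

theorem pointwise (hm : 1 ≤ m) {j : ℕ} (hj : 2 * j ≤ m) {h : ℝ} (hh : 0 ≤ h) (ω : OT L m) (y : Tor L)
    (hE : fld m ω ∈ Ev m j h y) :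
    fld m ω (pt m (y, true) j) - ω.1 y + h ≤ 12 * h + De m j ω y ∧
    fld m ω (pt m (y, true) j) - ω.1 (y + ed true) + h ≤ 12 * h + De m j ω y := by
  have hp : ∀ x, ω.1 x < fld m ω (pt m (y, true) j) + h := fun x => hE.1 (.inl x)
  have hj' : j ≤ m := by omega
  have hf := fld_pt hm ω (y, true) j hj'
  set w := fld m ω (pt m (y, true) j)
  set b := br m (ω.2 (y, true)) j with hb
  have hm0 : (0 : ℝ) < m := by positivity
  have s0 : (0:ℝ) ≤ (j : ℝ) / m := by positivity
  have s1 : (j : ℝ) / m ≤ 1 / 2 := by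
    rw [div_le_iff₀ hm0]
    have : (2 * j : ℝ) ≤ m := by exact_mod_cast hj
    linarith
  have b1 := le_abs_self b
  have b0 := abs_nonneg b
  have l0 := le_max_left (Lap ω.1 y) 0
  have l1 := le_max_right (Lap ω.1 y) 0
  have near : w - ω.1 y ≤ h + 2 * |b| := by
    have := hp (y + ed true)
    simp only [lin] at hf
    by_contra! hc
    set s := (j : ℝ) / m
    nlinarith [mul_nonneg s0 (sub_nonneg.2 this.le), mul_nonneg (sub_nonneg.2 s1) (sub_nonneg.2 hc.le)]
  have e : De m j ω y = max (Lap ω.1 y) 0 + 8 * |b| := rfl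
  refine ⟨by rw [e]; linarith, ?_⟩
  have h1 := hp (y - ed true)
  have h2 := hp (y + ed false)
  have h3 := hp (y - ed false)
  have hL : Lap ω.1 y = 2 * ω.1 y - ω.1 (y + ed true) - ω.1 (y - ed true) +
    (2 * ω.1 y - ω.1 (y + ed false) - ω.1 (y - ed false)) := by simp [Lap]; ring
  rw [e]; linarith

def Aw (m j : ℕ) (ω : OT L m) : ℝ := mx (fun y => fld m ω (pt m (y, true) j))

theorem br_mean (m j : ℕ) : Integrable (fun g => br m g j) (stdP (Fin m)) ∧
    ∫ g, br m g j ∂stdP (Fin m) = 0 := by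
  have hw : ∀ k, Integrable (fun g => wk m g k) (stdP (Fin m)) ∧ ∫ g, wk m g k ∂stdP (Fin m) = 0 := by
    intro k
    have e : (fun g => wk m g k) = fun g => ∑ i : Fin m, (√(8 / m) * if (i : ℕ) < k then 1 else 0) * g i := by
      ext g; rw [wk, Finset.mul_sum]; refine Finset.sum_congr rfl fun i _ => ?_
      split_ifs <;> simp
    rw [e]
    exact ⟨integrable_of_gauss (by fun_prop) (isG_std _), integral_of_gauss (by fun_prop) (isG_std _)⟩
  refine ⟨(hw j).1.sub ((hw m).1.const_mul _), ?_⟩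
  unfold br
  rw [integral_sub (hw j).1 ((hw m).1.const_mul _), integral_const_mul, (hw j).2, (hw m).2]; simp

theorem zint (x : Tor L) : Integrable (fun ω : OT L m => ω.1 x) (PT L m) :=
  Integrable.comp_fst (f := fun ζ : Tor L → ℝ => ζ x) (isG_muT.int x) _

theorem fint {f : (Fin m → ℝ) → ℝ} (hf : Integrable f (stdP (Fin m))) (e : Tor L × Bool) :
    Integrable (fun ω : OT L m => f (ω.2 e)) (PT L m) :=
  Integrable.comp_snd (f := fun g : Tor L × Bool → Fin m → ℝ => f (g e))
    ((measurePreserving_eval (fun _ : Tor L × Bool => stdP (Fin m)) e).integrable_comp_of_integrable hf) _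

theorem Mx_int : Integrable (Mx m) (PT L m) :=
  integrable_mx fun i => (Integrable.comp_fst (f := fun ζ : Tor L → ℝ => Yf ζ i) (Yf_int i) _).add
    ((fint (Bx_int m) (eI i)).const_mul 9)

theorem Wint (hm : 1 ≤ m) {j : ℕ} (hj : j ≤ m) (y : Tor L) :
    Integrable (fun ω : OT L m => fld m ω (pt m (y, true) j)) (PT L m) := by
  simp_rw [fun ω => fld_pt (L := L) hm ω (y, true) j hj]
  apply Integrable.add _ (fint (br_mean m j).1 _)
  unfold lin
  exact ((zint _).const_mul _).add ((zint _).const_mul _)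

theorem Aw_int (hm : 1 ≤ m) {j : ℕ} (hj : j ≤ m) : Integrable (Aw m j) (PT L m) :=
  integrable_mx fun y => Wint hm hj y

theorem De_int (j : ℕ) (y : Tor L) : Integrable (fun ω : OT L m => De m j ω y) (PT L m) := by
  unfold De
  apply Integrable.add _ ((fint (br_mean m j).1.abs _).const_mul 8)
  apply Integrable.sup _ (integrable_const _)
  unfold Lap
  exact integrable_finsetSum _ fun d _ => (((zint _).const_mul _).sub (zint _)).sub (zint _)

theorem EA (hm : 1 ≤ m) {j : ℕ} (hj : j ≤ m) :
    2 * cT L - Psi L m ≤ ∫ ω, Aw m j ω ∂PT L m := by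
  have hm0 : (0 : ℝ) < m := by positivity
  have s0 : (0:ℝ) ≤ (j : ℝ) / m := by positivity
  have s1 : (j : ℝ) / m ≤ 1 := by rw [div_le_one hm0]; exact_mod_cast hj
  have hI := Aw_int (L := L) hm hj
  unfold PT at hI
  have iY : Integrable (fun ζ : Tor L → ℝ => mx (Yf ζ)) (muT L) := integrable_mx fun i => Yf_int i
  have iM : Integrable (fun ζ : Tor L → ℝ => mx ζ) (muT L) := integrable_mx fun i => isG_muT.int i
  have h1 : ∫ ζ, mx (Yf ζ) ∂muT L ≤ Psi L m := by
    have : ∫ ζ, mx (Yf ζ) ∂muT L = ∫ ω, mx (Yf ω.1) ∂PT L m := by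
      unfold PT; rw [integral_fun_fst (f := fun ζ : Tor L → ℝ => mx (Yf ζ))]; simp
    rw [this]
    refine integral_mono (Integrable.comp_fst iY _) Mx_int fun ω => ?_
    apply mx_le; intro i
    have h' : _ ≤ Mx m ω := le_mx (fun i => Yf ω.1 i + 9 * Bx m (ω.2 (eI i))) i
    have := Bx_nonneg m (ω.2 (eI i))
    change _ ≤ Mx m ω
    linarith
  have h2 : 2 * cT L - ∫ ζ, mx (Yf ζ) ∂muT L = ∫ ζ, (2 * mx ζ - mx (Yf ζ)) ∂muT L := by
    rw [integral_sub (iM.const_mul 2) iY, integral_const_mul]; rfl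
  have h3 : ∫ ζ, (2 * mx ζ - mx (Yf ζ)) ∂muT L ≤ ∫ ω, Aw m j ω ∂PT L m := by
    unfold PT
    rw [integral_prod _ hI]
    refine integral_mono_ae ((iM.const_mul 2).sub iY) hI.integral_prod_left ?_
    filter_upwards [hI.prod_right_ae] with ζ hζ
    obtain ⟨y, hy⟩ := exists_mx ζ
    have k1 : lin m ζ (y, true) j ≤ ∫ g, Aw m j (ζ, g) ∂(Measure.pi fun _ : Tor L × Bool => stdP (Fin m)) := by
      have mp := measurePreserving_eval (fun _ : Tor L × Bool => stdP (Fin m)) (y, true)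
      have i1 : Integrable (fun g : Tor L × Bool → Fin m → ℝ => br m (g (y, true)) j)
          (Measure.pi fun _ => stdP (Fin m)) := mp.integrable_comp_of_integrable (br_mean m j).1
      have i2 : ∫ g : Tor L × Bool → Fin m → ℝ, br m (g (y, true)) j ∂(Measure.pi fun _ => stdP (Fin m)) = 0 := by
        have h' := integral_map (μ := Measure.pi fun _ : Tor L × Bool => stdP (Fin m)) mp.measurable.aemeasurable
          (br_meas m j).aestronglyMeasurable
        rw [mp.map_eq, (br_mean m j).2] at h'
        exact h'.symm
      have : lin m ζ (y, true) j = ∫ g : Tor L × Bool → Fin m → ℝ, (lin m ζ (y, true) j + br m (g (y, true)) j)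
          ∂(Measure.pi fun _ => stdP (Fin m)) := by
        rw [integral_add (integrable_const _) i1, i2]; simp
      rw [this]
      refine integral_mono ((integrable_const _).add i1) hζ fun g => ?_
      have := le_mx (fun y => fld m ((ζ, g) : OT L m) (pt m (y, true) j)) y
      rw [fld_pt hm _ _ _ hj] at this
      exact this
    refine le_trans ?_ k1
    have hz := fun x => hy ▸ le_mx ζ x
    have hq : ζ y + Lap ζ y ≤ mx (Yf ζ) := by
      have := le_mx (Yf ζ) (y, (true, true, 1))
      simpa [Yf, ch, gI] using this
    have hL : Lap ζ y = 2 * ζ y - ζ (y + ed true) - ζ (y - ed true) +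
      (2 * ζ y - ζ (y + ed false) - ζ (y - ed false)) := by simp [Lap]; ring
    have z1 := hz (y + ed true)
    have z2 := hz (y - ed true)
    have z3 := hz (y + ed false)
    have z4 := hz (y - ed false)
    rw [hy]
    simp only [lin]
    have : (j:ℝ) / m * (ζ y - ζ (y + ed true)) ≤ 1 * (ζ y - ζ (y + ed true)) :=
      mul_le_mul_of_nonneg_right s1 (by linarith)
    nlinarith
  linarith

theorem torus_est {C1 : ℝ} (hC : 0 < C1) (hm : 1 ≤ m) {j : ℕ} (hj : 2 * j ≤ m)
    (hΨ : Psi L m ≤ cT L + C1) : ∃ y : Tor L, PT L m (fld m ⁻¹' Ev m j (4 * C1) y) ≠ 0 ∧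
    ∀ v : Tor L, v = y ∨ v = y + ed true →
    ∫⁻ ω in fld m ⁻¹' Ev m j (4 * C1) y,
      ENNReal.ofReal (fld m ω (pt m (y, true) j) - ω.1 v + 4 * C1) ∂PT L m ≤
      ENNReal.ofReal (52 * C1) * PT L m (fld m ⁻¹' Ev m j (4 * C1) y) := by
  have hj' : j ≤ m := by omega
  set h := 4 * C1
  have hh : 0 < h := by positivity
  have mf : Measurable (fld m : OT L m → _) := measurable_pi_iff.2 fld_meas
  set S : Tor L → Set (OT L m) := fun y => fld m ⁻¹' Ev m j h y
  have mS : ∀ y, MeasurableSet (S y) := fun y => mf (Ev_meas j h y)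
  have uniq : ∀ (ω : OT L m) (y y' : Tor L), ω ∈ S y → ω ∈ S y' → y = y' := by
    intro ω y y' h1 h2
    have a := h1.2 y'
    have b := h2.2 y
    have e := le_antisymm a.1 b.1
    exact rk_inj (le_antisymm (a.2 e) (b.2 e.symm))
  have eA : ∀ (ω : OT L m) y, ω ∈ S y → Aw m j ω = fld m ω (pt m (y, true) j) := fun ω y hy =>
    le_antisymm (mx_le fun y' => (hy.2 y').1) (le_mx (fun y => fld m ω (pt m (y, true) j)) y)
  have AM : ∀ ω : OT L m, Aw m j ω ≤ Mx m ω := fun ω => mx_le fun y => fld_le hm ω _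
  set D : OT L m → ℝ := fun ω => Mx m ω - Aw m j ω
  have iD : Integrable D (PT L m) := Mx_int.sub (Aw_int hm hj')
  have ED : ∫ ω, D ω ∂PT L m ≤ 2 * C1 := by
    rw [integral_sub Mx_int (Aw_int hm hj')]
    have := EA (L := L) hm hj'
    have e : ∫ ω, Mx m ω ∂PT L m = Psi L m := rfl
    linarith
  have p1 : ∀ ω : OT L m, ∑ y, (S y).indicator (fun ω => De m j ω y) ω ≤ D ω := by
    intro ω
    by_cases hex : ∃ y, ω ∈ S y
    · obtain ⟨y, hy⟩ := hex
      rw [Finset.sum_eq_single y]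
      · rw [indicator_of_mem hy]
        have := fldDe_le hm hj' ω y
        simp only [D, eA ω y hy]; linarith
      · intro z _ hz
        exact indicator_of_notMem (fun h' => hz (uniq ω z y h' hy)) _
      · simp
    · push Not at hex
      rw [Finset.sum_eq_zero fun y _ => indicator_of_notMem (hex y) _]
      exact sub_nonneg.2 (AM ω)
  have p2 : ∀ ω : OT L m, 1 - ∑ y, (S y).indicator (fun _ => (1 : ℝ)) ω ≤ D ω / h := by
    intro ω
    by_cases hex : ∃ y, ω ∈ S y
    · obtain ⟨y, hy⟩ := hex
      have : (1 : ℝ) ≤ ∑ y, (S y).indicator (fun _ => (1 : ℝ)) ω := by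
        refine le_trans (by rw [indicator_of_mem hy])
          (Finset.single_le_sum (f := fun y => (S y).indicator (fun _ => (1 : ℝ)) ω)
            (fun z _ => indicator_nonneg (fun _ _ => zero_le_one) _) (Finset.mem_univ y))
      have : 0 ≤ D ω / h := div_nonneg (sub_nonneg.2 (AM ω)) hh.le
      linarith
    · rw [Finset.sum_eq_zero fun y _ => indicator_of_notMem (fun h' => hex ⟨y, h'⟩) _, sub_zero,
        le_div_iff₀ hh, one_mul]
      obtain ⟨y0, hy0⟩ := exists_mx (fun y => fld m ω (pt m (y, true) j))
      obtain ⟨y, hy, hmin⟩ := Finset.exists_min_image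
        (Finset.univ.filter fun y => fld m ω (pt m (y, true) j) = Aw m j ω) rk ⟨y0, by simp [Aw, hy0]⟩
      simp only [Finset.mem_filter, Finset.mem_univ, true_and] at hy hmin
      have hny : ω ∉ S y := fun h' => hex ⟨y, h'⟩
      have : ∃ p, fld m ω (pt m (y, true) j) + h ≤ fld m ω p := by
        by_contra! hc
        exact hny ⟨hc, fun y' => ⟨hy ▸ le_mx (fun y => fld m ω (pt m (y, true) j)) y',
          fun e => hmin y' (e.trans hy)⟩⟩
      obtain ⟨p, hp⟩ := this
      have := fld_le hm ω p
      simp only [D]; rw [hy] at hp; linarith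
  have q1 : ∑ y, ∫ ω in S y, De m j ω y ∂PT L m ≤ 2 * C1 := by
    refine le_trans ?_ ED
    simp_rw [fun y => (integral_indicator (μ := PT L m) (f := fun ω => De m j ω y) (mS y)).symm]
    rw [← integral_finsetSum _ fun y _ => (De_int j y).indicator (mS y)]
    exact integral_mono (integrable_finsetSum _ fun y _ => (De_int j y).indicator (mS y)) iD p1
  have q2 : 1 / 2 ≤ ∑ y, (PT L m).real (S y) := by
    have i1 : Integrable (fun ω => ∑ y, (S y).indicator (fun _ => (1 : ℝ)) ω) (PT L m) :=
      integrable_finsetSum _ fun y _ => (integrable_const _).indicator (mS y)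
    have h1 := integral_mono ((integrable_const (1:ℝ)).sub i1) (iD.div_const h) p2
    change ∫ ω, (1 - ∑ y, (S y).indicator (fun _ => (1 : ℝ)) ω) ∂PT L m ≤ _ at h1
    rw [integral_sub (integrable_const _) i1, integral_div, integral_finsetSum _ fun y _ =>
      (integrable_const (1:ℝ)).indicator (mS y)] at h1
    simp_rw [integral_indicator_const (1:ℝ) (mS _)] at h1
    simp only [smul_eq_mul, mul_one, integral_const, probReal_univ] at h1
    have : (∫ ω, D ω ∂PT L m) / h ≤ 1 / 2 := by
      rw [div_le_iff₀ hh]; simp only [h]; linarith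
    linarith
  have ex : ∃ y, 0 < (PT L m).real (S y) ∧ ∫ ω in S y, De m j ω y ∂PT L m ≤ 4 * C1 * (PT L m).real (S y) := by
    by_contra! hc
    have le : ∀ y, 4 * C1 * (PT L m).real (S y) ≤ ∫ ω in S y, De m j ω y ∂PT L m := by
      intro y
      rcases (measureReal_nonneg (μ := PT L m) (s := S y)).lt_or_eq with h' | h'
      · exact (hc y h').le
      · rw [← h', mul_zero]; exact setIntegral_nonneg (mS y) fun ω _ => De_nonneg j ω y
    obtain ⟨y, hy⟩ : ∃ y, 0 < (PT L m).real (S y) := by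
      by_contra! hc'
      have := Finset.sum_nonpos fun y (_ : y ∈ Finset.univ) => hc' y
      linarith
    have := Finset.sum_lt_sum (s := Finset.univ) (fun y _ => le y) ⟨y, Finset.mem_univ y, hc y hy⟩
    rw [← Finset.mul_sum] at this
    nlinarith
  obtain ⟨y, hy, hy2⟩ := ex
  refine ⟨y, fun h0 => by simp [S, measureReal_def, h0] at hy, ?_⟩
  intro v hv
  have b1 : ∫⁻ ω in S y, ENNReal.ofReal (fld m ω (pt m (y, true) j) - ω.1 v + h) ∂PT L m ≤
      ∫⁻ ω in S y, ENNReal.ofReal (12 * h + De m j ω y) ∂PT L m := by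
    refine setLIntegral_mono' (mS y) fun ω hω => ENNReal.ofReal_le_ofReal ?_
    have := pointwise hm hj hh.le ω y hω
    rcases hv with rfl | rfl
    exacts [this.1, this.2]
  refine b1.trans ?_
  have i2 : Integrable (fun ω => 12 * h + De m j ω y) ((PT L m).restrict (S y)) :=
    ((integrable_const _).add (De_int j y)).restrict
  rw [← ofReal_integral_eq_lintegral_ofReal i2 (ae_of_all _ fun ω => by
    have := De_nonneg j ω y; positivity),
    ← ofReal_measureReal (μ := PT L m) (s := S y), ← ENNReal.ofReal_mul (by positivity)]
  apply ENNReal.ofReal_le_ofReal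
  rw [integral_add (integrable_const _) (De_int j y).restrict]
  simp only [integral_const, smul_eq_mul, measureReal_restrict_apply_univ]
  simp only [h]; linarith

end tor

theorem prod_lint {X : Type} [Fintype X] [DecidableEq X] (f : X → ℝ → ENNReal) (hf : ∀ i, Measurable (f i)) :
    ∫⁻ x : X → ℝ, ∏ i, f i (x i) = ∏ i, ∫⁻ t, f i t := by
  have hm : Measurable (fun x : X → ℝ => ∏ i, f i (x i)) :=
    Finset.measurable_prod _ fun i _ => (hf i).comp (measurable_pi_apply i)
  have : ∀ s : Finset X, ∀ x, (∫⋯∫⁻_s, (fun x : X → ℝ => ∏ i, f i (x i)) ∂(fun _ => volume)) x =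
      (∏ i ∈ s, ∫⁻ t, f i t) * ∏ i ∈ sᶜ, f i (x i) := by
    intro s
    induction s using Finset.induction with
    | empty => intro x; simp
    | insert i s hi ih =>
      intro x
      rw [lmarginal_insert _ hm hi, Finset.prod_insert hi]
      have h1 : sᶜ = insert i (insert i s)ᶜ := by ext j; by_cases h : j = i <;> simp [h, hi]
      have h2 : ∀ t, (∏ j ∈ sᶜ, f j (Function.update x i t j)) = f i t * ∏ j ∈ (insert i s)ᶜ, f j (x j) := by
        intro t
        rw [h1, Finset.prod_insert (by simp)]
        congr 1
        · simp
        · refine Finset.prod_congr rfl fun j hj => ?_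
          rw [Function.update_of_ne]; rintro rfl; simp at hj
      simp_rw [ih, h2, ← mul_assoc, mul_comm (∏ j ∈ s, _) (f i _), mul_assoc]
      rw [lintegral_mul_const _ (hf i)]
  have := this Finset.univ 0
  rw [lmarginal_univ] at this
  simp only [Finset.compl_univ, Finset.prod_empty, mul_one] at this
  exact this

theorem std_dens {ι : Type} [Fintype ι] : ∃ κ : ENNReal, κ ≠ 0 ∧ κ ≠ ⊤ ∧ ∀ F : (ι → ℝ) → ENNReal, Measurable F →
    ∫⁻ z, F z ∂stdP ι = κ * ∫⁻ z, F z * ENNReal.ofReal (Real.exp (-(∑ i, z i ^ 2) / 2)) := by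
  set κ := ENNReal.ofReal ((√(2 * Real.pi))⁻¹ ^ Fintype.card ι)
  have hp : ∀ z : ι → ℝ, ∏ i, gaussianPDF 0 1 (z i) = κ * ENNReal.ofReal (Real.exp (-(∑ i, z i ^ 2) / 2)) := by
    intro z
    simp only [gaussianPDF, gaussianPDFReal]
    rw [← ENNReal.ofReal_prod_of_nonneg (fun i _ => by positivity), Finset.prod_mul_distrib,
      ← Real.exp_sum, ENNReal.ofReal_mul (by positivity)]
    simp only [κ, Finset.prod_const, Finset.card_univ, NNReal.coe_one, mul_one, sub_zero, Finset.sum_div,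
      neg_div, Finset.sum_neg_distrib]
  have hm : Measurable (fun z : ι → ℝ => ∏ i, gaussianPDF 0 1 (z i)) :=
    Finset.measurable_prod _ fun i _ => (measurable_gaussianPDF 0 1).comp (measurable_pi_apply i)
  have e : stdP ι = volume.withDensity (fun z : ι → ℝ => ∏ i, gaussianPDF 0 1 (z i)) := by
    refine Measure.pi_eq fun s hs => ?_
    rw [withDensity_apply _ (MeasurableSet.univ_pi hs), ← lintegral_indicator (MeasurableSet.univ_pi hs)]
    have : (fun a : ι → ℝ => (univ.pi s).indicator (fun z => ∏ i, gaussianPDF 0 1 (z i)) a) =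
        fun a => ∏ i, (s i).indicator (gaussianPDF 0 1) (a i) := by
      ext a
      by_cases ha : a ∈ univ.pi s
      · rw [indicator_of_mem ha]
        exact Finset.prod_congr rfl fun i _ => by rw [indicator_of_mem (ha i trivial)]
      · rw [indicator_of_notMem ha]
        simp only [mem_univ_pi, not_forall] at ha
        obtain ⟨i, hi⟩ := ha
        exact (Finset.prod_eq_zero (Finset.mem_univ i) (by rw [indicator_of_notMem hi])).symm
    rw [this, prod_lint _ fun i => (measurable_gaussianPDF 0 1).indicator (hs i)]
    refine Finset.prod_congr rfl fun i _ => ?_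
    rw [lintegral_indicator (hs i), gaussianReal_of_var_ne_zero _ one_ne_zero, withDensity_apply _ (hs i)]
  refine ⟨κ, by simp only [κ, ne_eq, ENNReal.ofReal_eq_zero, not_le]; positivity, ENNReal.ofReal_ne_top, fun F hF => ?_⟩
  rw [e, lintegral_withDensity_eq_lintegral_mul _ hm hF, ← lintegral_const_mul _ (by fun_prop)]
  refine lintegral_congr fun z => ?_
  simp only [Pi.mul_apply, hp]; ring

theorem dens {ι : Type} [Fintype ι] {ν : Measure (ι → ℝ)} {q : (ι → ℝ) → ℝ} (hν : IsG ν q)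
    (B : (ι → ℝ) →ₗ[ℝ] (ι → ℝ) →ₗ[ℝ] ℝ) (sym : ∀ f g, B f g = B g f) (nn : ∀ f, 0 ≤ B f f)
    (hc : ∀ c : ι → ℝ, ∃ x, (∀ g, B x g = ∑ i, c i * g i) ∧ q c = ∑ i, c i * x i) :
    ∃ κ : ENNReal, κ ≠ 0 ∧ κ ≠ ⊤ ∧ ∀ F : (ι → ℝ) → ENNReal, Measurable F →
    ∫⁻ z, F z ∂ν = κ * ∫⁻ z, F z * ENNReal.ofReal (Real.exp (-(B z z) / 2)) := by
  have inj : ∀ y, B y y = 0 → y = 0 := by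
    intro y hy
    have h0 : ∀ x, B x y = 0 := by
      intro x
      have h : ∀ t : ℝ, 0 ≤ B x x + 2 * t * B x y := by
        intro t
        have := nn (x + t • y)
        simp only [map_add, map_smul, LinearMap.add_apply, LinearMap.smul_apply, smul_eq_mul, hy, sym y x] at this
        linarith
      by_contra hne
      have := h (-(B x x + 1) / (2 * B x y))
      have e : 2 * (-(B x x + 1) / (2 * B x y)) * B x y = -(B x x + 1) := by field_simp
      linarith
    ext i
    obtain ⟨x, hx, -⟩ := hc (Pi.single i 1)
    have := hx y
    rw [h0] at this
    simpa [Pi.single_apply] using this.symm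
  set M : Matrix ι ι ℝ := fun i j => B (Pi.single i 1) (Pi.single j 1)
  have hB : ∀ f g, B f g = f ⬝ᵥ M.mulVec g := by
    intro f g
    conv_lhs => rw [pi_eq_sum_univ' f, pi_eq_sum_univ' g]
    simp only [map_sum, LinearMap.sum_apply, map_smul, LinearMap.smul_apply, smul_eq_mul, dotProduct,
      Matrix.mulVec, Finset.mul_sum, M]
    refine (Finset.sum_comm).trans (Finset.sum_congr rfl fun i _ => Finset.sum_congr rfl fun j _ => ?_)
    ring
  have hM : M.PosSemidef := by
    refine Matrix.PosSemidef.of_dotProduct_mulVec_nonneg (by ext i j; rw [Matrix.conjTranspose_apply]; exact sym _ _) fun x => ?_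
    have := nn x; rw [hB] at this; simpa using this
  obtain ⟨T, hT⟩ := psd_factor hM
  have hBT : ∀ f g, B f g = ∑ i, T.mulVec f i * T.mulVec g i := by
    intro f g
    rw [hB, hT, ← Matrix.mulVec_mulVec, Matrix.dotProduct_mulVec, Matrix.vecMul_transpose]; rfl
  have Tinj : Function.Injective (Matrix.toLin' T) := by
    rw [← LinearMap.ker_eq_bot, LinearMap.ker_eq_bot']
    intro f hf
    apply inj; rw [hBT]; simp only [Matrix.toLin'_apply] at hf; simp [hf]
  have Tsurj : Function.Surjective (Matrix.toLin' T) := LinearMap.injective_iff_surjective.1 Tinj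
  have law : ν.map (fun x => T.mulVec x) = stdP ι := by
    have h1 := hν.map T
    have : (fun c => q (Matrix.vecMul c T)) = fun c => ∑ i, c i ^ 2 := by
      ext c
      obtain ⟨x, hx, hq⟩ := hc (Matrix.vecMul c T)
      have h2 : ∀ g, ∑ i, Matrix.vecMul c T i * g i = ∑ i, c i * T.mulVec g i := fun g =>
        (Matrix.dotProduct_mulVec c T g).symm
      obtain ⟨g, hg⟩ := Tsurj (T.mulVec x - c)
      rw [Matrix.toLin'_apply] at hg
      have h3 := hx g
      rw [hBT, h2, hg] at h3
      have h4 : T.mulVec x = c := by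
        have : ∑ i, (T.mulVec x - c) i * (T.mulVec x - c) i = 0 := by
          simp only [Pi.sub_apply, sub_mul, Finset.sum_sub_distrib]
          simp only [Pi.sub_apply] at h3
          linarith
        have := (Finset.sum_eq_zero_iff_of_nonneg fun i _ => mul_self_nonneg _).1 this
        ext i
        have := mul_self_eq_zero.1 (this i (Finset.mem_univ i))
        simp only [Pi.sub_apply] at this; linarith
      rw [hq, h2, h4]; simp [sq]
    rw [this] at h1
    exact h1.uniq isG_std
  obtain ⟨κ, k0, k1, hκ⟩ := std_dens (ι := ι)
  have hdet : LinearMap.det (Matrix.toLin' T) ≠ 0 := by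
    have := LinearMap.isUnit_iff_ker_eq_bot (Matrix.toLin' T) |>.2 (LinearMap.ker_eq_bot.2 Tinj)
    exact (LinearMap.isUnit_iff_isUnit_det _ |>.1 this).ne_zero
  set e := LinearEquiv.ofBijective (Matrix.toLin' T) ⟨Tinj, Tsurj⟩
  have he : ∀ x, e.symm (T.mulVec x) = x := fun x => e.symm_apply_apply x
  have hem : Measurable e.symm := (e.symm.toContinuousLinearEquiv.continuous).measurable
  have hv := Measure.map_linearMap_addHaar_pi_eq_smul_addHaar hdet (volume : Measure (ι → ℝ))
  set δ := ENNReal.ofReal |(LinearMap.det (Matrix.toLin' T))⁻¹|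
  have d0 : δ ≠ 0 := by simp only [δ, ne_eq, ENNReal.ofReal_eq_zero, not_le]; positivity
  have mB : Measurable fun z => B z z := by simp_rw [hBT]; fun_prop
  refine ⟨κ * δ⁻¹, mul_ne_zero k0 (ENNReal.inv_ne_zero.2 ENNReal.ofReal_ne_top),
    ENNReal.mul_ne_top k1 (ENNReal.inv_ne_top.2 d0), fun F hF => ?_⟩
  have h1 : ∫⁻ z, F z ∂ν = ∫⁻ z, F (e.symm z) ∂stdP ι := by
    rw [← law, lintegral_map (f := fun z => F (e.symm z)) (hF.comp hem) (by fun_prop)]; simp_rw [he]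
  have h2 : ∫⁻ z, F (e.symm z) * ENNReal.ofReal (Real.exp (-(∑ i, z i ^ 2) / 2)) ∂(δ • (volume : Measure (ι → ℝ))) =
      ∫⁻ z, F z * ENNReal.ofReal (Real.exp (-(B z z) / 2)) := by
    have hFe : Measurable fun z => F (e.symm z) := hF.comp hem
    rw [← hv, lintegral_map (by fun_prop) (LinearMap.continuous_of_finiteDimensional _).measurable]
    refine lintegral_congr fun x => ?_
    simp only [Matrix.toLin'_apply, he, hBT, sq]
  rw [h1, hκ (fun z => F (e.symm z)) (hF.comp hem), ← h2, lintegral_smul_measure, smul_eq_mul, mul_assoc, ← mul_assoc δ⁻¹,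
    ENNReal.inv_mul_cancel d0 ENNReal.ofReal_ne_top, one_mul]

theorem gauss_zero {Ω : Type} [MeasurableSpace Ω] {ν : Measure Ω} {f : Ω → ℝ} (hf : Measurable f)
    (h : ν.map f = gaussianReal 0 0) : ∀ᵐ x ∂ν, f x = 0 := by
  rw [gaussianReal_zero_var] at h
  have : ∀ᵐ t ∂(ν.map f), t = 0 := by
    rw [h]; exact (ae_dirac_iff (measurableSet_singleton 0)).2 rfl
  exact ae_of_ae_map hf.aemeasurable this

theorem dens_Y {X : Type} [Fintype X] [DecidableEq X] {ν : Measure (X → ℝ)} {q : (X → ℝ) → ℝ} (hν : IsG ν q)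
    (B : (X → ℝ) →ₗ[ℝ] (X → ℝ) →ₗ[ℝ] ℝ) (sym : ∀ f g, B f g = B g f) (nn : ∀ f, 0 ≤ B f f) (Y : Finset X)
    (hc : ∀ c : X → ℝ, ∃ x : X → ℝ, (∀ p ∉ Y, x p = 0) ∧ (∀ g : X → ℝ, (∀ p ∉ Y, g p = 0) → B x g = ∑ i, c i * g i) ∧
      q c = ∑ i, c i * x i) :
    ∃ κ : ENNReal, κ ≠ 0 ∧ κ ≠ ⊤ ∧ ∀ F : (X → ℝ) → ENNReal, Measurable F →
    ∫⁻ z, F z ∂ν = κ * (∫⋯∫⁻_Y, (fun u => F u * ENNReal.ofReal (Real.exp (-(B u u) / 2))) ∂(fun _ => volume)) 0 := by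
  let ext : (Y → ℝ) →ₗ[ℝ] (X → ℝ) :=
    { toFun := fun y p => if h : p ∈ Y then y ⟨p, h⟩ else 0
      map_add' := fun f g => by ext p; by_cases h : p ∈ Y <;> simp [h]
      map_smul' := fun f g => by ext p; by_cases h : p ∈ Y <;> simp [h] }
  have ext1 : ∀ y (p : Y), ext y p = y p := fun y p => by simp [ext, p.2]
  have ext0 : ∀ y, ∀ p ∉ Y, ext y p = 0 := fun y p hp => by simp [ext, hp]
  have extu : ∀ y, Function.updateFinset (0 : X → ℝ) Y y = ext y := fun y => by
    ext p; by_cases h : p ∈ Y <;> simp [ext, Function.updateFinset, h]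
  have hs : ∀ c y : Y → ℝ, ∑ i, ext c i * ext y i = ∑ i, c i * y i := by
    intro c y
    rw [← Finset.sum_subset (Finset.subset_univ Y) (fun p _ hp => by rw [ext0 c p hp, zero_mul]),
      ← Finset.sum_coe_sort]
    simp_rw [ext1]
  have hext : ∀ x : X → ℝ, (∀ p ∉ Y, x p = 0) → ext (fun k => x k) = x := by
    intro x hx; ext p; by_cases h : p ∈ Y
    · simp [ext, h]
    · rw [ext0 _ p h, hx p h]
  have hG := hν.mapFun (Subtype.val : Y → X)
  have hq : ∀ c : Y → ℝ, (fun i => ∑ k : Y, if (k : X) = i then c k else 0) = ext c := by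
    intro c; ext i
    by_cases h : i ∈ Y
    · rw [Finset.sum_eq_single ⟨i, h⟩]
      · simp [ext, h]
      · intro b _ hb; rw [if_neg]; rintro rfl; exact hb rfl
      · simp
    · rw [ext0 _ i h]; exact Finset.sum_eq_zero fun k _ => by
        rw [if_neg]; rintro rfl; exact h k.2
  have hG' : IsG (ν.map fun x (k : Y) => x k) (fun c => q (ext c)) := by
    intro c; have := hG c
    change _ = gaussianReal 0 (q (ext c)).toNNReal
    rw [← hq c]; convert this
  obtain ⟨κ, k0, k1, hκ⟩ := dens hG' (B.compl₁₂ ext ext) (fun f g => sym _ _) (fun f => nn _) (by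
    intro c
    obtain ⟨x, hx, h1, h2⟩ := hc (ext c)
    refine ⟨fun k => x k, fun g => ?_, ?_⟩
    · rw [LinearMap.compl₁₂_apply, hext x hx, h1 _ (ext0 g), hs]
    · rw [h2, ← hs, hext x hx])
  refine ⟨κ, k0, k1, fun F hF => ?_⟩
  have hem : Measurable ext := (LinearMap.continuous_of_finiteDimensional ext).measurable
  have ae : ∀ᵐ z ∂ν, z = ext (fun k => z k) := by
    have : ∀ p : X, p ∉ Y → ∀ᵐ z ∂ν, z p = 0 := by
      intro p hp
      apply gauss_zero (measurable_pi_apply p)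
      rw [hν.coord]
      obtain ⟨x, hx, -, h2⟩ := hc (Pi.single p 1)
      have h3 : q (Pi.single p 1) = 0 := by
        rw [h2]; refine Finset.sum_eq_zero fun i _ => ?_
        by_cases hi : i = p
        · subst hi; simp [hx i hp]
        · simp [hi]
      have h4 : q (@Pi.single X (fun _ => ℝ) _ (fun a b => Classical.propDecidable (a = b)) p 1) = 0 := by convert h3
      congr 1; exact Real.toNNReal_of_nonpos h4.le
    have h2 : ∀ᵐ z ∂ν, ∀ p : X, p ∉ Y → z p = 0 := by
      rw [ae_all_iff]; intro p
      by_cases hp : p ∈ Y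
      · simp [hp]
      · simpa [hp] using this p hp
    filter_upwards [h2] with z hz
    exact (hext z hz).symm
  have e1 : ∫⁻ z, F z ∂ν = ∫⁻ y, F (ext y) ∂(ν.map fun x (k : Y) => x k) := by
    rw [lintegral_map (f := fun y => F (ext y)) (hF.comp hem) (by fun_prop)]
    refine lintegral_congr_ae ?_
    filter_upwards [ae] with z hz
    rw [← hz]
  rw [e1, hκ (fun y => F (ext y)) (hF.comp hem), lmarginal]
  simp_rw [extu]; rfl

theorem IsG.mapLin {ι κ : Type} [Fintype ι] [Fintype κ] {ν : Measure (ι → ℝ)} {q : (ι → ℝ) → ℝ}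
    (h : IsG ν q) (f : (ι → ℝ) → (κ → ℝ)) (hf : Measurable f) (A : (κ → ℝ) → (ι → ℝ))
    (hA : ∀ c x, ∑ p, c p * f x p = ∑ i, A c i * x i) : IsG (ν.map f) (fun c => q (A c)) := by
  intro c
  rw [Measure.map_map (by fun_prop) hf, ← h]
  congr 1; ext x; exact hA c x

section shear
variable {L : ℕ} [NeZero L] {m : ℕ}

def bv (m : ℕ) (b : XX L m → ℝ) (e : Tor L × Bool) (j : ℕ) : ℝ :=
  if h : 0 < j ∧ j < m then b (.inr (e.1, e.2, ⟨j - 1, by omega⟩)) else 0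

def vx (b : XX L m → ℝ) : Tor L → ℝ := fun x => b (.inl x)

def sh (m : ℕ) (s : ℝ) (b : XX L m → ℝ) : XX L m → ℝ
  | .inl x => b (.inl x)
  | .inr (x, d, k) => s * lin m (vx b) (x, d) (k + 1) + b (.inr (x, d, k))

theorem lin_add (f g : Tor L → ℝ) (e : Tor L × Bool) (j : ℕ) : lin m (f + g) e j = lin m f e j + lin m g e j := by
  simp [lin]; ring
theorem lin_smul (c : ℝ) (f : Tor L → ℝ) (e : Tor L × Bool) (j : ℕ) : lin m (c • f) e j = c * lin m f e j := by
  simp [lin]; ring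

def shL (m : ℕ) (s : ℝ) : (XX L m → ℝ) →ₗ[ℝ] (XX L m → ℝ) where
  toFun := sh m s
  map_add' f g := by
    ext p; rcases p with x | ⟨x, d, k⟩
    · rfl
    · have : vx (f + g) = vx f + vx g := rfl
      simp only [sh, Pi.add_apply, this, lin_add]; ring
  map_smul' c f := by
    ext p; rcases p with x | ⟨x, d, k⟩
    · rfl
    · have : vx (c • f) = c • vx f := rfl
      simp only [sh, Pi.smul_apply, this, lin_smul, RingHom.id_apply, smul_eq_mul]; ring

theorem sh_sh (s : ℝ) (b : XX L m → ℝ) : sh m (-s) (sh m s b) = b := by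
  ext p; rcases p with x | ⟨x, d, k⟩
  · rfl
  · have : vx (sh m s b) = vx b := rfl
    simp only [sh, this]; ring

def B0 (m : ℕ) (ε : ℝ) : (XX L m → ℝ) →ₗ[ℝ] (XX L m → ℝ) →ₗ[ℝ] ℝ :=
  LinearMap.mk₂ ℝ (fun f g => Eb (vx f) (vx g) + ε * (mn (vx f) * mn (vx g)) + ∑ e : Tor L × Bool,
      (m / 8 : ℝ) * ∑ j ∈ Finset.range m, (bv m f e (j + 1) - bv m f e j) * (bv m g e (j + 1) - bv m g e j))
    (fun f f' g => by
      have h : ∀ e j, bv m (f + f') e j = bv m f e j + bv m f' e j := fun e j => by unfold bv; split_ifs <;> simp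
      have h1 : Eb (vx (f + f')) (vx g) = Eb (vx f) (vx g) + Eb (vx f') (vx g) := Eb_add_left _ _ _
      have h2 : mn (vx (f + f')) = mn (vx f) + mn (vx f') := by
        simp only [mn, vx, Pi.add_apply, Finset.sum_add_distrib]; ring
      simp only [h, h1, h2, add_sub_add_comm, add_mul, Finset.sum_add_distrib, mul_add]; ring)
    (fun c f g => by
      have h : ∀ e j, bv m (c • f) e j = c * bv m f e j := fun e j => by unfold bv; split_ifs <;> simp
      simp only [h, Eb, mn, vx, Pi.smul_apply, smul_eq_mul, ← mul_sub, mul_assoc, ← Finset.mul_sum, mul_div_assoc, mul_add, mul_left_comm _ c])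
    (fun g f f' => by
      have h : ∀ e j, bv m (f + f') e j = bv m f e j + bv m f' e j := fun e j => by unfold bv; split_ifs <;> simp
      have h1 : Eb (vx g) (vx (f + f')) = Eb (vx g) (vx f) + Eb (vx g) (vx f') := by
        rw [Eb_comm, Eb_comm _ (vx f), Eb_comm _ (vx f')]; exact Eb_add_left _ _ _
      have h2 : mn (vx (f + f')) = mn (vx f) + mn (vx f') := by
        simp only [mn, vx, Pi.add_apply, Finset.sum_add_distrib]; ring
      simp only [h, h1, h2, add_sub_add_comm, Finset.sum_add_distrib, mul_add]; ring)
    (fun c g f => by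
      have h : ∀ e j, bv m (c • f) e j = c * bv m f e j := fun e j => by unfold bv; split_ifs <;> simp
      simp only [h, Eb, mn, vx, Pi.smul_apply, smul_eq_mul, ← mul_sub, ← Finset.mul_sum, mul_div_assoc, mul_add, mul_left_comm _ c])

theorem B0_apply (ε : ℝ) (f g : XX L m → ℝ) : B0 m ε f g = Eb (vx f) (vx g) + ε * (mn (vx f) * mn (vx g)) +
    ∑ e : Tor L × Bool, (m / 8 : ℝ) *
      ∑ j ∈ Finset.range m, (bv m f e (j + 1) - bv m f e j) * (bv m g e (j + 1) - bv m g e j) := rfl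

def En (m : ℕ) (u : XX L m → ℝ) : ℝ := ∑ e : Tor L × Bool, ((7 / 8) * (u (.inl e.1) - u (.inl (e.1 + ed e.2))) ^ 2 +
  (m / 8 : ℝ) * ∑ j ∈ Finset.range m, (u (pt m e (j + 1)) - u (pt m e j)) ^ 2)

theorem sh_pt (hm : 1 ≤ m) (b : XX L m → ℝ) (e : Tor L × Bool) (j : ℕ) (hj : j ≤ m) :
    sh m 1 b (pt m e j) = lin m (vx b) e j + bv m b e j := by
  have hm0 : (m : ℝ) ≠ 0 := by positivity
  unfold pt bv
  split_ifs with h h'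
  · have : j - 1 + 1 = j := by omega
    simp [sh, this]
  · subst h'; simp [sh, lin, vx]
  · obtain rfl : j = m := by omega
    simp [sh, lin, div_self hm0, vx]

theorem En_sh (hm : 1 ≤ m) (ε : ℝ) (b : XX L m → ℝ) : B0 m ε b b = En m (sh m 1 b) + ε * mn (vx b) ^ 2 := by
  have hm0 : (m : ℝ) ≠ 0 := by positivity
  rw [B0_apply]
  have h1 : Eb (vx b) (vx b) = ∑ e : Tor L × Bool, (vx b e.1 - vx b (e.1 + ed e.2)) ^ 2 := by
    rw [Fintype.sum_prod_type_right]; simp only [Eb, sq]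
  rw [h1, En, add_right_comm, ← Finset.sum_add_distrib, sq]
  congr 1
  refine Finset.sum_congr rfl fun e _ => ?_
  set δ := vx b (e.1 + ed e.2) - vx b e.1
  have h2 : ∀ j ∈ Finset.range m, (sh m 1 b (pt m e (j + 1)) - sh m 1 b (pt m e j)) ^ 2 =
      δ ^ 2 / m ^ 2 + 2 * δ / m * (bv m b e (j + 1) - bv m b e j) +
        (bv m b e (j + 1) - bv m b e j) * (bv m b e (j + 1) - bv m b e j) := by
    intro j hj
    have := Finset.mem_range.1 hj
    rw [sh_pt hm _ _ _ (by omega), sh_pt hm _ _ _ (by omega)]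
    simp only [lin, δ]; push_cast; field_simp; ring
  have h3 : bv m b e m - bv m b e 0 = 0 := by simp [bv]
  rw [Finset.sum_congr rfl h2, Finset.sum_add_distrib, Finset.sum_add_distrib, ← Finset.mul_sum,
    Finset.sum_range_sub, h3, Finset.sum_const, Finset.card_range, nsmul_eq_mul]
  change (vx b e.1 - vx b (e.1 + ed e.2)) ^ 2 + _ = (7 / 8) * (vx b e.1 - vx b (e.1 + ed e.2)) ^ 2 + _
  rw [mul_zero, add_zero, mul_add]
  have : (m / 8 : ℝ) * (m * (δ ^ 2 / m ^ 2)) = (vx b e.1 - vx b (e.1 + ed e.2)) ^ 2 / 8 := by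
    simp only [δ]; field_simp; ring
  rw [this]; ring

theorem bridge_id (m i : ℕ) (hi : i ≤ m) (hm : 1 ≤ m) (γ : ℕ → ℝ) (h0 : γ 0 = 0) (h1 : γ m = 0) :
    ∑ j ∈ Finset.range m, ((if j < i then (1:ℝ) else 0) - i / m) * (γ (j + 1) - γ j) = γ i := by
  simp only [sub_mul, Finset.sum_sub_distrib, ← Finset.mul_sum, Finset.sum_range_sub, h0, h1, ite_mul, one_mul,
    zero_mul]
  rw [← Finset.sum_filter]
  have : (Finset.range m).filter (fun j => j < i) = Finset.range i := by ext j; simp; omega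
  rw [this]; simp only [← Finset.sum_sub_distrib, Finset.sum_range_sub, h0, h1]; ring

def bc (m i j : ℕ) : ℝ := 8 / m * (min (i : ℝ) j - i * j / m)

theorem bc_diff (m i j : ℕ) : bc m (j + 1) i - bc m j i = 8 / m * ((if j < i then (1:ℝ) else 0) - i / m) := by
  unfold bc
  split_ifs with h
  · rw [min_eq_left (by exact_mod_cast h), min_eq_left (by exact_mod_cast h.le)]; push_cast; ring
  · rw [min_eq_right, min_eq_right] <;> first | exact_mod_cast (by omega) | (push_cast; ring)

theorem bc_id (m i : ℕ) (hi : i ≤ m) (hm : 1 ≤ m) (γ : ℕ → ℝ) (h0 : γ 0 = 0) (h1 : γ m = 0) :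
    (m / 8 : ℝ) * ∑ j ∈ Finset.range m, (bc m (j + 1) i - bc m j i) * (γ (j + 1) - γ j) = γ i := by
  have hm0 : (m : ℝ) ≠ 0 := by positivity
  simp_rw [bc_diff, mul_assoc]
  rw [← Finset.mul_sum, bridge_id m i hi hm γ h0 h1]; field_simp

def YS (m : ℕ) (S : Finset (Tor L)) (Ed : Finset (Tor L × Bool)) : Finset (XX L m) :=
  Finset.univ.filter fun p => match p with
    | .inl x => x ∈ S
    | .inr (x, d, _) => (x, d) ∈ Ed

theorem dens_sh (hm : 1 ≤ m) (ε : ℝ) (hε : 0 ≤ ε) (S : Finset (Tor L)) (Ed : Finset (Tor L × Bool))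
    (hSE : ∀ e : Tor L × Bool, e.1 ∈ S ∨ e.1 + ed e.2 ∈ S → e ∈ Ed)
    (KV : (Tor L → ℝ) → (Tor L → ℝ)) (hK0 : ∀ a, ∀ x ∉ S, KV a x = 0)
    (hK : ∀ a g, (∀ x ∉ S, g x = 0) → Eb (KV a) g + ε * (mn (KV a) * mn g) = ∑ x, a x * g x)
    {ν : Measure (XX L m → ℝ)} (hν : IsG ν fun c => ∑ x, vx c x * KV (vx c) x +
      ∑ e ∈ Ed, ∑ k : Fin (m - 1), ∑ k' : Fin (m - 1), c (.inr (e.1, e.2, k)) * c (.inr (e.1, e.2, k')) * bc m (k + 1) (k' + 1)) :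
    ∃ κ : ENNReal, κ ≠ 0 ∧ κ ≠ ⊤ ∧ ∀ F : (XX L m → ℝ) → ENNReal, Measurable F →
    ∫⁻ b, F (sh m 1 b) ∂ν = κ * (∫⋯∫⁻_(YS m S Ed), (fun u => F u *
      ENNReal.ofReal (Real.exp (-(En m u + ε * mn (vx u) ^ 2) / 2))) ∂(fun _ => volume)) 0 := by
  have hshm : Measurable (sh m 1 : (XX L m → ℝ) → _) :=
    (LinearMap.continuous_of_finiteDimensional (shL (L := L) m 1)).measurable
  have hs' : ∀ b : XX L m → ℝ, sh m 1 (sh m (-1) b) = b := fun b => by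
    have := sh_sh (m := m) (-1) b; rwa [neg_neg] at this
  have hB : ∀ u : XX L m → ℝ, (B0 m ε).compl₁₂ (shL m (-1)) (shL m (-1)) u u = En m u + ε * mn (vx u) ^ 2 := by
    intro u
    rw [LinearMap.compl₁₂_apply]
    change B0 m ε (sh m (-1) u) (sh m (-1) u) = _
    rw [En_sh hm, hs']; rfl
  have hY : ∀ (s : ℝ) (b : XX L m → ℝ), (∀ p ∉ YS m S Ed, b p = 0) → ∀ p ∉ YS m S Ed, sh m s b p = 0 := by
    intro s b hb p hp
    rcases p with x | ⟨x, d, k⟩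
    · exact hb _ hp
    · simp only [sh, hb _ hp, add_zero]
      have hn : (x, d) ∉ Ed := by simpa [YS] using hp
      have h1 : vx b x = 0 := hb _ (by simp only [YS, Finset.mem_filter, Finset.mem_univ, true_and]
                                       exact fun h => hn (hSE _ (.inl h)))
      have h2 : vx b (x + ed d) = 0 := hb _ (by simp only [YS, Finset.mem_filter, Finset.mem_univ, true_and]
                                                exact fun h => hn (hSE _ (.inr h)))
      simp [lin, h1, h2]
  have hG := hν.mapLin (sh m 1) hshm (fun c i => ∑ p, c p * sh m 1 (Pi.single i 1) p) (by
    intro c x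
    simp_rw [Finset.sum_mul]
    rw [Finset.sum_comm]
    refine Finset.sum_congr rfl fun p _ => ?_
    have : sh m 1 x p = ∑ i, x i * sh m 1 (Pi.single i 1) p := by
      have := congrArg (shL m 1) (pi_eq_sum_univ' x)
      rw [map_sum] at this
      have := congrFun this p
      simp only [map_smul, Finset.sum_apply, Pi.smul_apply, smul_eq_mul] at this
      exact this
    rw [this, Finset.mul_sum]
    exact Finset.sum_congr rfl fun i _ => by ring)
  obtain ⟨κ, k0, k1, hκ⟩ := dens_Y hG ((B0 m ε).compl₁₂ (shL m (-1)) (shL m (-1)))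
    (fun f g => by
      simp only [LinearMap.compl₁₂_apply, B0_apply, Eb_comm (vx (shL m (-1) f)), mul_comm (mn (vx (shL m (-1) f)))]
      congr 1
      exact Finset.sum_congr rfl fun e _ => by congr 1; exact Finset.sum_congr rfl fun j _ => mul_comm _ _)
    (fun f => by
      rw [hB, En]
      exact add_nonneg (Finset.sum_nonneg fun e _ => add_nonneg (by positivity)
        (mul_nonneg (by positivity) (Finset.sum_nonneg fun j _ => sq_nonneg _))) (by positivity))
    (YS m S Ed) (by
      intro c
      set a : XX L m → ℝ := fun i => ∑ p, c p * sh m 1 (Pi.single i 1) p with ha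
      have hac : ∀ x, ∑ i, a i * x i = ∑ p, c p * sh m 1 x p := by
        intro x
        simp_rw [ha, Finset.sum_mul]
        rw [Finset.sum_comm]
        refine Finset.sum_congr rfl fun p _ => ?_
        have := congrArg (shL m 1) (pi_eq_sum_univ' x)
        rw [map_sum] at this
        have := congrFun this p
        simp only [map_smul, Finset.sum_apply, Pi.smul_apply, smul_eq_mul] at this
        change sh m 1 x p = _ at this
        rw [this, Finset.mul_sum]
        exact Finset.sum_congr rfl fun i _ => by simp only [shL, LinearMap.coe_mk, AddHom.coe_mk]; ring
      let x0 : XX L m → ℝ := fun p => match p with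
        | .inl x => KV (vx a) x
        | .inr (x, d, k) => if (x, d) ∈ Ed then ∑ k', a (.inr (x, d, k')) * bc m (k + 1) (k' + 1) else 0
      have sx0 : ∀ p ∉ YS m S Ed, x0 p = 0 := by
        intro p hp
        rcases p with x | ⟨x, d, k⟩
        · exact hK0 _ _ (by simpa [YS] using hp)
        · have hn : (x, d) ∉ Ed := by simpa [YS] using hp
          simp [x0, hn]
      have sumX : ∀ f : XX L m → ℝ, ∑ p, f p = ∑ x, f (.inl x) + ∑ e : Tor L × Bool, ∑ k, f (.inr (e.1, e.2, k)) := by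
        intro f
        rw [Fintype.sum_sum_type]; simp only [Fintype.sum_prod_type]
      have hm0 : (m : ℝ) ≠ 0 := by positivity
      have bvx : ∀ e ∈ Ed, ∀ j ≤ m, bv m x0 e j = ∑ k' : Fin (m - 1), a (.inr (e.1, e.2, k')) * bc m j (k' + 1) := by
        intro e he j hj
        unfold bv
        split_ifs with h
        · have : j - 1 + 1 = j := by omega
          simp [x0, he, this]
        · symm; refine Finset.sum_eq_zero fun k' _ => ?_
          have hk := k'.2
          have : j = 0 ∨ j = m := by omega
          rcases this with rfl | rfl
          · simp [bc]; right; right; positivity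
          · have : min (j : ℝ) ((k':ℕ) + 1) = (k' : ℕ) + 1 := min_eq_right (by exact_mod_cast (by omega))
            simp [bc, this]; right; right; field_simp; simp
      refine ⟨sh m 1 x0, hY 1 x0 sx0, fun g hg => ?_, ?_⟩
      · set g0 := sh m (-1) g
        have hg0 := hY (-1) g hg
        have e1 : ∑ i, c i * g i = ∑ i, a i * g0 i := by rw [hac, hs']
        rw [e1, LinearMap.compl₁₂_apply]
        change B0 m ε (sh m (-1) (sh m 1 x0)) g0 = _
        rw [sh_sh, B0_apply, sumX]
        congr 1
        · exact hK (vx a) (vx g0) fun x hx => hg0 (.inl x) (by simpa [YS] using hx)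
        · refine Finset.sum_congr rfl fun e _ => ?_
          by_cases he : e ∈ Ed
          · have : ∀ j ∈ Finset.range m, (bv m x0 e (j + 1) - bv m x0 e j) * (bv m g0 e (j + 1) - bv m g0 e j) =
                ∑ k' : Fin (m - 1), a (.inr (e.1, e.2, k')) * ((bc m (j + 1) (k' + 1) - bc m j (k' + 1)) *
                  (bv m g0 e (j + 1) - bv m g0 e j)) := by
              intro j hj
              have := Finset.mem_range.1 hj
              rw [bvx e he _ (by omega), bvx e he _ (by omega), ← Finset.sum_sub_distrib, Finset.sum_mul]
              exact Finset.sum_congr rfl fun k _ => by ring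
            rw [Finset.sum_congr rfl this, Finset.sum_comm, Finset.mul_sum]
            refine Finset.sum_congr rfl fun k _ => ?_
            have hk := k.2
            rw [← Finset.mul_sum, mul_left_comm, bc_id m (k + 1) (by omega) hm _ (by simp [bv]) (by simp [bv])]
            congr 1
            have : 0 < (k : ℕ) + 1 ∧ (k : ℕ) + 1 < m := by omega
            simp [bv, this]
          · have hz : ∀ k, g0 (.inr (e.1, e.2, k)) = 0 := fun k => hg0 _ (by simpa [YS] using he)
            have hz' : ∀ j, bv m g0 e j = 0 := fun j => by unfold bv; split_ifs; exacts [hz _, rfl]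
            simp [hz, hz']
      · rw [← hac, sumX]
        congr 1
        rw [← Finset.sum_subset (Finset.subset_univ Ed)]
        · refine Finset.sum_congr rfl fun e he => Finset.sum_congr rfl fun k _ => ?_
          change ∑ k', a _ * a _ * _ = a _ * (if e ∈ Ed then _ else 0)
          rw [if_pos he, Finset.mul_sum]
          exact Finset.sum_congr rfl fun k' _ => mul_assoc _ _ _
        · intro e _ he; simp [x0, he])
  refine ⟨κ, k0, k1, fun F hF => ?_⟩
  rw [← lintegral_map hF hshm, hκ F hF]
  simp_rw [hB]
end shear

theorem lmarg_shift {X : Type} [Fintype X] [DecidableEq X] (s : Finset X) (f : (X → ℝ) → ENNReal) (x : X → ℝ) (t : ℝ) :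
    (∫⋯∫⁻_s, f ∂(fun _ => volume)) (fun p => x p + t) = (∫⋯∫⁻_s, (fun u => f (fun p => u p + t)) ∂(fun _ => volume)) x := by
  unfold lmarginal
  rw [← lintegral_add_right_eq_self _ (fun _ : s => t)]
  refine lintegral_congr fun y => ?_
  congr 1; ext p
  by_cases h : p ∈ s <;> simp [Function.updateFinset, h]

def c0 : ENNReal := ∫⁻ t : ℝ, ENNReal.ofReal (Real.exp (-t ^ 2 / 2))

theorem c0_top : c0 ≠ ⊤ := by
  have : Integrable (fun t : ℝ => Real.exp (-t ^ 2 / 2)) := by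
    have := integrable_exp_neg_mul_sq (b := 1 / 2) (by norm_num)
    refine this.congr (ae_of_all _ fun t => ?_)
    simp only; congr 1; ring
  have h := this.2
  rw [hasFiniteIntegral_iff_ofReal (ae_of_all _ fun t => (Real.exp_pos _).le)] at h
  exact h.ne

theorem c0_zero : c0 ≠ 0 := by
  unfold c0
  rw [Ne, lintegral_eq_zero_iff (by fun_prop)]
  intro h
  have h2 : ∀ᵐ t : ℝ, False := by
    filter_upwards [h] with t ht
    have := Real.exp_pos (-t ^ 2 / 2)
    simp only [Pi.zero_apply, ENNReal.ofReal_eq_zero] at ht; linarith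
  rw [ae_iff] at h2; simp at h2

theorem slice {X : Type} [Fintype X] [DecidableEq X] (w : X) (G : (X → ℝ) → ENNReal) (hG : Measurable G)
    (hs : ∀ u t, G (fun p => u p + t) = G u) (μ : (X → ℝ) → ℝ) (hμ : Measurable μ)
    (hμs : ∀ u t, μ (fun p => u p + t) = μ u + t) (x : X → ℝ) :
    (∫⋯∫⁻_Finset.univ, (fun u => G u * ENNReal.ofReal (Real.exp (-(μ u) ^ 2 / 2))) ∂(fun _ => volume)) 0 =
    c0 * (∫⋯∫⁻_(Finset.univ.erase w), G ∂(fun _ => volume)) x := by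
  have hm : Measurable (fun u => G u * ENNReal.ofReal (Real.exp (-(μ u) ^ 2 / 2))) := by fun_prop
  set s := (Finset.univ : Finset X).erase w with hsdef
  have e0 : ∀ (f : (X → ℝ) → ENNReal) (x y : X → ℝ), x w = y w → (∫⋯∫⁻_s, f ∂(fun _ => volume)) x = (∫⋯∫⁻_s, f ∂(fun _ => volume)) y := by
    intro f x y h
    refine lmarginal_congr _ _ fun i hi => ?_
    have : i = w := by simpa [hsdef] using hi
    rw [this, h]
  have e1 : (∫⋯∫⁻_s, G ∂(fun _ => volume)) x = (∫⋯∫⁻_s, G ∂(fun _ => volume)) 0 := by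
    rw [e0 _ x (fun p => (0 : X → ℝ) p + x w) (by simp), lmarg_shift]
    simp_rw [hs]
  rw [e1]
  have hi : (Finset.univ : Finset X) = insert w s := (Finset.insert_erase (Finset.mem_univ w)).symm
  rw [hi, lmarginal_insert _ hm (by simp [hsdef])]
  have e2 : ∀ t : ℝ, (∫⋯∫⁻_s, (fun u => G u * ENNReal.ofReal (Real.exp (-(μ u) ^ 2 / 2))) ∂(fun _ => volume)) (Function.update 0 w t) =
      ∫⁻ y : s → ℝ, G (Function.updateFinset 0 s y) * ENNReal.ofReal (Real.exp (-(μ (Function.updateFinset 0 s y) + t) ^ 2 / 2)) := by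
    intro t
    rw [e0 _ _ (fun p => (0 : X → ℝ) p + t) (by simp), lmarg_shift]
    simp_rw [hs, hμs]; rfl
  simp_rw [e2]
  have hu : Measurable (fun y : s → ℝ => Function.updateFinset (0 : X → ℝ) s y) := measurable_updateFinset
  rw [lintegral_lintegral_swap]
  · have e3 : ∀ y : s → ℝ, ∫⁻ t : ℝ, G (Function.updateFinset 0 s y) *
        ENNReal.ofReal (Real.exp (-(μ (Function.updateFinset 0 s y) + t) ^ 2 / 2)) = G (Function.updateFinset 0 s y) * c0 := by
      intro y
      rw [lintegral_const_mul _ (by fun_prop)]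
      congr 1
      rw [c0, lintegral_add_left_eq_self (fun t : ℝ => ENNReal.ofReal (Real.exp (-t ^ 2 / 2)))]
    simp_rw [e3]
    refine (lintegral_mul_const (r := c0) (f := fun y => G (Function.updateFinset 0 s y)) (hG.comp hu)).trans ?_
    rw [mul_comm]; rfl
  · have h1 : Measurable fun z : ℝ × (s → ℝ) => G (Function.updateFinset 0 s z.2) := hG.comp (hu.comp measurable_snd)
    have h2 : Measurable fun z : ℝ × (s → ℝ) => μ (Function.updateFinset 0 s z.2) := hμ.comp (hu.comp measurable_snd)
    exact (h1.mul (by fun_prop)).aemeasurable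

section tdens
variable {L : ℕ} [NeZero L] {m : ℕ}

theorem bc_sum (hm : 1 ≤ m) (a b : ℕ) (ha : a ≤ m) (hb : b ≤ m) :
    ∑ i : Fin m, (√(8 / m) * ((if (i : ℕ) < a then (1:ℝ) else 0) - a / m)) *
      (√(8 / m) * ((if (i : ℕ) < b then (1:ℝ) else 0) - b / m)) = bc m a b := by
  have hm0 : (m : ℝ) ≠ 0 := by positivity
  have h := bridge_id m a ha hm (fun j => bc m j b) (by simp [bc]) (by
    have : min (m : ℝ) b = b := min_eq_right (by exact_mod_cast hb)
    simp only [bc, this]; field_simp; simp)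
  rw [← h, Finset.sum_range]
  refine Finset.sum_congr rfl fun i _ => ?_
  have h8 : √(8 / (m:ℝ)) * √(8 / (m:ℝ)) = 8 / m := Real.mul_self_sqrt (by positivity)
  rw [bc_diff]
  linear_combination (((if (i : ℕ) < a then (1:ℝ) else 0) - a / m) * ((if (i : ℕ) < b then (1:ℝ) else 0) - b / m)) * h8

def base (m : ℕ) (ω : OT L m) : XX L m → ℝ
  | .inl x => -ω.1 x
  | .inr (x, d, k) => -br m (ω.2 (x, d)) (k + 1)

theorem sh_base (ω : OT L m) : sh m 1 (base m ω) = fun p => -fld m ω p := by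
  ext p; rcases p with x | ⟨x, d, k⟩
  · rfl
  · simp [sh, base, fld, lin, vx]; ring

theorem base_meas : Measurable (base m : OT L m → _) := by
  rw [measurable_pi_iff]; intro p
  rcases p with x | ⟨x, d, k⟩
  · simp only [base]; fun_prop
  · have h : Measurable (fun ω : OT L m => ω.2 (x, d)) := by fun_prop
    exact ((br_meas m (k + 1)).comp h).neg

theorem br_gauss (hm : 1 ≤ m) (c : Fin (m - 1) → ℝ) :
    (stdP (Fin m)).map (fun g => ∑ k, c k * -br m g (k + 1)) =
    gaussianReal 0 (∑ k, ∑ k' : Fin (m - 1), c k * c k' * bc m (k + 1) (k' + 1)).toNNReal ∧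
    0 ≤ ∑ k, ∑ k' : Fin (m - 1), c k * c k' * bc m (k + 1) (k' + 1) := by
  let A : Fin m → ℝ := fun i => ∑ k : Fin (m - 1), -c k * (√(8 / m) * ((if (i : ℕ) < (k:ℕ) + 1 then (1:ℝ) else 0) - ((k + 1 : ℕ) : ℝ) / m))
  have hA : (fun g : Fin m → ℝ => ∑ k, c k * -br m g (k + 1)) = fun g => ∑ i, A i * g i := by
    ext g
    simp only [A, Finset.sum_mul]
    rw [Finset.sum_comm]
    refine Finset.sum_congr rfl fun k _ => ?_
    have e : br m g (k + 1) = ∑ i : Fin m, (√(8 / m) * ((if (i : ℕ) < (k:ℕ) + 1 then (1:ℝ) else 0) - ((k + 1 : ℕ) : ℝ) / m)) * g i := by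
      unfold br wk
      rw [← mul_assoc, mul_comm _ √(8 / (m:ℝ)), mul_assoc, ← mul_sub, Finset.mul_sum, ← Finset.sum_sub_distrib, Finset.mul_sum]
      refine Finset.sum_congr rfl fun i _ => ?_
      have := i.2
      rw [if_pos this]
      split_ifs <;> ring
    rw [e, ← Finset.sum_neg_distrib, Finset.mul_sum]
    exact Finset.sum_congr rfl fun i _ => by ring
  have hq : ∑ i, A i ^ 2 = ∑ k, ∑ k' : Fin (m - 1), c k * c k' * bc m (k + 1) (k' + 1) := by
    simp only [A, sq, Finset.sum_mul_sum]
    rw [Finset.sum_comm]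
    refine Finset.sum_congr rfl fun k _ => ?_
    rw [Finset.sum_comm]
    refine Finset.sum_congr rfl fun k' _ => ?_
    have h1 := k.2
    have h2 := k'.2
    rw [← bc_sum hm _ _ (by omega) (by omega), Finset.mul_sum]
    exact Finset.sum_congr rfl fun i _ => by ring
  rw [hA, ← hq]
  exact ⟨isG_std A, Finset.sum_nonneg fun i _ => sq_nonneg _⟩

theorem isG_base (hm : 1 ≤ m) : IsG ((PT L m).map (base m)) fun c => ∑ x, vx c x * (Km L).mulVec (vx c) x +
      ∑ e ∈ (Finset.univ : Finset (Tor L × Bool)), ∑ k : Fin (m - 1), ∑ k' : Fin (m - 1), c (.inr (e.1, e.2, k)) * c (.inr (e.1, e.2, k')) * bc m (k + 1) (k' + 1) := by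
  intro c
  rw [Measure.map_map (by fun_prop) base_meas]
  have h1 := isG_muT (L := L) (fun x => -vx c x)
  have h2 := gauss_sum_pi' (fun _ : Tor L × Bool => stdP (Fin m)) (fun e g => ∑ k : Fin (m - 1), c (.inr (e.1, e.2, k)) * -br m g (k + 1))
    (fun e => Finset.measurable_sum _ fun k _ => measurable_const.mul (br_meas m (k + 1)).neg) _
    (fun e => (br_gauss hm (fun k => c (.inr (e.1, e.2, k)))).1)
  have h3 := gauss_sum_prod (muT L) (Measure.pi fun _ : Tor L × Bool => stdP (Fin m)) _ (by fun_prop)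
    (fun ω => ∑ e, ∑ k : Fin (m - 1), c (.inr (e.1, e.2, k)) * -br m (ω e) (k + 1))
    (Finset.measurable_sum _ fun e _ => Finset.measurable_sum _ fun k _ => measurable_const.mul
      ((br_meas m (k + 1)).comp (measurable_pi_apply e)).neg) _ _ h1 h2
  have e1 : (fun x : XX L m → ℝ => ∑ i, c i * x i) ∘ base m = fun ω : OT L m =>
      ∑ x, (fun x => -vx c x) x * ω.1 x + ∑ e, ∑ k : Fin (m - 1), c (.inr (e.1, e.2, k)) * -br m (ω.2 e) (k + 1) := by
    ext ω
    simp only [Function.comp, Fintype.sum_sum_type, Fintype.sum_prod_type, base, vx]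
    congr 1
    exact Finset.sum_congr rfl fun x _ => by ring
  rw [e1, show PT L m = (muT L).prod (Measure.pi fun _ : Tor L × Bool => stdP (Fin m)) from rfl]
  refine h3.trans ?_
  have e2 : qK (fun x => -vx c x) = ∑ x, vx c x * (Km L).mulVec (vx c) x := by
    have : (fun x => -vx c x) = -vx c := rfl
    rw [this, qK, Matrix.mulVec_neg, neg_dotProduct, dotProduct_neg, neg_neg]; rfl
  congr 1
  rw [Real.toNNReal_add (by rw [← e2]; exact qK_nonneg _) (Finset.sum_nonneg fun e _ => (br_gauss hm _).2), e2,
    Real.toNNReal_sum_of_nonneg fun e _ => (br_gauss hm _).2]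

theorem torus_dens (hm : 1 ≤ m) : ∃ κ : ENNReal, κ ≠ 0 ∧ κ ≠ ⊤ ∧ ∀ F : (XX L m → ℝ) → ENNReal, Measurable F →
    ∫⁻ ω, F (fun p => -fld m ω p) ∂PT L m = κ * (∫⋯∫⁻_Finset.univ, (fun u => F u *
      ENNReal.ofReal (Real.exp (-(En m u + 1 * mn (vx u) ^ 2) / 2))) ∂(fun _ => volume)) 0 := by
  obtain ⟨κ, k0, k1, h⟩ := dens_sh (L := L) hm 1 zero_le_one Finset.univ Finset.univ (fun e _ => Finset.mem_univ e)
    (fun a => (Km L).mulVec a) (fun a x hx => absurd (Finset.mem_univ x) hx) (fun a g _ => by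
      rw [one_mul, ← Qm_form, Matrix.mulVec_mulVec, QK, Matrix.one_mulVec, dotProduct_comm]; rfl) (isG_base hm)
  refine ⟨κ, k0, k1, fun F hF => ?_⟩
  have hY : YS m (Finset.univ : Finset (Tor L)) Finset.univ = Finset.univ := by
    ext p; rcases p with x | ⟨x, d, k⟩ <;> simp [YS]
  have hshm : Measurable (sh m 1 : (XX L m → ℝ) → _) :=
    (LinearMap.continuous_of_finiteDimensional (shL (L := L) m 1)).measurable
  rw [← hY, ← h F hF, lintegral_map (f := fun b => F (sh m 1 b)) (hF.comp hshm) base_meas]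
  simp_rw [sh_base]

def wt (m : ℕ) (u : XX L m → ℝ) : ENNReal := ENNReal.ofReal (Real.exp (-(En m u) / 2))

theorem En_meas : Measurable (En m : (XX L m → ℝ) → ℝ) := by unfold En; fun_prop
theorem wt_meas : Measurable (wt m : (XX L m → ℝ) → _) := by unfold wt; have := En_meas (L := L) (m := m); fun_prop

theorem En_shift (u : XX L m → ℝ) (t : ℝ) : En m (fun p => u p + t) = En m u := by simp [En]

def UU (m j : ℕ) (h a : ℝ) (y : Tor L) : Set (XX L m → ℝ) :=
  {u | (∀ p, a < u p) ∧ ∀ y', a + h ≤ u (pt m (y', true) j) ∧ (u (pt m (y', true) j) = a + h → rk y ≤ rk y')}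

theorem UU_meas (j : ℕ) (h a : ℝ) (y : Tor L) : MeasurableSet (UU m j h a y) := by
  unfold UU
  simp only [setOf_and, setOf_forall]
  refine MeasurableSet.inter (MeasurableSet.iInter fun p => measurableSet_lt (by fun_prop) (by fun_prop))
    (MeasurableSet.iInter fun y' => (measurableSet_le (by fun_prop) (by fun_prop)).inter ?_)
  by_cases hr : rk y ≤ rk y'
  · simp [hr]
  · simp only [hr, imp_false]
    exact (measurableSet_eq_fun (by fun_prop) (by fun_prop)).compl

theorem UU_iff (j : ℕ) (h a : ℝ) (y : Tor L) (u : XX L m → ℝ) (hu : u (pt m (y, true) j) = a + h) :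
    u ∈ UU m j h a y ↔ (fun p => -u p) ∈ Ev m j h y := by
  simp only [UU, Ev, mem_setOf_eq, hu, neg_inj, neg_le_neg_iff]
  refine and_congr (forall_congr' fun p => ?_) Iff.rfl
  constructor <;> intro <;> linarith

theorem torus_slice {C1 : ℝ} (hC : 0 < C1) (hm : 1 ≤ m) {j : ℕ} (hj : 2 * j ≤ m) (hΨ : Psi L m ≤ cT L + C1) :
    ∃ y : Tor L, ∀ (a : ℝ) (v : Tor L), (v = y ∨ v = y + ed true) → ∀ x : XX L m → ℝ, x (pt m (y, true) j) = a + 4 * C1 →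
      (∫⋯∫⁻_(Finset.univ.erase (pt m (y, true) j)), (fun u => ENNReal.ofReal (u (.inl v) - a) *
        ((UU m j (4 * C1) a y).indicator (wt m) u)) ∂(fun _ => volume)) x ≤
      ENNReal.ofReal (52 * C1) * (∫⋯∫⁻_(Finset.univ.erase (pt m (y, true) j)), ((UU m j (4 * C1) a y).indicator (wt m)) ∂(fun _ => volume)) x ∧
      (∫⋯∫⁻_(Finset.univ.erase (pt m (y, true) j)), ((UU m j (4 * C1) a y).indicator (wt m)) ∂(fun _ => volume)) x ≠ 0 ∧
      (∫⋯∫⁻_(Finset.univ.erase (pt m (y, true) j)), ((UU m j (4 * C1) a y).indicator (wt m)) ∂(fun _ => volume)) x ≠ ⊤ := by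
  obtain ⟨y, hy0, hy⟩ := torus_est (L := L) hC hm hj hΨ
  obtain ⟨κ, k0, k1, hκ⟩ := torus_dens (L := L) hm
  refine ⟨y, fun a v hv x hx => ?_⟩
  set w := pt m (y, true) j
  set s := (Finset.univ : Finset (XX L m)).erase w with hs
  have hEm : MeasurableSet {u : XX L m → ℝ | (fun p => -u p) ∈ Ev m j (4 * C1) y} :=
    (Ev_meas j (4 * C1) y).preimage (f := fun (u : XX L m → ℝ) p => -u p) (by fun_prop)
  have hEs : ∀ (u : XX L m → ℝ) (t : ℝ), (fun p => -(u p + t)) ∈ Ev m j (4 * C1) y ↔ (fun p => -u p) ∈ Ev m j (4 * C1) y := by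
    intro u t
    simp only [Ev, mem_setOf_eq, neg_inj, neg_le_neg_iff, add_left_inj, add_le_add_iff_right]
    refine and_congr (forall_congr' fun p => ?_) Iff.rfl
    constructor <;> intro <;> linarith
  have hmn : ∀ (u : XX L m → ℝ) (t : ℝ), mn (vx fun p => u p + t) = mn (vx u) + t := by
    intro u t
    have hL : (L : ℝ) ≠ 0 := Nat.cast_ne_zero.2 (NeZero.ne L)
    simp only [mn, vx, Finset.sum_add_distrib, Finset.sum_const, nsmul_eq_mul, Finset.card_univ]
    rw [Fintype.card_prod, ZMod.card]; push_cast; field_simp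

  have key : ∀ Φ : (XX L m → ℝ) → ENNReal, Measurable Φ → (∀ u t, Φ (fun p => u p + t) = Φ u) →
      ∫⁻ ω, Φ (fun p => -fld m ω p) ∂PT L m = κ * c0 * (∫⋯∫⁻_s, (fun u => Φ u * wt m u) ∂(fun _ => volume)) x := by
    intro Φ hΦ hΦs
    have := slice w (fun u => Φ u * wt m u) (hΦ.mul wt_meas) (fun u t => by simp only [hΦs, wt, En_shift])
      (fun u => mn (vx u)) (by unfold mn vx; fun_prop) hmn x
    rw [hκ Φ hΦ, mul_assoc, ← this]
    congr 2; ext u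
    rw [wt, mul_assoc, ← ENNReal.ofReal_mul (Real.exp_pos _).le, ← Real.exp_add]
    congr 3; ring
  have hsl : ∀ u : XX L m → ℝ, u w = a + 4 * C1 → ((UU m j (4 * C1) a y).indicator (wt m) u) =
      ({u : XX L m → ℝ | (fun p => -u p) ∈ Ev m j (4 * C1) y}.indicator 1 u) * wt m u := by
    intro u hu
    by_cases h : u ∈ UU m j (4 * C1) a y
    · have h' : u ∈ {u : XX L m → ℝ | (fun p => -u p) ∈ Ev m j (4 * C1) y} := (UU_iff _ _ _ _ u hu).1 h
      rw [indicator_of_mem h, indicator_of_mem h']; simp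
    · have h' : u ∉ {u : XX L m → ℝ | (fun p => -u p) ∈ Ev m j (4 * C1) y} := fun h' => h ((UU_iff _ _ _ _ u hu).2 h')
      rw [indicator_of_notMem h, indicator_of_notMem h']; simp
  have hw : ∀ z : s → ℝ, Function.updateFinset x s z w = a + 4 * C1 := by
    intro z; simp [Function.updateFinset, hs, hx]
  have E1 : (∫⋯∫⁻_s, ((UU m j (4 * C1) a y).indicator (wt m)) ∂(fun _ => volume)) x = (∫⋯∫⁻_s,
      (fun u => ({u : XX L m → ℝ | (fun p => -u p) ∈ Ev m j (4 * C1) y}.indicator 1 u) * wt m u) ∂(fun _ => volume)) x := by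
    unfold lmarginal; exact lintegral_congr fun z => hsl _ (hw z)
  have E2 : (∫⋯∫⁻_s, (fun u => ENNReal.ofReal (u (.inl v) - a) * ((UU m j (4 * C1) a y).indicator (wt m) u)) ∂(fun _ => volume)) x = (∫⋯∫⁻_s,
      (fun u => (({u : XX L m → ℝ | (fun p => -u p) ∈ Ev m j (4 * C1) y}.indicator 1 u) *
        ENNReal.ofReal (u (.inl v) - u w + 4 * C1)) * wt m u) ∂(fun _ => volume)) x := by
    unfold lmarginal
    refine lintegral_congr fun z => ?_
    have h2 : ∀ t : ℝ, t - (a + 4 * C1) + 4 * C1 = t - a := fun t => by ring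
    beta_reduce; rw [hsl _ (hw z), hw z, h2]; ring
  have hI : Measurable ({u : XX L m → ℝ | (fun p => -u p) ∈ Ev m j (4 * C1) y}.indicator (1 : (XX L m → ℝ) → ENNReal)) :=
    measurable_one.indicator hEm
  have hIs : ∀ (u : XX L m → ℝ) (t : ℝ), {u : XX L m → ℝ | (fun p => -u p) ∈ Ev m j (4 * C1) y}.indicator (1 : (XX L m → ℝ) → ENNReal) (fun p => u p + t) =
      {u : XX L m → ℝ | (fun p => -u p) ∈ Ev m j (4 * C1) y}.indicator (1 : (XX L m → ℝ) → ENNReal) u := by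
    intro u t
    simp only [indicator_apply, mem_setOf_eq, hEs]; rfl
  have K1 := key _ hI hIs
  have K2 := key (fun u => ({u : XX L m → ℝ | (fun p => -u p) ∈ Ev m j (4 * C1) y}.indicator 1 u) *
        ENNReal.ofReal (u (.inl v) - u w + 4 * C1)) (hI.mul (by fun_prop)) (fun u t => by
          rw [hIs]; simp only [add_sub_add_right_eq_sub])
  have hfm : MeasurableSet (fld m ⁻¹' Ev m j (4 * C1) y : Set (OT L m)) :=
    (measurable_pi_iff.2 fld_meas) (Ev_meas j (4 * C1) y)
  have P1 : ∫⁻ ω, {u : XX L m → ℝ | (fun p => -u p) ∈ Ev m j (4 * C1) y}.indicator (1 : (XX L m → ℝ) → ENNReal) (fun p => -fld m ω p) ∂PT L m =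
      PT L m (fld m ⁻¹' Ev m j (4 * C1) y) := by
    rw [← lintegral_indicator_one hfm]
    refine lintegral_congr fun ω => ?_
    simp only [indicator_apply, mem_setOf_eq, neg_neg, mem_preimage]; rfl
  have P2 : ∫⁻ ω, ({u : XX L m → ℝ | (fun p => -u p) ∈ Ev m j (4 * C1) y}.indicator (1 : (XX L m → ℝ) → ENNReal) (fun p => -fld m ω p)) *
      ENNReal.ofReal (-fld m ω (.inl v) - -fld m ω w + 4 * C1) ∂PT L m =
      ∫⁻ ω in fld m ⁻¹' Ev m j (4 * C1) y, ENNReal.ofReal (fld m ω w - ω.1 v + 4 * C1) ∂PT L m := by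
    rw [← lintegral_indicator hfm]
    refine lintegral_congr fun ω => ?_
    simp only [indicator_apply, mem_setOf_eq, neg_neg, mem_preimage]
    have : -fld m ω (.inl v) - -fld m ω w + 4 * C1 = fld m ω w - ω.1 v + 4 * C1 := by simp only [fld]; ring
    rw [this]
    change (if fld m ω ∈ _ then _ else _) * _ = _
    split_ifs <;> simp
  rw [P1] at K1
  rw [P2] at K2
  have kk0 : κ * c0 ≠ 0 := mul_ne_zero k0 c0_zero
  have kk1 : κ * c0 ≠ ⊤ := ENNReal.mul_ne_top k1 c0_top
  rw [E1, E2]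
  refine ⟨?_, ?_, ?_⟩
  · have := hy v hv
    rw [K1, K2, mul_left_comm] at this
    exact (ENNReal.mul_le_mul_iff_right kk0 kk1).1 this
  · intro h0; rw [h0, mul_zero] at K1; exact hy0 K1
  · intro h0; rw [h0, ENNReal.mul_top kk0] at K1; exact measure_ne_top _ _ K1
end tdens

theorem sq_submod (a b c d : ℝ) : (max a c - max b d) ^ 2 + (min a c - min b d) ^ 2 ≤ (a - b) ^ 2 + (c - d) ^ 2 := by
  rcases le_total a c with h | h <;> rcases le_total b d with h' | h' <;> simp only [h, h', max_eq_left, max_eq_right, min_eq_left, min_eq_right] <;> nlinarith [mul_nonneg (sub_nonneg.2 h) (sub_nonneg.2 h')]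

section core
variable {L : ℕ} [NeZero L] {m : ℕ}

theorem En_submod (x z : XX L m → ℝ) : En m (x ⊔ z) + En m (x ⊓ z) ≤ En m x + En m z := by
  unfold En
  rw [← Finset.sum_add_distrib, ← Finset.sum_add_distrib]
  refine Finset.sum_le_sum fun e _ => ?_
  have h1 := sq_submod (x (.inl e.1)) (x (.inl (e.1 + ed e.2))) (z (.inl e.1)) (z (.inl (e.1 + ed e.2)))
  have h2 : ∑ j ∈ Finset.range m, ((x ⊔ z) (pt m e (j + 1)) - (x ⊔ z) (pt m e j)) ^ 2 +
      ∑ j ∈ Finset.range m, ((x ⊓ z) (pt m e (j + 1)) - (x ⊓ z) (pt m e j)) ^ 2 ≤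
      ∑ j ∈ Finset.range m, (x (pt m e (j + 1)) - x (pt m e j)) ^ 2 +
      ∑ j ∈ Finset.range m, (z (pt m e (j + 1)) - z (pt m e j)) ^ 2 := by
    rw [← Finset.sum_add_distrib, ← Finset.sum_add_distrib]
    exact Finset.sum_le_sum fun j _ => sq_submod _ _ _ _
  have h3 := mul_le_mul_of_nonneg_left h2 (by positivity : (0:ℝ) ≤ m / 8)
  simp only [Pi.sup_apply, Pi.inf_apply] at *
  linarith

theorem wt_submod (x z : XX L m → ℝ) : wt m x * wt m z ≤ wt m (x ⊔ z) * wt m (x ⊓ z) := by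
  unfold wt
  rw [← ENNReal.ofReal_mul (Real.exp_pos _).le, ← ENNReal.ofReal_mul (Real.exp_pos _).le, ← Real.exp_add, ← Real.exp_add]
  refine ENNReal.ofReal_le_ofReal (Real.exp_le_exp.2 ?_)
  have := En_submod x z
  linarith

def HH (a : ℝ) (Ip Im : Finset (XX L m)) : Set (XX L m → ℝ) := {u | (∀ p ∈ Ip, a < u p) ∧ ∀ p ∈ Im, u p < -a}

theorem HH_meas (a : ℝ) (Ip Im : Finset (XX L m)) : MeasurableSet (HH a Ip Im) := by
  unfold HH
  simp only [setOf_and, setOf_forall]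
  exact (MeasurableSet.iInter fun p => MeasurableSet.iInter fun _ => measurableSet_lt (by fun_prop) (by fun_prop)).inter
    (MeasurableSet.iInter fun p => MeasurableSet.iInter fun _ => measurableSet_lt (by fun_prop) (by fun_prop))

theorem UU_up {j : ℕ} {h a : ℝ} {y : Tor L} {u u' : XX L m → ℝ} (hu : u ∈ UU m j h a y) (hle : u ≤ u') :
    u' ∈ UU m j h a y := by
  refine ⟨fun p => (hu.1 p).trans_le (hle p), fun y' => ⟨(hu.2 y').1.trans (hle _), fun e => (hu.2 y').2 ?_⟩⟩
  exact le_antisymm (e ▸ hle _) (hu.2 y').1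

theorem inner_ff {C : ENNReal} {j : ℕ} {h a : ℝ} {y v : Tor L} (Ip Im : Finset (XX L m)) (s : Finset (XX L m))
    (hw : pt m (y, true) j ∉ s)
    (hJ : ∀ x : XX L m → ℝ, x (pt m (y, true) j) = a + h →
      (∫⋯∫⁻_(Finset.univ.erase (pt m (y, true) j)), (fun u => ENNReal.ofReal (u (.inl v) - a) *
        ((UU m j h a y).indicator (wt m) u)) ∂(fun _ => volume)) x ≤
      C * (∫⋯∫⁻_(Finset.univ.erase (pt m (y, true) j)), ((UU m j h a y).indicator (wt m)) ∂(fun _ => volume)) x ∧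
      (∫⋯∫⁻_(Finset.univ.erase (pt m (y, true) j)), ((UU m j h a y).indicator (wt m)) ∂(fun _ => volume)) x ≠ 0 ∧
      (∫⋯∫⁻_(Finset.univ.erase (pt m (y, true) j)), ((UU m j h a y).indicator (wt m)) ∂(fun _ => volume)) x ≠ ⊤)
    (x : XX L m → ℝ) (hx : ∀ p ∉ s, x p ≤ a) :
    (∫⋯∫⁻_s, (fun u => ENNReal.ofReal (u (.inl v) - a) * (HH a Ip Im).indicator (wt m) u) ∂(fun _ => volume)) x ≤
    C * (∫⋯∫⁻_s, ((HH a Ip Im).indicator (wt m)) ∂(fun _ => volume)) x := by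
  set w := pt m (y, true) j
  have mU : Measurable ((UU m j h a y).indicator (wt m)) := wt_meas.indicator (UU_meas j h a y)
  have mH : Measurable ((HH a Ip Im).indicator (wt m)) := wt_meas.indicator (HH_meas a Ip Im)
  have mg : Measurable fun u : XX L m → ℝ => ENNReal.ofReal (u (.inl v) - a) := by fun_prop
  have ff := ff_marg (fun u => ENNReal.ofReal (u (.inl v) - a) * (HH a Ip Im).indicator (wt m) u)
    ((UU m j h a y).indicator (wt m)) (fun u => ENNReal.ofReal (u (.inl v) - a) * (UU m j h a y).indicator (wt m) u)
    ((HH a Ip Im).indicator (wt m)) (mg.mul mH) mU (mg.mul mU) mH (by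
      intro x z
      by_cases h1 : x ∈ HH a Ip Im
      · by_cases h2 : z ∈ UU m j h a y
        · have h3 : x ⊔ z ∈ UU m j h a y := UU_up h2 le_sup_right
          have h4 : x ⊓ z ∈ HH a Ip Im := ⟨fun p hp => lt_min (h1.1 p hp) (h2.1 p), fun p hp => (min_le_left _ _).trans_lt (h1.2 p hp)⟩
          rw [indicator_of_mem h1, indicator_of_mem h2, indicator_of_mem h3, indicator_of_mem h4, mul_assoc, mul_assoc]
          refine mul_le_mul' (ENNReal.ofReal_le_ofReal (sub_le_sub_right (le_max_left _ _) _)) (wt_submod x z)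
        · simp [indicator_of_notMem h2]
      · simp [indicator_of_notMem h1]) s
  set A := (∫⋯∫⁻_s, (fun u => ENNReal.ofReal (u (.inl v) - a) * (HH a Ip Im).indicator (wt m) u) ∂(fun _ => volume)) x
  set D := (∫⋯∫⁻_s, ((HH a Ip Im).indicator (wt m)) ∂(fun _ => volume)) x
  have h1 : ∀ z : XX L m → ℝ, A * (∫⋯∫⁻_s, ((UU m j h a y).indicator (wt m)) ∂(fun _ => volume)) z ≤
      (∫⋯∫⁻_s, (fun u => ENNReal.ofReal (u (.inl v) - a) * (UU m j h a y).indicator (wt m) u) ∂(fun _ => volume)) z * D := by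
    intro z
    by_cases hz : ∀ p ∉ s, x p ≤ z p
    · refine (ff x z).trans (le_of_eq ?_)
      congr 1
      · exact lmarginal_congr _ _ fun p hp => max_eq_right (hz p hp)
      · exact lmarginal_congr _ _ fun p hp => min_eq_left (hz p hp)
    · push Not at hz
      obtain ⟨p, hp, hlt⟩ := hz
      have : (∫⋯∫⁻_s, ((UU m j h a y).indicator (wt m)) ∂(fun _ => volume)) z = 0 := by
        unfold lmarginal
        refine (lintegral_congr fun q => ?_).trans lintegral_zero
        refine indicator_of_notMem (fun hU => ?_) _
        have h5 := hU.1 p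
        simp only [Function.updateFinset, hp, dite_false] at h5
        linarith [hx p hp]
      rw [this, mul_zero]; exact zero_le
  set t := (Finset.univ.erase w) \ s with ht
  have hts : Disjoint t s := Finset.sdiff_disjoint
  have hst : t ∪ s = Finset.univ.erase w := Finset.sdiff_union_of_subset (Finset.subset_erase.2 ⟨Finset.subset_univ s, hw⟩)
  let X0 : XX L m → ℝ := fun _ => a + h
  obtain ⟨J1, J2, J3⟩ := hJ X0 rfl
  have hA : A * (∫⋯∫⁻_(Finset.univ.erase w), ((UU m j h a y).indicator (wt m)) ∂(fun _ => volume)) X0 ≤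
      (∫⋯∫⁻_(Finset.univ.erase w), (fun u => ENNReal.ofReal (u (.inl v) - a) * (UU m j h a y).indicator (wt m) u) ∂(fun _ => volume)) X0 * D := by
    rw [← hst, lmarginal_union _ _ mU hts, lmarginal_union _ (fun u => ENNReal.ofReal (u (.inl v) - a) * (UU m j h a y).indicator (wt m) u) (mg.mul mU) hts]
    unfold lmarginal at h1 ⊢
    have m1 : Measurable fun z : XX L m → ℝ => (∫⋯∫⁻_s, ((UU m j h a y).indicator (wt m)) ∂(fun _ => volume)) z := mU.lmarginal _
    have m2 : Measurable fun z : XX L m → ℝ => (∫⋯∫⁻_s, (fun u => ENNReal.ofReal (u (.inl v) - a) * (UU m j h a y).indicator (wt m) u) ∂(fun _ => volume)) z := (mg.mul mU).lmarginal _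
    have m1' := m1.comp (measurable_updateFinset (x := X0) (s := t))
    have m2' := m2.comp (measurable_updateFinset (x := X0) (s := t))
    unfold lmarginal at m1' m2'
    refine (lintegral_const_mul A m1').symm.trans_le (le_trans ?_ (lintegral_mul_const D m2').le)
    exact lintegral_mono fun q => h1 _
  have h2 := hA.trans (mul_le_mul_left J1 D)
  rw [mul_comm C, mul_assoc, mul_comm A] at h2
  exact (ENNReal.mul_le_mul_iff_right J2 J3).1 h2

theorem core {C : ENNReal} {j : ℕ} {h a : ℝ} {y v : Tor L} (ha : 0 ≤ a) (Ip Im Bs : Finset (XX L m)) (Y : Finset (XX L m))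
    (hw : pt m (y, true) j ∈ Bs)
    (hJ : ∀ x : XX L m → ℝ, x (pt m (y, true) j) = a + h →
      (∫⋯∫⁻_(Finset.univ.erase (pt m (y, true) j)), (fun u => ENNReal.ofReal (u (.inl v) - a) *
        ((UU m j h a y).indicator (wt m) u)) ∂(fun _ => volume)) x ≤
      C * (∫⋯∫⁻_(Finset.univ.erase (pt m (y, true) j)), ((UU m j h a y).indicator (wt m)) ∂(fun _ => volume)) x ∧
      (∫⋯∫⁻_(Finset.univ.erase (pt m (y, true) j)), ((UU m j h a y).indicator (wt m)) ∂(fun _ => volume)) x ≠ 0 ∧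
      (∫⋯∫⁻_(Finset.univ.erase (pt m (y, true) j)), ((UU m j h a y).indicator (wt m)) ∂(fun _ => volume)) x ≠ ⊤)
    {ν : Measure (XX L m → ℝ)} {κ : ENNReal}
    (hν : ∀ F : (XX L m → ℝ) → ENNReal, Measurable F → ∫⁻ b, F (sh m 1 b) ∂ν = κ * (∫⋯∫⁻_Y, (fun u => F u *
      ENNReal.ofReal (Real.exp (-(En m u + 0 * mn (vx u) ^ 2) / 2))) ∂(fun _ => volume)) 0)
    (A : Set (XX L m → ℝ)) (mA : MeasurableSet A) (hA1 : ∀ u u', (∀ p ∈ Bs, u p = u' p) → u ∈ A → u' ∈ A)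
    (hA2 : ∀ u ∈ A, ∀ p ∈ Bs, u p ≤ a) :
    ∫⁻ b, (A ∩ HH a Ip Im).indicator (fun u => ENNReal.ofReal (u (.inl v) - a)) (sh m 1 b) ∂ν ≤
    C * ∫⁻ b, (A ∩ HH a Ip Im).indicator (fun _ => 1) (sh m 1 b) ∂ν := by
  have mAH := mA.inter (HH_meas a Ip Im)
  have mg : Measurable fun u : XX L m → ℝ => ENNReal.ofReal (u (.inl v) - a) := by fun_prop
  rw [hν _ (mg.indicator mAH), hν _ (measurable_const.indicator mAH), mul_left_comm]
  refine mul_le_mul_right ?_ κ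
  set s := Y \ Bs with hs
  have hts : Disjoint (Y ∩ Bs) s := by rw [Finset.disjoint_left]; intro p hp hp'; simp [hs] at hp hp'; tauto
  have hY : Y = (Y ∩ Bs) ∪ s := by ext p; simp [hs]; tauto
  have mH : Measurable ((HH a Ip Im).indicator (wt m)) := wt_meas.indicator (HH_meas a Ip Im)
  have mI : Measurable (A.indicator (fun _ => (1 : ENNReal))) := measurable_const.indicator mA
  have e1 : (fun u => (A ∩ HH a Ip Im).indicator (fun u => ENNReal.ofReal (u (.inl v) - a)) u *
      ENNReal.ofReal (Real.exp (-(En m u + 0 * mn (vx u) ^ 2) / 2))) = fun u => A.indicator (fun _ => 1) u *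
      (ENNReal.ofReal (u (.inl v) - a) * (HH a Ip Im).indicator (wt m) u) := by
    ext u
    by_cases h1 : u ∈ A <;> by_cases h2 : u ∈ HH a Ip Im <;> simp [h1, h2, wt]
  have e2 : (fun u => (A ∩ HH a Ip Im).indicator (fun _ => (1 : ENNReal)) u *
      ENNReal.ofReal (Real.exp (-(En m u + 0 * mn (vx u) ^ 2) / 2))) = fun u => A.indicator (fun _ => 1) u *
      ((HH a Ip Im).indicator (wt m) u) := by
    ext u
    by_cases h1 : u ∈ A <;> by_cases h2 : u ∈ HH a Ip Im <;> simp [h1, h2, wt]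
  have pull : ∀ (f : (XX L m → ℝ) → ENNReal), Measurable f → ∀ x, (∫⋯∫⁻_s, (fun u => A.indicator (fun _ => 1) u * f u) ∂(fun _ => volume)) x =
      A.indicator (fun _ => 1) x * (∫⋯∫⁻_s, f ∂(fun _ => volume)) x := by
    intro f hf x
    unfold lmarginal
    refine Eq.trans ?_ (lintegral_const_mul _ (hf.comp (measurable_updateFinset (x := x) (s := s))))
    refine lintegral_congr fun q => ?_
    simp only [Function.comp]
    have hq : ∀ p ∈ Bs, x p = Function.updateFinset x s q p := fun p hp => by simp [Function.updateFinset, hs, hp]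
    by_cases h1 : x ∈ A
    · rw [indicator_of_mem h1, indicator_of_mem (hA1 _ _ hq h1)]
    · rw [indicator_of_notMem h1, indicator_of_notMem fun h2 => h1 (hA1 _ _ (fun p hp => (hq p hp).symm) h2)]
  rw [e1, e2, hY, lmarginal_union _ (fun u => A.indicator (fun _ => 1) u * (ENNReal.ofReal (u (.inl v) - a) * (HH a Ip Im).indicator (wt m) u)) (mI.mul (mg.mul mH)) hts, lmarginal_union _ (fun u => A.indicator (fun _ => 1) u * (HH a Ip Im).indicator (wt m) u) (mI.mul mH) hts]
  rw [lmarginal, lmarginal]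
  have m0 := ((mI.mul mH).lmarginal (fun _ => volume) (s := s)).comp (measurable_updateFinset (x := (0 : XX L m → ℝ)) (s := Y ∩ Bs))
  refine le_trans ?_ (lintegral_const_mul C m0).le
  refine lintegral_mono fun q => ?_
  set x := Function.updateFinset (0 : XX L m → ℝ) (Y ∩ Bs) q with hxd
  change (∫⋯∫⁻_s, (fun u => A.indicator (fun _ => 1) u * (ENNReal.ofReal (u (.inl v) - a) * (HH a Ip Im).indicator (wt m) u)) ∂(fun _ => volume)) x ≤
    C * (∫⋯∫⁻_s, (fun u => A.indicator (fun _ => 1) u * (HH a Ip Im).indicator (wt m) u) ∂(fun _ => volume)) x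
  rw [pull (fun u => ENNReal.ofReal (u (.inl v) - a) * (HH a Ip Im).indicator (wt m) u) (mg.mul mH), pull _ mH]
  by_cases h1 : x ∈ A
  · rw [indicator_of_mem h1, one_mul, one_mul]
    refine inner_ff Ip Im s (by simp [hs, hw]) hJ x fun p hp => ?_
    by_cases hB : p ∈ Bs
    · exact hA2 x h1 p hB
    · have : p ∉ Y ∩ Bs := fun h => hB (Finset.mem_inter.1 h).2
      simp only [hxd, Function.updateFinset, this, dite_false]; exact ha
  · simp [indicator_of_notMem h1]
end core

theorem nbrs_sum (u : ℤ × ℤ) (f : ℤ × ℤ → ℝ) : ∑ w ∈ nbrs u, f w =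
    f (u.1 + 1, u.2) + f (u.1 - 1, u.2) + f (u.1, u.2 + 1) + f (u.1, u.2 - 1) := by
  unfold nbrs
  rw [Finset.sum_insert, Finset.sum_insert, Finset.sum_insert, Finset.sum_singleton]
  · ring
  all_goals simp [Prod.ext_iff]
  all_goals omega

theorem ks_nonneg (K : Set (ℤ × ℤ)) (n : ℕ) : ∀ u v, 0 ≤ killedStep K n u v := by
  induction n with
  | zero => intro u v; unfold killedStep; split_ifs <;> norm_num
  | succ n ih => intro u v; unfold killedStep; split_ifs
                 · norm_num
                 · exact mul_nonneg (by norm_num) (Finset.sum_nonneg fun w _ => ih w v)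

theorem nbr_box {N : ℕ} {u : ℤ × ℤ} (hu : u ∈ box N) (hb : u ∉ bdry N) : ∀ w ∈ nbrs u, w ∈ box N := by
  intro w hw
  by_contra h
  exact hb (Finset.mem_filter.2 ⟨hu, w, hw, h⟩)

theorem ks_bound (N : ℕ) (v : ℤ × ℤ) (k : ℕ) : ∀ u ∈ box N,
    ∑ n ∈ Finset.range k, killedStep (↑(bdry N)) n u v ≤ 2 * (N : ℝ) ^ 2 - (u.1 : ℝ) ^ 2 - (u.2 : ℝ) ^ 2 := by
  have pos : ∀ u ∈ box N, (0 : ℝ) ≤ 2 * (N : ℝ) ^ 2 - (u.1 : ℝ) ^ 2 - (u.2 : ℝ) ^ 2 := by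
    intro u hu
    simp only [box, Finset.mem_product, Finset.mem_Icc] at hu
    obtain ⟨⟨h1, h2⟩, h3, h4⟩ := hu
    have e1 : u.1 ^ 2 ≤ (N : ℤ) ^ 2 := sq_le_sq' (by omega) (by omega)
    have e2 : u.2 ^ 2 ≤ (N : ℤ) ^ 2 := sq_le_sq' (by omega) (by omega)
    have e1' : (u.1 : ℝ) ^ 2 ≤ (N : ℝ) ^ 2 := by exact_mod_cast e1
    have e2' : (u.2 : ℝ) ^ 2 ≤ (N : ℝ) ^ 2 := by exact_mod_cast e2
    linarith
  induction k with
  | zero => simpa using pos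
  | succ k ih =>
    intro u hu
    by_cases hb : u ∈ bdry N
    · rw [Finset.sum_eq_zero]
      · exact pos u hu
      · intro n _
        cases n <;> simp [killedStep, hb]
    · rw [Finset.sum_range_succ']
      have h0 : killedStep (↑(bdry N)) 0 u v ≤ 1 := by unfold killedStep; split_ifs <;> norm_num
      have h1 : ∀ n, killedStep (↑(bdry N)) (n + 1) u v = 1 / 4 * ∑ w ∈ nbrs u, killedStep (↑(bdry N)) n w v := by
        intro n; simp [killedStep, hb]
      simp only [h1]
      rw [← Finset.mul_sum, Finset.sum_comm]
      have h2 := Finset.sum_le_sum fun w hw => ih w (nbr_box hu hb w hw)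
      rw [nbrs_sum u fun w => 2 * (N : ℝ) ^ 2 - (w.1 : ℝ) ^ 2 - (w.2 : ℝ) ^ 2] at h2
      push_cast at h2
      nlinarith

theorem ks_summable (N : ℕ) (u v : ℤ × ℤ) (hu : u ∈ box N) :
    Summable fun n => killedStep (↑(bdry N)) n u v :=
  summable_of_sum_range_le (fun n => ks_nonneg _ n u v) fun k => ks_bound N v k u hu

theorem green_bd {N : ℕ} {u : ℤ × ℤ} (v : ℤ × ℤ) (hu : u ∈ bdry N) : green N u v = 0 := by
  unfold green greenK
  rw [show (fun n => killedStep (↑(bdry N)) n u v) = fun _ => 0 from ?_, tsum_zero]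
  funext n
  cases n <;> simp [killedStep, hu]

theorem green_rec {N : ℕ} {u : ℤ × ℤ} (v : ℤ × ℤ) (hu : u ∈ box N) (hb : u ∉ bdry N) :
    green N u v = (if u = v then 1 else 0) + 1 / 4 * ∑ w ∈ nbrs u, green N w v := by
  unfold green greenK
  rw [(ks_summable N u v hu).tsum_eq_zero_add]
  congr 1
  · simp [killedStep, hb]
  · have h1 : ∀ n, killedStep (↑(bdry N)) (n + 1) u v = 1 / 4 * ∑ w ∈ nbrs u, killedStep (↑(bdry N)) n w v := by
      intro n; simp [killedStep, hb]
    simp only [h1]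
    rw [tsum_mul_left, Summable.tsum_finsetSum]
    exact fun w hw => ks_summable N w v (nbr_box hu hb w hw)

theorem gaussFam_isG {Ω J : Type} [MeasurableSpace Ω] {P : Measure Ω} {f : J → Ω → ℝ} {K : J → J → ℝ} {S : Set J}
    (h : IsGaussFam P f K S) {X : Type} [Fintype X] [DecidableEq X] (T : Finset X) (g : X → J) (hg : Set.InjOn g T)
    (hS : ∀ i ∈ T, g i ∈ S) : IsG (P.map fun ω i => if i ∈ T then f (g i) ω else 0)
      fun c => ∑ i, ∑ j, c i * c j * (if i ∈ T ∧ j ∈ T then K (g i) (g j) else 0) := by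
  intro c
  have mf := h.1
  rw [Measure.map_map (by fun_prop) (measurable_pi_lambda _ fun i => by split_ifs <;> fun_prop)]
  let l : J →₀ ℝ := Finsupp.onFinset (T.image g) (fun k => ∑ i ∈ T with g i = k, c i) (by
    intro k hk
    obtain ⟨i, hi, -⟩ := Finset.exists_ne_zero_of_sum_ne_zero hk
    rw [Finset.mem_filter] at hi
    exact Finset.mem_image.2 ⟨i, hi⟩)
  have hl : ∀ i ∈ T, l (g i) = c i := by
    intro i hi
    change ∑ i' ∈ T with g i' = g i, c i' = c i
    rw [show T.filter (fun i' => g i' = g i) = {i} from ?_, Finset.sum_singleton]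
    ext i'
    simp only [Finset.mem_filter, Finset.mem_singleton]
    exact ⟨fun ⟨a, b⟩ => hg a hi b, by rintro rfl; exact ⟨hi, rfl⟩⟩
  have hsub : l.support ⊆ T.image g := Finsupp.support_onFinset_subset
  have key : ∀ F : J → ℝ, ∑ k ∈ l.support, l k * F k = ∑ i ∈ T, c i * F (g i) := by
    intro F
    rw [Finset.sum_subset hsub fun k _ hk => by rw [Finsupp.notMem_support_iff.1 hk, zero_mul],
      Finset.sum_image hg]
    exact Finset.sum_congr rfl fun i hi => by rw [hl i hi]
  have := h.2 l (fun k hk => by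
    obtain ⟨i, hi, rfl⟩ := Finset.mem_image.1 (hsub hk); exact hS i hi)
  have e1 : (fun ω => ∑ i ∈ l.support, l i * f i ω) =
      (fun x : X → ℝ => ∑ i, c i * x i) ∘ fun ω i => if i ∈ T then f (g i) ω else 0 := by
    funext ω
    rw [key fun k => f k ω]
    simp [Finset.sum_ite_mem, mul_ite]
  rw [← e1, this]
  congr 2
  simp only [mul_assoc, ← Finset.mul_sum]
  rw [key fun k => ∑ j ∈ l.support, l j * K k j]
  simp only [key, mul_ite, mul_zero, ite_and, Finset.sum_ite_mem, Finset.univ_inter]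
  have : ∀ i : X, (∑ x, c i * if i ∈ T then (if x ∈ T then c x * K (g i) (g x) else 0) else 0) =
    if i ∈ T then c i * ∑ x ∈ T, c x * K (g i) (g x) else 0 := by
    intro i; split_ifs
    · simp [Finset.sum_ite_mem, Finset.mul_sum]
    · simp
  simp [this, Finset.sum_ite_mem, Finset.mul_sum, mul_ite]

structure Emb (N L : ℕ) (M : ℤ × ℤ → Tor L) (ρ : Bool → ℤ × ℤ) : Prop where
  step : ∀ x d, M (x + ρ d) = M x + ed d
  inj : ∀ x x' : ℤ × ℤ, |x.1 - x'.1| ≤ N → |x.2 - x'.2| ≤ N → M x = M x' → x = x'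
  nb : ∀ (u : ℤ × ℤ) (f : ℤ × ℤ → ℝ), ∑ w ∈ nbrs u, f w = ∑ d, (f (u + ρ d) + f (u - ρ d))
  nbm : ∀ (u : ℤ × ℤ) d, u + ρ d ∈ nbrs u ∧ u - ρ d ∈ nbrs u
  adjr : ∀ u v, adj u v → ∃ d, v = u + ρ d ∨ u = v + ρ d
  radj : ∀ u d, adj u (u + ρ d)
  le1 : ∀ d, |(ρ d).1| ≤ 1 ∧ |(ρ d).2| ≤ 1

theorem emb_exists {N L : ℕ} (hL : N + 2 ≤ L) (p q : ℤ × ℤ) (h : adj p q) (y : Tor L) :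
    ∃ M ρ, Emb N L M ρ ∧ M p = y ∧ M q = y + ed true := by
  obtain ⟨s, t, hq, hst⟩ : ∃ s t : ℤ, q = p + (s, t) ∧
      ((s = 1 ∧ t = 0) ∨ (s = -1 ∧ t = 0) ∨ (s = 0 ∧ t = 1) ∨ (s = 0 ∧ t = -1)) := by
    refine ⟨q.1 - p.1, q.2 - p.2, by ext <;> simp, ?_⟩
    unfold adj at h
    have := abs_le.1 (show |p.1 - q.1| ≤ 1 by have := abs_nonneg (p.2 - q.2); omega)
    have := abs_le.1 (show |p.2 - q.2| ≤ 1 by have := abs_nonneg (p.1 - q.1); omega)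
    rcases abs_cases (p.1 - q.1) with h1 | h1 <;> rcases abs_cases (p.2 - q.2) with h2 | h2 <;> omega
  let M : ℤ × ℤ → Tor L := fun x => (y.1 + ((s * (x.1 - p.1) + t * (x.2 - p.2) : ℤ) : ZMod L),
    y.2 + ((-t * (x.1 - p.1) + s * (x.2 - p.2) : ℤ) : ZMod L))
  let ρ : Bool → ℤ × ℤ := fun d => if d then (s, t) else (-t, s)
  have hstep : ∀ x d, M (x + ρ d) = M x + ed d := by
    intro x d
    rcases hst with ⟨rfl, rfl⟩ | ⟨rfl, rfl⟩ | ⟨rfl, rfl⟩ | ⟨rfl, rfl⟩ <;> cases d <;>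
      ext <;> simp [M, ρ, ed] <;> ring
  have hp : M p = y := by simp [M]
  refine ⟨M, ρ, ⟨hstep, ?_, ?_, ?_, ?_, ?_, ?_⟩, hp, ?_⟩
  · intro x x' h1 h2 hM
    have e1 := congrArg Prod.fst hM
    have e2 := congrArg Prod.snd hM
    simp only [M, add_right_inj] at e1 e2
    rw [ZMod.intCast_eq_intCast_iff_dvd_sub] at e1 e2
    rw [abs_le] at h1 h2
    have z : ∀ w : ℤ, (L : ℤ) ∣ w → -(N : ℤ) ≤ w → w ≤ N → w = 0 := fun w a b c =>
      Int.eq_zero_of_abs_lt_dvd a (by rw [abs_lt]; omega)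
    rcases hst with ⟨rfl, rfl⟩ | ⟨rfl, rfl⟩ | ⟨rfl, rfl⟩ | ⟨rfl, rfl⟩ <;>
      (have := z _ e1 (by linarith) (by linarith)
       have := z _ e2 (by linarith) (by linarith)
       ext <;> linarith)
  · intro u f
    rw [nbrs_sum, Fintype.sum_bool]
    rcases hst with ⟨rfl, rfl⟩ | ⟨rfl, rfl⟩ | ⟨rfl, rfl⟩ | ⟨rfl, rfl⟩ <;>
      simp [ρ, Prod.add_def, Prod.sub_def, ← sub_eq_add_neg] <;> ring
  · intro u d
    rcases hst with ⟨rfl, rfl⟩ | ⟨rfl, rfl⟩ | ⟨rfl, rfl⟩ | ⟨rfl, rfl⟩ <;> cases d <;>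
      simp [ρ, nbrs, Prod.add_def, Prod.sub_def, ← sub_eq_add_neg]
  · intro u v huv
    unfold adj at huv
    have := abs_le.1 (show |u.1 - v.1| ≤ 1 by have := abs_nonneg (u.2 - v.2); omega)
    have := abs_le.1 (show |u.2 - v.2| ≤ 1 by have := abs_nonneg (u.1 - v.1); omega)
    rw [Bool.exists_bool]
    simp only [ρ, Prod.ext_iff, Prod.fst_add, Prod.snd_add, if_true, Bool.false_eq_true, if_false]
    rcases abs_cases (u.1 - v.1) with h1 | h1 <;> rcases abs_cases (u.2 - v.2) with h2 | h2 <;> omega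
  · intro u d
    rcases hst with ⟨rfl, rfl⟩ | ⟨rfl, rfl⟩ | ⟨rfl, rfl⟩ | ⟨rfl, rfl⟩ <;> cases d <;> simp [ρ, adj]
  · intro d
    rcases hst with ⟨rfl, rfl⟩ | ⟨rfl, rfl⟩ | ⟨rfl, rfl⟩ | ⟨rfl, rfl⟩ <;> cases d <;> simp [ρ]
  · rw [← hp, ← hstep, hq]; simp [ρ]

section emb
variable {L : ℕ} [NeZero L] {N : ℕ} {M : ℤ × ℤ → Tor L} {ρ : Bool → ℤ × ℤ}

theorem box_diff {N : ℕ} {u v : ℤ × ℤ} (hu : u ∈ box N) (hv : v ∈ box N) :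
    |u.1 - v.1| ≤ N - 1 ∧ |u.2 - v.2| ≤ N - 1 := by
  simp only [box, Finset.mem_product, Finset.mem_Icc] at hu hv
  rw [abs_le, abs_le]; omega

theorem Emb.injOn (E : Emb N L M ρ) : Set.InjOn M (box N) := by
  intro u hu v hv h
  have := box_diff hu hv
  exact E.inj u v (by omega) (by omega) h

theorem Emb.edge (E : Emb N L M ρ) {u v : ℤ × ℤ} (hu : u ∈ box N) (hv : v ∈ box N) {d : Bool}
    (h : M v = M u + ed d) : v = u + ρ d := by
  have h1 := box_diff hv hu
  have h2 := E.le1 d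
  rw [← E.step] at h
  refine E.inj _ _ ?_ ?_ h <;> simp only [Prod.fst_add, Prod.snd_add] <;> rw [abs_le] at * <;>
    simp only [abs_le] at * <;> omega

def iv (N : ℕ) (M : ℤ × ℤ → Tor L) : Tor L → ℤ × ℤ := Function.invFunOn M (box N)
def MB (N : ℕ) (M : ℤ × ℤ → Tor L) : Finset (Tor L) := (box N).image M

theorem Emb.ivM (E : Emb N L M ρ) {u : ℤ × ℤ} (hu : u ∈ box N) : iv N M (M u) = u :=
  E.injOn.leftInvOn_invFunOn hu

theorem iv_box {y : Tor L} (hy : y ∈ MB N M) : iv N M y ∈ box N ∧ M (iv N M y) = y := by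
  have h : ∃ a ∈ (box N : Set (ℤ × ℤ)), M a = y := by simpa [MB] using hy
  exact ⟨Function.invFunOn_mem h, Function.invFunOn_eq h⟩

def TT (N m : ℕ) (M : ℤ × ℤ → Tor L) : Finset (XX L m) := Finset.univ.filter fun i =>
  match i with
  | .inl y => y ∈ MB N M
  | .inr (x, d, _) => x ∈ MB N M ∧ x + ed d ∈ MB N M

def gg (N m : ℕ) (M : ℤ × ℤ → Tor L) : XX L m → M2Idx
  | .inl y => .inl (iv N M y)
  | .inr (x, d, k) => .inr (iv N M x, iv N M (x + ed d), true, 4 * ((k : ℕ) + 1 : ℕ) / (m : ℝ))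

def SS (N : ℕ) (M : ℤ × ℤ → Tor L) : Finset (Tor L) := (box N \ bdry N).image M
def EE (N : ℕ) (M : ℤ × ℤ → Tor L) : Finset (Tor L × Bool) :=
  Finset.univ.filter fun e => e.1 ∈ MB N M ∧ e.1 + ed e.2 ∈ MB N M

def KV (N : ℕ) (M : ℤ × ℤ → Tor L) (a : Tor L → ℝ) (x : Tor L) : ℝ :=
  if x ∈ SS N M then 1 / 4 * ∑ y ∈ MB N M, green N (iv N M x) (iv N M y) * a y else 0

theorem Emb.kvM (E : Emb N L M ρ) (a : Tor L → ℝ) {u : ℤ × ℤ} (hu : u ∈ box N) :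
    KV N M a (M u) = 1 / 4 * ∑ y ∈ MB N M, green N u (iv N M y) * a y := by
  unfold KV
  rw [E.ivM hu]
  split_ifs with h
  · rfl
  · have : u ∈ bdry N := by
      by_contra hb
      exact h (Finset.mem_image_of_mem _ (Finset.mem_sdiff.2 ⟨hu, hb⟩))
    simp [green_bd _ this]

theorem Emb.lap (E : Emb N L M ρ) (a : Tor L → ℝ) {u : ℤ × ℤ} (hu : u ∈ box N) (hb : u ∉ bdry N) :
    Lap (KV N M a) (M u) = a (M u) := by
  have hn := nbr_box hu hb
  have e2 : ∀ d, M u - ed d = M (u - ρ d) := by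
    intro d; rw [sub_eq_iff_eq_add, ← E.step, sub_add_cancel]
  unfold Lap
  simp only [← E.step, e2]
  simp only [E.kvM a hu, E.kvM a (hn _ (E.nbm u _).1), E.kvM a (hn _ (E.nbm u _).2)]
  have r : ∀ y, green N u (iv N M y) = (if u = iv N M y then 1 else 0) + 1 / 4 * ∑ d,
      (green N (u + ρ d) (iv N M y) + green N (u - ρ d) (iv N M y)) := by
    intro y; rw [green_rec _ hu hb, E.nb u fun w => green N w (iv N M y)]
  have : a (M u) = ∑ y ∈ MB N M, (if u = iv N M y then 1 else 0) * a y := by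
    rw [Finset.sum_eq_single (M u)]
    · simp [E.ivM hu]
    · intro y hy hne
      rw [if_neg, zero_mul]
      rintro rfl; exact hne (iv_box hy).2.symm
    · intro h; exact absurd (Finset.mem_image_of_mem _ hu) h
  rw [this]
  simp only [Fintype.sum_bool, Finset.mul_sum, ← Finset.sum_sub_distrib, ← Finset.sum_add_distrib]
  refine Finset.sum_congr rfl fun y _ => ?_
  have := r y
  rw [Fintype.sum_bool] at this
  linear_combination a y * this

theorem ed_add_ne (hL : 3 ≤ L) (d d' : Bool) : (ed d : Tor L) + ed d' ≠ 0 := by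
  have h1 : (1 : ZMod L) ≠ 0 := by
    have : Fact (1 < L) := ⟨by omega⟩
    exact one_ne_zero
  have h2 : (1 + 1 : ZMod L) ≠ 0 := by
    intro h
    have : ((2 : ℕ) : ZMod L) = 0 := by push_cast; rw [← h]; norm_num
    rw [ZMod.natCast_eq_zero_iff] at this
    exact absurd (Nat.le_of_dvd (by norm_num) this) (by omega)
  cases d <;> cases d' <;> simp [ed, Prod.ext_iff, h1, h2]

theorem ed_inj (hL : 3 ≤ L) {d d' : Bool} (h : (ed d : Tor L) = ed d') : d = d' := by
  have h1 : (1 : ZMod L) ≠ 0 := by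
    have : Fact (1 < L) := ⟨by omega⟩
    exact one_ne_zero
  revert h; cases d <;> cases d' <;> simp [ed, h1, Prod.ext_iff]

theorem Emb.cov (E : Emb N L M ρ) (hL : 3 ≤ L) {m : ℕ} (hm : 1 ≤ m) (e e' : Tor L × Bool) (k k' : Fin (m - 1)) :
    (if (Sum.inr (e.1, e.2, k) : XX L m) ∈ TT N m M ∧ (Sum.inr (e'.1, e'.2, k') : XX L m) ∈ TT N m M then
      m2Cov N (gg N m M (.inr (e.1, e.2, k))) (gg N m M (.inr (e'.1, e'.2, k'))) else 0) =
    if e' = e ∧ e ∈ EE N M then bc m (k + 1) (k' + 1) else 0 := by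
  have hm' : (m : ℝ) ≠ 0 := by positivity
  obtain ⟨x, d⟩ := e
  obtain ⟨x', d'⟩ := e'
  simp only [TT, EE, gg, m2Cov, Finset.mem_filter, Finset.mem_univ, true_and, if_true, edgeLen]
  by_cases h1 : x ∈ MB N M ∧ x + ed d ∈ MB N M
  swap
  · simp [h1]
  by_cases h2 : x' ∈ MB N M ∧ x' + ed d' ∈ MB N M
  swap
  · rw [if_neg (by tauto), if_neg]
    rintro ⟨h, -⟩
    simp only [Prod.mk.injEq] at h
    obtain ⟨rfl, rfl⟩ := h
    exact h2 h1
  have ii : ∀ y y', y ∈ MB N M → y' ∈ MB N M → iv N M y = iv N M y' → y = y' := by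
    intro y y' hy hy' h
    rw [← (iv_box hy).2, h, (iv_box hy').2]
  rw [if_pos ⟨h1, h2⟩]
  by_cases he : x = x' ∧ d = d'
  · obtain ⟨rfl, rfl⟩ := he
    rw [if_pos ⟨rfl, rfl⟩, if_pos ⟨rfl, h1⟩]
    unfold bridgeCov bc
    rw [show min (4 * ((k + 1 : ℕ) : ℝ) / m) (4 * ((k' + 1 : ℕ) : ℝ) / m) = 4 / m * min ((k + 1 : ℕ) : ℝ) ((k' + 1 : ℕ) : ℝ) from ?_]
    · field_simp; ring
    · rw [mul_min_of_nonneg _ _ (by positivity)]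
      congr 1 <;> ring
  · rw [if_neg, if_neg, if_neg]
    · rintro ⟨h, -⟩
      simp only [Prod.mk.injEq] at h
      exact he ⟨h.1.symm, h.2.symm⟩
    · rintro ⟨a, b⟩
      have a' := ii _ _ h1.1 h2.2 a
      have b' := ii _ _ h1.2 h2.1 b
      refine ed_add_ne hL d' d ?_
      rw [a', add_assoc] at b'
      simpa using b'
    · rintro ⟨a, b⟩
      have a' := ii _ _ h1.1 h2.1 a
      have b' := ii _ _ h1.2 h2.2 b
      subst a'
      exact he ⟨rfl, ed_inj hL (add_left_cancel b')⟩

theorem Emb.box_dens (E : Emb N L M ρ) (hL : 3 ≤ L) {m : ℕ} (hm : 1 ≤ m)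
    {Ω : Type} [MeasurableSpace Ω] {P : Measure Ω} {f : M2Idx → Ω → ℝ} (h : IsGaussFam P f (m2Cov N) (m2Valid N)) :
    ∃ (κ : ENNReal) (Y : Finset (XX L m)), ∀ F : (XX L m → ℝ) → ENNReal, Measurable F →
      ∫⁻ b, F (sh m 1 b) ∂(P.map fun ω i => if i ∈ TT N m M then f (gg N m M i) ω else 0) =
        κ * (∫⋯∫⁻_Y, fun u => F u * ENNReal.ofReal (Real.exp (-(En m u + 0 * mn (vx u) ^ 2) / 2)) ∂fun _ => volume) 0 := by
  have hm' : (0 : ℝ) < m := by positivity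
  have hi : Set.InjOn (gg N m M) (TT N m M) := by
    intro i hi j hj hij
    simp only [TT, Finset.coe_filter, Finset.mem_univ, true_and, Set.mem_setOf_eq] at hi hj
    rcases i with y | ⟨x, d, k⟩ <;> rcases j with y' | ⟨x', d', k'⟩ <;> simp only [gg, Sum.inl.injEq, Sum.inr.injEq, reduceCtorEq, Prod.mk.injEq] at hi hj hij ⊢
    · rw [← (iv_box hi).2, hij, (iv_box hj).2]
    · obtain ⟨a, b, -, c⟩ := hij
      have a' : x = x' := by rw [← (iv_box hi.1).2, a, (iv_box hj.1).2]
      have b' : x + ed d = x' + ed d' := by rw [← (iv_box hi.2).2, b, (iv_box hj.2).2]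
      subst a'
      refine ⟨rfl, ed_inj hL (add_left_cancel b'), ?_⟩
      field_simp at c
      ext
      have : ((k : ℕ) + 1) = ((k' : ℕ) + 1) := by exact_mod_cast c
      omega
  have hS : ∀ i ∈ TT N m M, gg N m M i ∈ m2Valid N := by
    intro i hi
    simp only [TT, Finset.mem_filter, Finset.mem_univ, true_and] at hi
    rcases i with y | ⟨x, d, k⟩
    · exact (iv_box hi).1
    · have h1 := iv_box hi.1
      have h2 := iv_box hi.2
      refine ⟨h1.1, h2.1, ?_, by positivity, ?_⟩
      · rw [E.edge h1.1 h2.1 (d := d) (by rw [h1.2, h2.2])]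
        exact E.radj _ _
      · simp only [edgeLen, if_true]
        rw [div_le_iff₀ hm']
        have : ((k + 1 : ℕ) : ℝ) ≤ m := by exact_mod_cast (by omega)
        linarith
  have G := gaussFam_isG h (TT N m M) (gg N m M) hi hS
  have hd := dens_sh hm 0 le_rfl (SS N M) (EE N M) ?_ (KV N M) (fun a x hx => if_neg hx) ?_
    (ν := P.map fun ω i => if i ∈ TT N m M then f (gg N m M i) ω else 0) ?_
  · obtain ⟨κ, -, -, hκ⟩ := hd
    exact ⟨κ, _, hκ⟩
  · intro e he
    simp only [EE, Finset.mem_filter, Finset.mem_univ, true_and]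
    rcases he with he | he <;> obtain ⟨u, hu, hue⟩ := Finset.mem_image.1 he <;> rw [Finset.mem_sdiff] at hu <;>
      have hn := nbr_box hu.1 hu.2
    · rw [← hue, ← E.step]
      exact ⟨Finset.mem_image_of_mem _ hu.1, Finset.mem_image_of_mem _ (hn _ (E.nbm u _).1)⟩
    · refine ⟨?_, hue ▸ Finset.mem_image_of_mem _ hu.1⟩
      have : M (u - ρ e.2) = e.1 := by
        have := E.step (u - ρ e.2) e.2
        rw [sub_add_cancel, hue] at this
        exact (add_right_cancel this).symm
      exact this ▸ Finset.mem_image_of_mem _ (hn _ (E.nbm u _).2)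
  · intro a g hg
    rw [zero_mul, add_zero, ← green_id]
    refine Finset.sum_congr rfl fun x _ => ?_
    by_cases hx : x ∈ SS N M
    · obtain ⟨u, hu, rfl⟩ := Finset.mem_image.1 hx
      rw [Finset.mem_sdiff] at hu
      rw [E.lap a hu.1 hu.2, mul_comm]
    · rw [hg x hx]; simp
  · intro c
    rw [G c]
    congr 2
    beta_reduce
    rw [Fintype.sum_sum_type]
    simp only [Fintype.sum_sum_type]
    congr 1
    · refine Finset.sum_congr rfl fun x _ => ?_
      rw [show ∑ p : Tor L × Bool × Fin (m - 1), _ = (0 : ℝ) from Finset.sum_eq_zero fun p _ => by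
        obtain ⟨x, d, k⟩ := p; simp [gg, m2Cov], add_zero]
      by_cases hx : x ∈ MB N M
      · obtain ⟨u, hu, rfl⟩ := Finset.mem_image.1 hx
        rw [E.kvM _ hu, Finset.mul_sum, Finset.mul_sum]
        rw [← Finset.sum_subset (Finset.subset_univ (MB N M))]
        · refine Finset.sum_congr rfl fun y hy => ?_
          rw [if_pos ⟨by simpa [TT] using hx, by simpa [TT] using hy⟩]
          simp only [gg, m2Cov, gffCov]
          rw [if_pos ⟨(iv_box hx).1, (iv_box hy).1⟩, E.ivM hu]
          simp only [vx]; ring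
        · intro y _ hy
          rw [if_neg, mul_zero]
          simp [TT, hy]
      · have : x ∉ SS N M := fun h => hx (Finset.image_subset_image Finset.sdiff_subset h)
        simp [KV, this, TT, hx]
    · have z : ∀ p : Tor L × Bool × Fin (m - 1), ∑ x : Tor L, c (.inr p) * c (.inl x) *
          (if (Sum.inr p : XX L m) ∈ TT N m M ∧ Sum.inl x ∈ TT N m M then m2Cov N (gg N m M (.inr p)) (gg N m M (.inl x)) else 0) = 0 := by
        intro p
        exact Finset.sum_eq_zero fun x _ => by obtain ⟨x, d, k⟩ := p; simp [gg, m2Cov]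
      simp only [z, zero_add]
      have as : ∀ F : Tor L × Bool × Fin (m - 1) → ℝ, ∑ p, F p = ∑ e : Tor L × Bool, ∑ k, F (e.1, e.2, k) := by
        intro F; simp only [Fintype.sum_prod_type]
      simp only [as]
      simp only [E.cov hL hm]
      rw [← Finset.sum_subset (Finset.subset_univ (EE N M))]
      · refine Finset.sum_congr rfl fun e he => Finset.sum_congr rfl fun k _ => ?_
        rw [Finset.sum_eq_single e]
        · simp [he]
        · intro e' _ hne; simp [hne]
        · simp
      · intro e _ he; simp [he]
end emb

theorem cond_reduce {Ω : Type} {mΩ : MeasurableSpace Ω} {P : Measure Ω} [IsProbabilityMeasure P]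
    (m : MeasurableSpace Ω) (hm : m ≤ mΩ) {f : Ω → ℝ} (hf : Integrable f P) {H R : Set Ω} (mH : MeasurableSet[mΩ] H)
    (mR : MeasurableSet[m] R) {c C0 : ℝ} (hC : 0 ≤ C0)
    (h : ∀ A, MeasurableSet[m] A → A ⊆ R →
      ∫⁻ ω in A ∩ H, ENNReal.ofReal (f ω - c) ∂P ≤ ENNReal.ofReal C0 * P (A ∩ H)) :
    ∀ᵐ ω ∂P, ω ∈ R → (P[H.indicator (fun ω => f ω) | m]) ω ≤ (c + C0) * (P[H.indicator (fun _ => (1 : ℝ)) | m]) ω := by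
  have i1 : Integrable (H.indicator fun ω => f ω) P := hf.indicator mH
  have i2 : Integrable (H.indicator fun _ => (1 : ℝ)) P := (integrable_const _).indicator mH
  have e1 := condExp_sub (i2.smul (c + C0)) i1 m
  have e2 := condExp_smul (μ := P) (c + C0) (H.indicator fun _ => (1 : ℝ)) m
  set g : Ω → ℝ := (c + C0) • (H.indicator fun _ => (1 : ℝ)) - H.indicator fun ω => f ω with hg
  have ig : Integrable g P := (i2.smul (c + C0)).sub i1
  have mc : Measurable[m] (P[g | m]) := stronglyMeasurable_condExp.measurable
  let A : Set Ω := R ∩ {ω | (P[g | m]) ω < 0}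
  have mA : MeasurableSet[m] A := mR.inter (mc measurableSet_Iio)
  have key : 0 ≤ ∫ ω in A, g ω ∂P := by
    have hA := h A mA inter_subset_left
    have : ∫ ω in A, g ω ∂P = ∫ ω in A ∩ H, (c + C0 - f ω) ∂P := by
      rw [← setIntegral_indicator mH]
      congr 1
      funext ω
      by_cases hω : ω ∈ H <;> simp [hg, hω]
    rw [this]
    have ifr : Integrable (fun ω => f ω - c) (P.restrict (A ∩ H)) := (hf.sub (integrable_const c)).restrict
    have : ∫ ω in A ∩ H, (c + C0 - f ω) ∂P = C0 * (P (A ∩ H)).toReal - ∫ ω in A ∩ H, (f ω - c) ∂P := by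
      rw [show (fun ω => c + C0 - f ω) = fun ω => C0 - (f ω - c) by funext; ring, integral_sub (integrable_const _) ifr]
      simp [Measure.real, mul_comm]
    rw [this, integral_eq_lintegral_pos_part_sub_lintegral_neg_part ifr]
    have t1 := ENNReal.toReal_mono (ENNReal.mul_ne_top ENNReal.ofReal_ne_top (measure_ne_top _ _)) hA
    rw [ENNReal.toReal_mul, ENNReal.toReal_ofReal hC] at t1
    have t2 : 0 ≤ (∫⁻ ω in A ∩ H, ENNReal.ofReal (-(f ω - c)) ∂P).toReal := ENNReal.toReal_nonneg
    linarith
  have z : P A = 0 := by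
    have k1 : ∫ ω in A, -(P[g | m]) ω ∂P = -∫ ω in A, g ω ∂P := by
      rw [integral_neg, setIntegral_condExp hm ig mA]
    have nn : 0 ≤ᵐ[P.restrict A] fun ω => -(P[g | m]) ω :=
      (ae_restrict_iff' (hm _ mA)).2 (Filter.Eventually.of_forall fun ω hω => by
        have := hω.2; simp only [Set.mem_setOf_eq] at this; simp only [Pi.zero_apply]; linarith)
    have k2 : ∫ ω in A, -(P[g | m]) ω ∂P = 0 :=
      le_antisymm (by linarith) (integral_nonneg_of_ae nn)
    rw [setIntegral_eq_zero_iff_of_nonneg_ae nn integrable_condExp.neg.integrableOn,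
      Filter.EventuallyEq, ae_restrict_iff' (hm _ mA)] at k2
    refine measure_mono_null (fun ω hω => ?_) k2
    intro hh
    have h1 := hh hω
    have h2 := hω.2
    simp only [Set.mem_setOf_eq, Pi.zero_apply, neg_eq_zero] at h1 h2
    linarith
  filter_upwards [e1, e2, measure_eq_zero_iff_ae_notMem.1 z] with ω h1 h2 h3 hR
  have : 0 ≤ (P[g | m]) ω := by
    by_contra hh
    exact h3 ⟨hR, not_le.1 hh⟩
  rw [h1, Pi.sub_apply, h2] at this
  simpa using this

theorem pval_symm {Ω : Type} [MeasurableSpace Ω] {N : ℕ} (hN : 1 ≤ N) {P : Measure Ω} {η : ℤ × ℤ → Ω → ℝ}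
    {brg : (ℤ × ℤ) → (ℤ × ℤ) → Bool → ℝ → Ω → ℝ} (hG : IsMetricGFF2 N P η brg) (u u' : ℤ × ℤ) {j : ℕ}
    (hj : j ≤ N ^ 3) (ω : Ω) : pval N η brg (u, u', j) ω = pval N η brg (u', u, N ^ 3 - j) ω := by
  have hN' : (N : ℝ) ^ 3 ≠ 0 := by positivity
  unfold pval mval2
  rw [hG.2.2.2.1]
  simp only [edgeLen, if_true]
  rw [Nat.cast_sub hj]
  push_cast
  rw [show 4 * ((N : ℝ) ^ 3 - j) / (N : ℝ) ^ 3 = 4 - 4 * j / (N : ℝ) ^ 3 by field_simp]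
  ring

section fin
variable {L : ℕ} [NeZero L] {N : ℕ} {M : ℤ × ℤ → Tor L} {ρ : Bool → ℤ × ℤ}

def b0 {Ω : Type} (N m : ℕ) (M : ℤ × ℤ → Tor L) (f : M2Idx → Ω → ℝ) (ω : Ω) (i : XX L m) : ℝ :=
  if i ∈ TT N m M then f (gg N m M i) ω else 0

theorem Emb.vtx (E : Emb N L M ρ) {m : ℕ} {Ω : Type} {η : ℤ × ℤ → Ω → ℝ}
    {brg : (ℤ × ℤ) → (ℤ × ℤ) → Bool → ℝ → Ω → ℝ} {u : ℤ × ℤ} (hu : u ∈ box N) (ω : Ω) :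
    b0 N m M (m2fam η brg) ω (.inl (M u)) = η u ω := by
  unfold b0
  rw [if_pos (by simp only [TT, Finset.mem_filter, Finset.mem_univ, true_and]; exact Finset.mem_image_of_mem _ hu)]
  simp [gg, E.ivM hu, m2fam]

theorem Emb.pval_pt (E : Emb N L M ρ) (hN : 1 ≤ N) {Ω : Type} [MeasurableSpace Ω] {P : Measure Ω} {η : ℤ × ℤ → Ω → ℝ}
    {brg : (ℤ × ℤ) → (ℤ × ℤ) → Bool → ℝ → Ω → ℝ} (hG : IsMetricGFF2 N P η brg) {u u' : ℤ × ℤ} (hu : u ∈ box N)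
    (hu' : u' ∈ box N) {d : Bool} (h : M u' = M u + ed d) {j : ℕ} (hj : j ≤ N ^ 3) (ω : Ω) :
    pval N η brg (u, u', j) ω = sh (N ^ 3) 1 (b0 N (N ^ 3) M (m2fam η brg) ω) (pt (N ^ 3) (M u, d) j) := by
  have hN' : (N : ℝ) ^ 3 ≠ 0 := by positivity
  rw [sh_pt (Nat.one_le_pow _ _ hN) _ _ _ hj]
  unfold pval mval2 lin
  simp only [vx, ← h, E.vtx hu, E.vtx hu', edgeLen, if_true]
  have e : (4 * (j : ℝ) / (N : ℝ) ^ 3) / 4 = (j : ℝ) / ((N ^ 3 : ℕ) : ℝ) := by push_cast; ring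
  rw [e]
  congr 1
  unfold bv
  split_ifs with hjj
  · unfold b0
    rw [if_pos]
    · simp only [gg, m2fam, ← h, E.ivM hu, E.ivM hu']
      rw [Nat.sub_add_cancel hjj.1]
      push_cast; rfl
    · simp only [TT, Finset.mem_filter, Finset.mem_univ, true_and, ← h]
      exact ⟨Finset.mem_image_of_mem _ hu, Finset.mem_image_of_mem _ hu'⟩
  · rcases Nat.eq_zero_or_pos j with rfl | h0
    · simp [hG.2.1]
    · have : j = N ^ 3 := by omega
      have h4 := hG.2.2.1 u u' true ω
      simp only [edgeLen, if_true] at h4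
      rw [this]; push_cast
      rw [mul_div_assoc, div_self hN', mul_one, h4]

theorem Emb.pts (E : Emb N L M ρ) (hN : 1 ≤ N) {Ω : Type} [MeasurableSpace Ω] {P : Measure Ω} {η : ℤ × ℤ → Ω → ℝ}
    {brg : (ℤ × ℤ) → (ℤ × ℤ) → Bool → ℝ → Ω → ℝ} (hG : IsMetricGFF2 N P η brg) :
    ∃ pp : PPt → XX L (N ^ 3), ∀ q, pValid N q → ∀ ω,
      pval N η brg q ω = sh (N ^ 3) 1 (b0 N (N ^ 3) M (m2fam η brg) ω) (pp q) := by
  refine Classical.axiom_of_choice (r := fun q p => pValid N q → ∀ ω,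
      pval N η brg q ω = sh (N ^ 3) 1 (b0 N (N ^ 3) M (m2fam η brg) ω) p) ?_
  rintro ⟨u, u', j⟩
  by_cases hv : pValid N (u, u', j)
  swap
  · exact ⟨.inl 0, fun h => absurd h hv⟩
  obtain ⟨hu, hu', ha, hj⟩ := hv
  obtain ⟨d, h | h⟩ := E.adjr u u' ha
  · exact ⟨_, fun _ ω => E.pval_pt hN hG hu hu' (by rw [← E.step, h]) hj ω⟩
  · exact ⟨_, fun _ ω => by
      rw [pval_symm hN hG _ _ hj]
      exact E.pval_pt hN hG hu' hu (by rw [← E.step, h]) (Nat.sub_le _ _) ω⟩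

theorem Emb.main (E : Emb N L M ρ) (hL : 3 ≤ L) (hN : 1 ≤ N) {Ω : Type} [mΩ : MeasurableSpace Ω] {P : Measure Ω}
    {η : ℤ × ℤ → Ω → ℝ} {brg : (ℤ × ℤ) → (ℤ × ℤ) → Bool → ℝ → Ω → ℝ} (hG : IsMetricGFF2 N P η brg)
    {lam C1 : ℝ} (hlam : 0 < lam) {Ip Im Bp Bm : Finset PPt} {Bz : Finset (ℤ × ℤ)}
    (hval : ∀ q ∈ Ip ∪ Im ∪ Bp ∪ Bm, pValid N q) (hBz : Bz ⊆ box N) {p q v : ℤ × ℤ} {j : ℕ} {w : PPt}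
    (hp : p ∈ box N) (hq : q ∈ box N) (hj : 2 * j ≤ N ^ 3) (hv : v = p ∨ v = q) (hw : w ∈ Bp ∪ Bm)
    (hwp : ∀ ω, pval N η brg w ω = pval N η brg (p, q, j) ω) (hpq : M q = M p + ed true)
    (hy : ∀ (a : ℝ) (v : Tor L), v = M p ∨ v = M p + ed true →
      ∀ x : XX L (N ^ 3) → ℝ, x (pt (N ^ 3) (M p, true) j) = a + 4 * C1 →
        (∫⋯∫⁻_Finset.univ.erase (pt (N ^ 3) (M p, true) j), fun u =>
          ENNReal.ofReal (u (Sum.inl v) - a) * (UU (N ^ 3) j (4 * C1) a (M p)).indicator (wt (N ^ 3)) u ∂fun _ => volume) x ≤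
          ENNReal.ofReal (52 * C1) * (∫⋯∫⁻_Finset.univ.erase (pt (N ^ 3) (M p, true) j),
            (UU (N ^ 3) j (4 * C1) a (M p)).indicator (wt (N ^ 3)) ∂fun _ => volume) x ∧
        (∫⋯∫⁻_Finset.univ.erase (pt (N ^ 3) (M p, true) j),
            (UU (N ^ 3) j (4 * C1) a (M p)).indicator (wt (N ^ 3)) ∂fun _ => volume) x ≠ 0 ∧
        (∫⋯∫⁻_Finset.univ.erase (pt (N ^ 3) (M p, true) j),
            (UU (N ^ 3) j (4 * C1) a (M p)).indicator (wt (N ^ 3)) ∂fun _ => volume) x ≠ ⊤)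
    (A : Set Ω) (mA : MeasurableSet[condSigma N η brg Bz Bp Bm] A) (hA : A ⊆ eventRng N η brg lam Bz Bp Bm) :
    ∫⁻ ω in A ∩ eventH N η brg lam Ip Im, ENNReal.ofReal (η v ω - (lam + 1 / N)) ∂P ≤
      ENNReal.ofReal (52 * C1) * P (A ∩ eventH N η brg lam Ip Im) := by
  obtain ⟨κ, Y, hκ⟩ := E.box_dens hL (Nat.one_le_pow 3 _ hN) hG.1
  obtain ⟨pp, hpp⟩ := E.pts hN hG
  obtain ⟨T, mT, rfl⟩ := mA
  have hvb : v ∈ box N := by rcases hv with rfl | rfl <;> assumption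
  have ha : (0 : ℝ) ≤ lam + 1 / N := by positivity
  set a : ℝ := lam + 1 / N with ha'
  let X : Ω → XX L (N ^ 3) → ℝ := fun ω => sh (N ^ 3) 1 (b0 N (N ^ 3) M (m2fam η brg) ω)
  let Φ : (XX L (N ^ 3) → ℝ) → ({x // x ∈ Bz} → ℝ) × ({q // q ∈ Bp ∪ Bm} → ℝ) :=
    fun u => (fun x => u (.inl (M x.1)), fun q => u (pp q.1))
  have mΦ : Measurable Φ := by fun_prop
  let Bs : Finset (XX L (N ^ 3)) := insert (pt (N ^ 3) (M p, true) j) (Bz.image (fun x => .inl (M x)) ∪ (Bp ∪ Bm).image pp)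
  let A' : Set (XX L (N ^ 3) → ℝ) := Φ ⁻¹' T ∩ {u | ∀ p ∈ Bs, u p ≤ a}
  have mA' : MeasurableSet A' := by
    refine (mΦ mT).inter ?_
    rw [show {u : XX L (N ^ 3) → ℝ | ∀ p ∈ Bs, u p ≤ a} = ⋂ p ∈ Bs, {u | u p ≤ a} by ext; simp]
    exact Finset.measurableSet_biInter _ fun p _ => measurableSet_le (measurable_pi_apply p) measurable_const
  have vB : ∀ q ∈ Bp ∪ Bm, pValid N q := fun q hq => hval q (by simp only [Finset.mem_union] at hq ⊢; tauto)
  have hX1 : ∀ x ∈ Bz, ∀ ω, X ω (.inl (M x)) = η x ω := fun x hx ω => E.vtx (hBz hx) ω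
  have hX2 : ∀ q ∈ Bp ∪ Bm, ∀ ω, X ω (pp q) = pval N η brg q ω := fun q hq ω => (hpp q (vB q hq) ω).symm
  have hX3 : ∀ ω, X ω (pt (N ^ 3) (M p, true) j) = pval N η brg w ω := fun ω => by
    rw [hwp]; exact (E.pval_pt hN hG hp hq hpq (by omega) ω).symm
  have hΦ : ∀ ω, Φ (X ω) = ((fun x : {x // x ∈ Bz} => η x.1 ω), (fun q : {q // q ∈ Bp ∪ Bm} => pval N η brg q.1 ω)) := by
    intro ω
    exact Prod.ext (funext fun x => hX1 x.1 x.2 ω) (funext fun q => hX2 q.1 q.2 ω)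
  have hle : ∀ ω ∈ eventRng N η brg lam Bz Bp Bm, ∀ q ∈ Bp ∪ Bm, pval N η brg q ω ≤ a := by
    intro ω hω q hq
    rcases Finset.mem_union.1 hq with h | h
    · exact (hω.2.1 q h).2
    · have := (hω.2.2 q h).2; linarith
  have hmem : ∀ ω, ω ∈ (fun ω => ((fun x : {x // x ∈ Bz} => η x.1 ω),
      (fun q : {q // q ∈ Bp ∪ Bm} => pval N η brg q.1 ω))) ⁻¹' T ∩ eventH N η brg lam Ip Im ↔
      X ω ∈ A' ∩ HH a (Ip.image pp) (Im.image pp) := by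
    intro ω
    refine and_congr ⟨fun h => ⟨?_, ?_⟩, fun h => ?_⟩ ?_
    · change Φ (X ω) ∈ T; rw [hΦ]; exact h
    · have hr := hA h
      intro z hz
      simp only [Bs, Finset.mem_insert, Finset.mem_union, Finset.mem_image] at hz
      rcases hz with rfl | ⟨x, hx, rfl⟩ | ⟨q, hq, rfl⟩
      · rw [hX3]; exact hle ω hr w hw
      · rw [hX1 x hx]; exact (abs_le.1 (hr.1 x hx)).2
      · rw [← Finset.mem_union] at hq
        rw [hX2 q hq]; exact hle ω hr q hq
    · have := h.1
      change Φ (X ω) ∈ T at this; rw [hΦ] at this; exact this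
    · simp only [eventH, HH, Set.mem_setOf_eq, Finset.forall_mem_image]
      refine and_congr (forall₂_congr fun q hq => ?_) (forall₂_congr fun q hq => ?_)
      · rw [hpp q (hval q (by simp [hq]))]
      · rw [hpp q (hval q (by simp [hq]))]
  have mf := hG.1.1
  have mb : Measurable (b0 N (N ^ 3) M (m2fam η brg)) :=
    measurable_pi_lambda _ fun i => by unfold b0; split_ifs <;> fun_prop
  have ms : Measurable (sh (N ^ 3) 1 : (XX L (N ^ 3) → ℝ) → _) := by
    refine measurable_pi_lambda _ fun i => ?_
    rcases i with x | ⟨x, d, k⟩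
    · exact measurable_pi_apply _
    · simp only [sh, lin, vx]; fun_prop
  have mS : MeasurableSet (A' ∩ HH a (Ip.image pp) (Im.image pp)) := mA'.inter (HH_meas _ _ _)
  have hc := core (ν := P.map (b0 N (N ^ 3) M (m2fam η brg))) (C := ENNReal.ofReal (52 * C1)) (h := 4 * C1) (y := M p) (v := M v) (j := j) ha (Ip.image pp) (Im.image pp) Bs Y
    (Finset.mem_insert_self _ _) (hy a (M v) (by rcases hv with rfl | rfl <;> simp [hpq])) hκ A' mA' ?_ (fun u hu => hu.2)
  · rw [lintegral_map (f := fun b => (A' ∩ HH a (Ip.image pp) (Im.image pp)).indicator (fun u => ENNReal.ofReal (u (Sum.inl (M v)) - a)) (sh (N ^ 3) 1 b))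
        ((Measurable.indicator (by fun_prop) mS).comp ms) mb,
      lintegral_map (f := fun b => (A' ∩ HH a (Ip.image pp) (Im.image pp)).indicator (fun u => 1) (sh (N ^ 3) 1 b))
        ((Measurable.indicator (by fun_prop) mS).comp ms) mb] at hc
    have mS' := (ms.comp mb) mS
    rw [show (fun ω => ((fun x : {x // x ∈ Bz} => η x.1 ω),
      (fun q : {q // q ∈ Bp ∪ Bm} => pval N η brg q.1 ω))) ⁻¹' T ∩ eventH N η brg lam Ip Im =
      (sh (N ^ 3) 1 ∘ b0 N (N ^ 3) M (m2fam η brg)) ⁻¹' (A' ∩ HH a (Ip.image pp) (Im.image pp)) from Set.ext hmem]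
    rw [← lintegral_indicator mS', ← lintegral_indicator_one mS']
    refine le_trans (le_of_eq ?_) (hc.trans (le_of_eq ?_))
    · refine lintegral_congr fun ω => ?_
      rw [show (fun ω => ENNReal.ofReal (η v ω - a)) = fun ω => ENNReal.ofReal (b0 N (N ^ 3) M (m2fam η brg) ω (.inl (M v)) - a)
        from funext fun ω => by rw [E.vtx hvb]]
      rfl
    · rfl
  · rintro u u' h ⟨h1, h2⟩
    refine ⟨?_, fun z hz => (h z hz) ▸ h2 z hz⟩
    change Φ u' ∈ T
    rw [show Φ u' = Φ u from ?_]
    · exact h1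
    · refine Prod.ext (funext fun x => (h _ ?_).symm) (funext fun q => (h _ ?_).symm)
      · exact Finset.mem_insert_of_mem (Finset.mem_union_left _ (Finset.mem_image_of_mem _ x.2))
      · exact Finset.mem_insert_of_mem (Finset.mem_union_right _ (Finset.mem_image_of_mem _ q.2))
end fin

theorem box_mono {n N : ℕ} (h : n ≤ N) : box n ⊆ box N := by
  intro u hu
  simp only [box, Finset.mem_product, Finset.mem_Icc] at hu ⊢
  omega

theorem rng_meas {Ω : Type} [MeasurableSpace Ω] (N : ℕ) (η : ℤ × ℤ → Ω → ℝ)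
    (brg : (ℤ × ℤ) → (ℤ × ℤ) → Bool → ℝ → Ω → ℝ) (lam : ℝ) (Bz : Finset (ℤ × ℤ)) (Bp Bm : Finset PPt) :
    MeasurableSet[condSigma N η brg Bz Bp Bm] (eventRng N η brg lam Bz Bp Bm) := by
  refine ⟨{z | (∀ x, |z.1 x| ≤ lam + 1 / N) ∧ (∀ q, (q.1 ∈ Bp → lam < z.2 q ∧ z.2 q ≤ lam + 1 / N)) ∧
    ∀ q, (q.1 ∈ Bm → -(lam + 1 / N) ≤ z.2 q ∧ z.2 q < -lam)}, ?_, ?_⟩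
  · simp only [Set.setOf_and, Set.setOf_forall]
    refine (MeasurableSet.iInter fun x => measurableSet_le (by fun_prop) measurable_const).inter
      ((MeasurableSet.iInter fun q => MeasurableSet.iInter fun _ => ?_).inter
        (MeasurableSet.iInter fun q => MeasurableSet.iInter fun _ => ?_))
    · exact (measurableSet_lt measurable_const (by fun_prop)).inter (measurableSet_le (by fun_prop) measurable_const)
    · exact (measurableSet_le measurable_const (by fun_prop)).inter (measurableSet_lt (by fun_prop) measurable_const)
  · ext ω
    simp only [eventRng, Set.mem_preimage, Set.mem_setOf_eq, Subtype.forall, Finset.mem_union]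
    refine and_congr Iff.rfl (and_congr ⟨fun h q hq => h q (Or.inl hq) hq, fun h q _ hq => h q hq⟩
      ⟨fun h q hq => h q (Or.inr hq) hq, fun h q _ hq => h q hq⟩)

theorem scale_exists : ∃ C1 : ℝ, 0 < C1 ∧ ∀ N : ℕ, ∃ (L : ℕ) (_ : NeZero L), N + 2 ≤ L ∧
    ∀ m, 1 ≤ m → Psi L m ≤ cT L + C1 := by
  obtain ⟨C, k, hΨ⟩ := Psi_bound
  refine ⟨|C| + (3 * (k : ℝ) + 1), by positivity, fun N => ?_⟩
  obtain ⟨n, hn, hcT⟩ := good_scale k (N + 2)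
  refine ⟨2 ^ n, inferInstance, hn.trans Nat.lt_two_pow_self.le, fun m hm => ?_⟩
  have := hΨ (2 ^ n) m (2 ^ (n + k)) hm (by rw [pow_add, mul_comm])
  have := le_abs_self C
  linarith

theorem stmt13 (α β lam : ℝ) (hα : 0 < α) (hαβ : α < β) (hβ : β < 1) (hlam : 0 < lam) :
    ∃ C₀ > (0 : ℝ), ∀ N : ℕ, 1 ≤ N →
      ∀ (Ω : Type) (_ : MeasurableSpace Ω) (P : Measure Ω), IsProbabilityMeasure P →
        ∀ (η : ℤ × ℤ → Ω → ℝ) (brg : (ℤ × ℤ) → (ℤ × ℤ) → Bool → ℝ → Ω → ℝ),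
          IsMetricGFF2 N P η brg →
          ∀ (Ip Im Bp Bm : Finset PPt) (B0 : Finset (ℤ × ℤ)),

            (∀ q ∈ Ip ∪ Im ∪ Bp ∪ Bm, pValid N q) →
            (∀ q ∈ Ip ∪ Im, outsideAlpha α N q) →
            (∀ q ∈ Ip ∪ Im ∪ Bp ∪ Bm, q.1 ∈ boxR (β * N) ∧ q.2.1 ∈ boxR (β * N)) →
            B0 ⊆ bdryR (α * N) →

            0 < P (eventRng N η brg lam B0 Bp Bm ∩ eventH N η brg lam Ip Im) →

            ∀ v : ℤ × ℤ, v ∈ box N → v ∉ boxR (α * N) →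
              (∃ q ∈ Ip ∪ Im, (q.1 = v ∧ q.2.2 = 0) ∨ (q.2.1 = v ∧ q.2.2 = N ^ 3)) →
              (∃ v' : ℤ × ℤ, ∃ j : ℕ, adj v v' ∧ v' ∈ box N ∧ j ≤ N ^ 3 ∧
                ((v, v', j) ∈ Bp ∪ Bm ∨ (v', v, j) ∈ Bp ∪ Bm)) →
              ∀ᵐ ω ∂P, ω ∈ eventRng N η brg lam B0 Bp Bm →
                (P[(eventH N η brg lam Ip Im).indicator (fun ω' => η v ω') |
                    condSigma N η brg B0 Bp Bm]) ω ≤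
                  (lam + 1 / N + C₀) *
                    (P[(eventH N η brg lam Ip Im).indicator (fun _ => (1 : ℝ)) |
                        condSigma N η brg B0 Bp Bm]) ω := by
  obtain ⟨C1, hC1, hs⟩ := scale_exists
  refine ⟨52 * C1, by positivity, ?_⟩
  intro N hN Ω mΩ P hP η brg hG Ip Im Bp Bm Bz hval _ _ hBz _ v hv _ _ ⟨v', j₀, hadj, hv', hj₀, hw⟩
  have hsym : adj v' v := by unfold adj at hadj ⊢; rw [abs_sub_comm, abs_sub_comm v'.2]; exact hadj
  have hBz' : Bz ⊆ box N := by
    refine hBz.trans ((Finset.filter_subset _ _).trans (box_mono (Nat.floor_le_of_le ?_)))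
    have : (0 : ℝ) ≤ N := Nat.cast_nonneg N
    nlinarith
  obtain ⟨p, q, j, w, hp, hq, hpq, hj, hvpq, hwB, hwp⟩ : ∃ (p q : ℤ × ℤ) (j : ℕ) (w : PPt), p ∈ box N ∧ q ∈ box N ∧
      adj p q ∧ 2 * j ≤ N ^ 3 ∧ (v = p ∨ v = q) ∧ w ∈ Bp ∪ Bm ∧ ∀ ω, pval N η brg w ω = pval N η brg (p, q, j) ω := by
    by_cases h2 : 2 * j₀ ≤ N ^ 3
    · rcases hw with hw | hw
      · exact ⟨v, v', j₀, _, hv, hv', hadj, h2, Or.inl rfl, hw, fun _ => rfl⟩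
      · exact ⟨v', v, j₀, _, hv', hv, hsym, h2, Or.inr rfl, hw, fun _ => rfl⟩
    · rcases hw with hw | hw
      · exact ⟨v', v, N ^ 3 - j₀, _, hv', hv, hsym, by omega, Or.inr rfl, hw, fun ω => pval_symm hN hG _ _ hj₀ ω⟩
      · exact ⟨v, v', N ^ 3 - j₀, _, hv, hv', hadj, by omega, Or.inl rfl, hw, fun ω => pval_symm hN hG _ _ hj₀ ω⟩
  obtain ⟨L, iL, hL, hΨ⟩ := hs N
  have hm1 : 1 ≤ N ^ 3 := Nat.one_le_pow _ _ hN
  have hΨ' := hΨ (N ^ 3) hm1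
  obtain ⟨y, hy⟩ := torus_slice hC1 hm1 hj hΨ'
  obtain ⟨M, ρ, E, rfl, hMq⟩ := emb_exists hL p q hpq y
  have mf := hG.1.1
  have mη : ∀ x, Measurable (η x) := fun x => mf (.inl x)
  have mb : ∀ u v b t, Measurable (brg u v b t) := fun u v b t => mf (.inr (u, v, b, t))
  have mp : ∀ q, Measurable (pval N η brg q) := by
    intro q
    have h1 := mη q.1
    have h2 := mη q.2.1
    have h3 := mb q.1 q.2.1 true (4 * (q.2.2 : ℝ) / (N : ℝ) ^ 3)
    unfold pval mval2
    fun_prop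
  have hint : Integrable (fun ω => η v ω) P := by
    have := hG.1.2 (Finsupp.single (.inl v) 1) (by
      intro i hi
      have := Finsupp.support_single_subset hi
      rw [Finset.mem_singleton] at this
      rw [this]; exact hv)
    rw [Finsupp.support_single_ne_zero _ one_ne_zero] at this
    simp only [Finset.sum_singleton, Finsupp.single_eq_same, one_mul] at this
    exact integrable_of_gauss (mη v) this
  have mH : MeasurableSet (eventH N η brg lam Ip Im) := by
    unfold eventH
    rw [Set.setOf_and]
    simp only [Set.setOf_forall]
    exact (Finset.measurableSet_biInter _ fun q _ => measurableSet_lt measurable_const (mp q)).inter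
      (Finset.measurableSet_biInter _ fun q _ => measurableSet_lt (mp q) measurable_const)
  have hσ : condSigma N η brg Bz Bp Bm ≤ mΩ := by
    refine Measurable.comap_le ?_
    have h1 : Measurable fun ω => (fun x : {x // x ∈ Bz} => η x.1 ω) := measurable_pi_iff.2 fun x => mη x.1
    have h2 : Measurable fun ω => (fun q : {q // q ∈ Bp ∪ Bm} => pval N η brg q.1 ω) := measurable_pi_iff.2 fun q => mp q.1
    exact Measurable.prodMk h1 h2
  have hmain := E.main (by omega) hN hG hlam hval hBz' hp hq hj hvpq hwB hwp hMq hy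
  exact cond_reduce _ hσ hint mH (rng_meas N η brg lam Bz Bp Bm) (by positivity) hmain

end
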